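/- Let μ, ν be nonnegative integers and set C(μ,ν) = (μ!·ν!/(μ+ν+4)!)·(binom(μ+ν+2, μ+1) − 1). There is a polynomial Q of degree μ+ν+4 with leading coefficient (6/π²)·C(μ,ν) such that for every ε > 0 and all t ≥ 2, Σ_{n≤t} d^{(μ)}(n)·d^{(ν)}(n)/n = Q(log t) + O_ε(t^{−1/2+ε}). -/

import Mathlib

open Complex

/-- `d^{(μ,ν)}(n) = Σ_{ab=n} (log a)^μ (log b)^ν`. -/
noncomputable def dGen (μ ν : ℕ) (n : ℕ) : ℝ :=
  ∑ x ∈ n.divisorsAntidiagonal, Real.log x.1 ^ μ * Real.log x.2 ^ ν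

/-- `d^{(μ)}(n) = d^{(μ,0)}(n)`. -/
noncomputable def dLog (μ : ℕ) (n : ℕ) : ℝ := dGen μ 0 n

open MeasureTheory Set in
lemma norm_integral_exp_interval_ge (n : ℕ) (η : ℝ) (hη : 0 < η) (hn : 2 * n * η ≤ 1) :
    ∃ D : ℂ, 2 * η / Real.pi ≤ ‖D‖ ∧ ∀ y : ℝ,
      ∫ θ in y..(y + η), Complex.exp (2 * Real.pi * Complex.I * n * θ) =
        Complex.exp (2 * Real.pi * Complex.I * n * y) * D := by
  have hpi := Real.pi_pos
  refine ⟨∫ θ in (0:ℝ)..η, Complex.exp (2 * Real.pi * Complex.I * n * θ), ?_, ?_⟩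
  · rcases Nat.eq_zero_or_pos n with rfl | hn0
    · simp only [Nat.cast_zero, mul_zero, zero_mul, Complex.exp_zero,
        intervalIntegral.integral_const, sub_zero, Complex.real_smul, mul_one,
        Complex.norm_real, Real.norm_eq_abs, abs_of_pos hη]
      rw [div_le_iff₀ hpi]
      nlinarith [Real.pi_gt_three]
    · have hn0' : (0:ℝ) < n := by exact_mod_cast hn0
      have hc : (2 * Real.pi * Complex.I * n : ℂ) ≠ 0 := by
        simp [hpi.ne', hn0.ne']
      rw [integral_exp_mul_complex hc]
      have h1 : (2 * Real.pi * Complex.I * n * (η:ℝ) : ℂ) = Complex.I * ((2 * Real.pi * n * η : ℝ) : ℂ) := by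
        push_cast; ring
      rw [h1]
      simp only [Complex.ofReal_zero, mul_zero, Complex.exp_zero, norm_div]
      rw [Complex.norm_exp_I_mul_ofReal_sub_one]
      have h2 : ‖(2 * Real.pi * Complex.I * n : ℂ)‖ = 2 * Real.pi * n := by
        simp [abs_of_pos hpi]
      rw [h2]
      have hs := Real.mul_le_sin (x := 2 * Real.pi * n * η / 2) (by positivity) (by nlinarith)
      have hs0 : 2 / Real.pi * (2 * Real.pi * n * η / 2) = 2 * n * η := by
        field_simp
      rw [hs0] at hs
      rw [Real.norm_eq_abs, abs_of_nonneg (by nlinarith [mul_pos hn0' hη])]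
      rw [div_le_div_iff₀ hpi (by positivity)]
      nlinarith [mul_pos hn0' hη, mul_pos hpi hη]
  · intro y
    have := intervalIntegral.integral_comp_add_left (a := 0) (b := η)
      (fun θ : ℝ => Complex.exp (2 * Real.pi * Complex.I * n * θ)) y
    rw [add_zero] at this
    rw [← this, ← intervalIntegral.integral_const_mul]
    refine intervalIntegral.integral_congr fun θ _ => ?_
    show Complex.exp _ = Complex.exp _ * Complex.exp _
    rw [← Complex.exp_add]
    congr 1
    push_cast; ring

open MeasureTheory Set in
lemma large_sieve_spaced {ι : Type*} (s : Finset ι) (x : ι → ℝ) (c : ι → ℂ) (η : ℝ) (X : ℕ)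
    (hη : 0 < η) (h0 : ∀ i ∈ s, 0 ≤ x i) (h1 : ∀ i ∈ s, x i ≤ 1 - η)
    (sep : ∀ i ∈ s, ∀ j ∈ s, i ≠ j → η ≤ |x i - x j|) (hX : 2 * X * η ≤ 1) :
    ∑ n ∈ Finset.range X, ‖∑ i ∈ s, c i * Complex.exp (2 * Real.pi * Complex.I * n * x i)‖ ^ 2
      ≤ 3 / η * ∑ i ∈ s, ‖c i‖ ^ 2 := by
  classical
  have hpi := Real.pi_pos
  set A : ι → Set ℝ := fun i => Ioc (x i) (x i + η) with hA
  have hAm : ∀ i, MeasurableSet (A i) := fun i => measurableSet_Ioc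
  have hAsub : ∀ i ∈ s, A i ⊆ Ioc 0 1 := by
    intro i hi θ hθ
    exact ⟨lt_of_le_of_lt (h0 i hi) hθ.1, by linarith [hθ.2, h1 i hi]⟩
  have hdisj : ∀ i ∈ s, ∀ j ∈ s, ∀ θ, θ ∈ A i → θ ∈ A j → i = j := by
    intro i hi j hj θ ⟨ha, hb⟩ ⟨hc, hd⟩
    by_contra hne
    have := sep i hi j hj hne
    rcases le_abs.1 this with h | h <;> linarith
  set f : ℝ → ℂ := fun θ => ∑ i ∈ s, (A i).indicator (fun _ => c i) θ with hf
  have hint_eq : ∀ i ∈ s, ∀ g : ℝ → ℂ, ∫ θ in (0:ℝ)..1, (A i).indicator g θ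
      = ∫ θ in (x i)..(x i + η), g θ := by
    intro i hi g
    rw [intervalIntegral.integral_of_le zero_le_one, intervalIntegral.integral_of_le (by linarith),
      setIntegral_indicator (hAm i), inter_eq_self_of_subset_right (hAsub i hi)]
  have hL2 : MemLp f 2 (volume.restrict (Ioc (0:ℝ) 1)) := by
    have : f = ∑ i ∈ s, (A i).indicator (fun _ => c i) := by
      ext θ; simp [hf]
    rw [this]
    refine memLp_finsetSum' s fun i _ => ?_
    exact memLp_indicator_const 2 (hAm i) _ (Or.inr (measure_ne_top _ _))
  have hsum := hasSum_sq_fourierCoeffOn (a := (0:ℝ)) (b := 1) zero_lt_one hL2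
  have hnorm : ∫ θ in (0:ℝ)..1, ‖f θ‖ ^ 2 = η * ∑ i ∈ s, ‖c i‖ ^ 2 := by
    have hpt : ∀ θ, ‖f θ‖ ^ 2 = ∑ i ∈ s, (A i).indicator (fun _ => ‖c i‖ ^ 2) θ := by
      intro θ
      by_cases hex : ∃ i ∈ s, θ ∈ A i
      · obtain ⟨i, hi, hiθ⟩ := hex
        have e1 : f θ = c i := by
          simp only [hf]
          rw [Finset.sum_eq_single_of_mem i hi]
          · simp [hiθ]
          · intro j hj hji
            rw [indicator_of_notMem]
            exact fun hjθ => hji (hdisj j hj i hi θ hjθ hiθ)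
        rw [e1, Finset.sum_eq_single_of_mem i hi]
        · simp [hiθ]
        · intro j hj hji
          rw [indicator_of_notMem]
          exact fun hjθ => hji (hdisj j hj i hi θ hjθ hiθ)
      · push Not at hex
        have e1 : f θ = 0 := by
          simp only [hf]
          exact Finset.sum_eq_zero fun i hi => indicator_of_notMem (hex i hi) _
        rw [e1, Finset.sum_eq_zero fun i hi => indicator_of_notMem (hex i hi) _]
        simp
    simp only [hpt]
    rw [intervalIntegral.integral_of_le zero_le_one, integral_finsetSum, Finset.mul_sum]
    · refine Finset.sum_congr rfl fun i hi => ?_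
      rw [setIntegral_indicator (hAm i), inter_eq_self_of_subset_right (hAsub i hi)]
      simp [hA, hη.le]
    · intro i _
      exact (integrable_const _).indicator (hAm i)
  rw [hnorm] at hsum
  simp only [sub_zero, inv_one, one_smul] at hsum
  have hbess := sum_le_hasSum ((Finset.range X).image (fun n : ℕ => -(n:ℤ)))
    (fun i _ => sq_nonneg _) hsum
  rw [Finset.sum_image (by intro a _ b _ h; simpa using h)] at hbess
  have hterm : ∀ n ∈ Finset.range X,
      (2 * η / Real.pi) ^ 2 * ‖∑ i ∈ s, c i * Complex.exp (2 * Real.pi * Complex.I * n * x i)‖ ^ 2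
        ≤ ‖fourierCoeffOn (zero_lt_one (α := ℝ)) f (-(n:ℤ))‖ ^ 2 := by
    intro n hn
    have hnX : (n:ℝ) ≤ X := by exact_mod_cast (Finset.mem_range.1 hn).le
    obtain ⟨D, hD, hDe⟩ := norm_integral_exp_interval_ge n η hη (by nlinarith)
    have hco : fourierCoeffOn (zero_lt_one (α := ℝ)) f (-(n:ℤ))
        = (∑ i ∈ s, c i * Complex.exp (2 * Real.pi * Complex.I * n * x i)) * D := by
      rw [fourierCoeffOn_eq_integral, Finset.sum_mul]
      simp only [sub_zero, div_one, one_smul, neg_neg]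
      have : ∀ θ : ℝ, (fourier (n:ℤ) (θ : AddCircle ((1:ℝ) - 0)) : ℂ) • f θ
          = ∑ i ∈ s, (A i).indicator
            (fun θ : ℝ => c i * Complex.exp (2 * Real.pi * Complex.I * n * θ)) θ := by
        intro θ
        rw [fourier_coe_apply]
        simp only [hf, smul_eq_mul, Finset.mul_sum]
        refine Finset.sum_congr rfl fun i _ => ?_
        by_cases hi : θ ∈ A i
        · simp [hi]; ring
        · simp [hi]
      have h' : ∀ θ ∈ uIcc (0:ℝ) 1, (fourier (n:ℤ) (θ : AddCircle ((1:ℝ) - 0)) : ℂ) • f θ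
          = ∑ i ∈ s, (A i).indicator
            (fun θ : ℝ => c i * Complex.exp (2 * Real.pi * Complex.I * n * θ)) θ := fun θ _ => this θ
      have h'' := intervalIntegral.integral_congr (μ := volume) h'
      refine Eq.trans ?_ (h''.trans ?_)
      · simp
      rw [intervalIntegral.integral_finsetSum]
      · refine Finset.sum_congr rfl fun i hi => ?_
        rw [hint_eq i hi, intervalIntegral.integral_const_mul, hDe (x i)]
        ring
      · intro i _
        rw [intervalIntegrable_iff, uIoc_of_le zero_le_one]
        refine Integrable.indicator ?_ (hAm i)
        exact (Continuous.integrableOn_Ioc (by fun_prop))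
    rw [hco, norm_mul, mul_pow, mul_comm]
    gcongr
  have hfin := (Finset.sum_le_sum hterm).trans hbess
  rw [← Finset.mul_sum] at hfin
  set S := ∑ n ∈ Finset.range X, ‖∑ i ∈ s, c i * Complex.exp (2 * Real.pi * Complex.I * n * x i)‖ ^ 2
  set T := ∑ i ∈ s, ‖c i‖ ^ 2
  have hT : 0 ≤ T := Finset.sum_nonneg fun i _ => sq_nonneg _
  have h4 : 4 * η * S ≤ Real.pi ^ 2 * T := by
    have : (2 * η / Real.pi) ^ 2 * S * Real.pi ^ 2 = η * (4 * η * S) := by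
      field_simp; ring
    have h5 := mul_le_mul_of_nonneg_right hfin (sq_nonneg Real.pi)
    rw [this] at h5
    have : η * (4 * η * S) ≤ η * (Real.pi ^ 2 * T) := by linarith
    exact le_of_mul_le_mul_left this hη
  have h6 : Real.pi ^ 2 ≤ 12 := by nlinarith [Real.pi_lt_d2, Real.pi_gt_three]
  rw [div_mul_eq_mul_div, le_div_iff₀ hη]
  nlinarith [mul_le_mul_of_nonneg_right h6 hT]

/-- The additive character `e(x) = exp(2πix)`. -/
noncomputable def addExp (x : ℝ) : ℂ := Complex.exp (((2 * Real.pi * x : ℝ) : ℂ) * Complex.I)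

/-- The centred sawtooth value `{n/m} - 1/2`. -/
noncomputable def saw (m n : ℕ) : ℝ := ((n % m : ℕ) : ℝ) / m - 1 / 2

/-- The multiplier `1/(e(-r) - 1)` of the discrete Fourier expansion of the sawtooth. -/
noncomputable def sawMult (r : ℝ) : ℂ := (addExp (-r) - 1)⁻¹

lemma norm_addExp (x : ℝ) : ‖addExp x‖ = 1 := Complex.norm_exp_ofReal_mul_I _

lemma addExp_add (x y : ℝ) : addExp (x + y) = addExp x * addExp y := by
  simp only [addExp]
  rw [← Complex.exp_add]
  congr 1
  push_cast; ring

@[simp] lemma addExp_zero : addExp 0 = 1 := by simp [addExp]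

lemma addExp_natCast (n : ℕ) : addExp n = 1 := by
  have := Complex.exp_nat_mul_two_pi_mul_I n
  rw [← this, addExp]
  congr 1
  push_cast; ring

lemma addExp_nat_mul (k : ℕ) (x : ℝ) : addExp (k * x) = addExp x ^ k := by
  simp only [addExp]
  rw [← Complex.exp_nat_mul]
  congr 1
  push_cast; ring

lemma addExp_neg_mul (x : ℝ) : addExp (-x) * addExp x = 1 := by
  rw [← addExp_add]; simp

lemma norm_addExp_sub_one (x : ℝ) : ‖addExp x - 1‖ = 2 * |Real.sin (Real.pi * x)| := by
  have := Complex.norm_exp_I_mul_ofReal_sub_one (2 * Real.pi * x)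
  rw [mul_comm] at this
  rw [addExp, this, norm_mul, Real.norm_eq_abs, Real.norm_eq_abs]
  norm_num
  congr 2; ring

lemma norm_addExp_neg_sub_one (x : ℝ) : ‖addExp (-x) - 1‖ = ‖addExp x - 1‖ := by
  rw [norm_addExp_sub_one, norm_addExp_sub_one, mul_neg, Real.sin_neg, abs_neg]

lemma norm_addExp_nat_mul_sub_one_le (k : ℕ) (x : ℝ) :
    ‖addExp (k * x) - 1‖ ≤ k * ‖addExp x - 1‖ := by
  induction k with
  | zero => simp
  | succ k ih =>
    have : addExp ((k + 1 : ℕ) * x) - 1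
        = addExp x * (addExp (k * x) - 1) + (addExp x - 1) := by
      push_cast
      rw [add_mul, one_mul, addExp_add]; ring
    rw [this]
    refine (norm_add_le _ _).trans ?_
    rw [norm_mul, norm_addExp]
    push_cast
    linarith

lemma norm_sawMult_le {r : ℝ} (h0 : 0 < r) (h1 : r < 1) :
    ‖sawMult r‖ ≤ 1 / 4 * (1 / r + 1 / (1 - r)) := by
  have hr : 0 < 1 - r := by linarith
  have hpi := Real.pi_pos
  rw [sawMult, norm_inv, norm_addExp_neg_sub_one, norm_addExp_sub_one]
  have key : ∀ s : ℝ, 0 < s → s ≤ 1 / 2 → 2 * s ≤ Real.sin (Real.pi * s) := by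
    intro s hs hs2
    have := Real.mul_le_sin (x := Real.pi * s) (by positivity) (by nlinarith)
    have e : 2 / Real.pi * (Real.pi * s) = 2 * s := by field_simp
    linarith
  have hi : ∀ s : ℝ, 0 < s → 2 * s ≤ |Real.sin (Real.pi * r)| →
      (2 * |Real.sin (Real.pi * r)|)⁻¹ ≤ 1 / 4 * (1 / s) := by
    intro s hs h
    rw [← one_div, div_mul_div_comm, one_mul]
    apply one_div_le_one_div_of_le (by positivity)
    linarith
  have p1 : 0 < 1 / r := by positivity
  have p2 : 0 < 1 / (1 - r) := by positivity
  rcases le_total r (1 / 2) with h | h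
  · have := hi r h0 ((key r h0 h).trans (le_abs_self _))
    linarith
  · have h2 := key (1 - r) hr (by linarith)
    rw [show Real.pi * (1 - r) = Real.pi - Real.pi * r by ring, Real.sin_pi_sub] at h2
    have := hi (1 - r) hr (h2.trans (le_abs_self _))
    linarith

lemma norm_sawMult_mul_le (k : ℕ) (r : ℝ) : ‖sawMult r * (addExp (k * r) - 1)‖ ≤ k := by
  rw [norm_mul, sawMult, norm_inv, norm_addExp_neg_sub_one]
  have h := norm_addExp_nat_mul_sub_one_le k r
  rcases (norm_nonneg (addExp r - 1)).eq_or_lt with h0 | h0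
  · rw [← h0]; simp
  · rw [inv_mul_le_iff₀ h0]; linarith

lemma addExp_ne_one {j m : ℕ} (h0 : 0 < j) (h1 : j < m) : addExp (j / m) ≠ 1 := by
  have hm : (0:ℝ) < m := by exact_mod_cast (h0.trans h1)
  have hj : (0:ℝ) < j := by exact_mod_cast h0
  have hjm : (j:ℝ) < m := by exact_mod_cast h1
  intro h
  have h2 := norm_addExp_sub_one (j / m)
  rw [h, sub_self, norm_zero] at h2
  have : 0 < Real.sin (Real.pi * (j / m)) := by
    apply Real.sin_pos_of_pos_of_lt_pi
    · have := Real.pi_pos; positivity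
    · have : (j:ℝ) / m < 1 := (div_lt_one hm).2 hjm
      nlinarith [Real.pi_pos]
  rw [abs_of_pos this] at h2
  linarith

lemma sum_addExp_div (m n : ℕ) (hm : 0 < m) :
    ∑ j ∈ Finset.range m, addExp (n * (j / m)) = if m ∣ n then (m : ℂ) else 0 := by
  have hm' : (m:ℝ) ≠ 0 := by exact_mod_cast hm.ne'
  have e : ∀ j : ℕ, addExp (n * (j / m)) = addExp (n / m) ^ j := by
    intro j
    rw [← addExp_nat_mul]; congr 1; ring
  simp only [e]
  split_ifs with h
  · obtain ⟨k, rfl⟩ := h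
    have : (((m * k : ℕ) : ℝ) / m) = (k:ℕ) := by push_cast; field_simp
    rw [this, addExp_natCast]; simp
  · have hne : addExp (n / m) ≠ 1 := by
      have h3 : (n:ℝ) / m = (n / m : ℕ) + ((n % m : ℕ) : ℝ) / m := by
        field_simp
        exact_mod_cast (by rw [add_comm]; exact (Nat.mod_add_div n m).symm)
      rw [h3, addExp_add, addExp_natCast, one_mul]
      exact addExp_ne_one (Nat.pos_of_ne_zero fun h0 => h (Nat.dvd_of_mod_eq_zero h0))
        (Nat.mod_lt _ hm)
    rw [geom_sum_eq hne]
    have : addExp (n / m) ^ m = 1 := by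
      rw [← addExp_nat_mul]
      have : (m:ℝ) * (n / m) = (n:ℕ) := by field_simp
      rw [this, addExp_natCast]
    rw [this]; simp

lemma saw_succ_sub (m n : ℕ) (hm : 0 < m) :
    saw m (n + 1) - saw m n = 1 / m - if m ∣ n + 1 then 1 else 0 := by
  have hm' : (m:ℝ) ≠ 0 := by exact_mod_cast hm.ne'
  simp only [saw]
  have h := Nat.mod_add_div n m
  split_ifs with hd
  · have h1 : (n + 1) % m = 0 := Nat.mod_eq_zero_of_dvd hd
    have h2 : n % m + 1 = m := by
      have hlt := Nat.mod_lt n hm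
      have : (n % m + 1) % m = 0 := by rw [Nat.mod_add_mod]; exact h1
      rcases Nat.lt_or_ge (n % m + 1) m with h3 | h3
      · rw [Nat.mod_eq_of_lt h3] at this; omega
      · omega
    rw [h1]
    have h2' : ((n % m : ℕ) : ℝ) + 1 = m := by exact_mod_cast h2
    field_simp
    push_cast
    linarith
  · have h2 : (n + 1) % m = n % m + 1 := by
      have hlt := Nat.mod_lt n hm
      have : (n + 1) % m = (n % m + 1) % m := by rw [Nat.mod_add_mod]
      rw [this]
      apply Nat.mod_eq_of_lt
      rcases Nat.lt_or_ge (n % m + 1) m with h3 | h3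
      · exact h3
      · exfalso; apply hd
        apply Nat.dvd_of_mod_eq_zero
        rw [this]
        have : n % m + 1 = m := by omega
        rw [this, Nat.mod_self]
    rw [h2]; push_cast; field_simp; ring

lemma sum_sawMult (m : ℕ) (hm : 0 < m) :
    ∑ j ∈ Finset.range m, sawMult (j / m) = -((m - 1 : ℝ) / 2 : ℝ) := by
  obtain ⟨k, rfl⟩ : ∃ k, m = k + 1 := ⟨m - 1, by omega⟩
  rw [Finset.sum_range_succ']
  have h0 : sawMult (((0:ℕ):ℝ) / ((k + 1 : ℕ) : ℝ)) = 0 := by simp [sawMult]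
  rw [h0, add_zero]
  have hrefl := Finset.sum_range_reflect (fun j : ℕ => sawMult (((j + 1 : ℕ):ℝ) / ((k + 1 : ℕ) : ℝ))) k
  have hpair : ∀ j ∈ Finset.range k, sawMult (((k - 1 - j + 1 : ℕ):ℝ) / ((k + 1 : ℕ) : ℝ))
      = -1 - sawMult (((j + 1 : ℕ):ℝ) / ((k + 1 : ℕ) : ℝ)) := by
    intro j hj
    have hj' := Finset.mem_range.1 hj
    have hne := addExp_ne_one (j := j + 1) (m := k + 1) (by omega) (by omega)
    set r : ℝ := ((j + 1 : ℕ):ℝ) / ((k + 1 : ℕ) : ℝ) with hr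
    have e1 : -(((k - 1 - j + 1 : ℕ):ℝ) / ((k + 1 : ℕ) : ℝ)) + (1:ℕ) = r := by
      have : ((k - 1 - j + 1 : ℕ):ℝ) = k - j := by
        have : k - 1 - j + 1 = k - j := by omega
        rw [this, Nat.cast_sub hj'.le]
      rw [this, hr]; push_cast; field_simp; ring
    have e2 : addExp (-(((k - 1 - j + 1 : ℕ):ℝ) / ((k + 1 : ℕ) : ℝ))) = addExp r := by
      rw [← e1, addExp_add, addExp_natCast, mul_one]
    rw [sawMult, e2, sawMult]
    have hm1 := addExp_neg_mul r
    have hz : addExp r ≠ 0 := fun h => by rw [h] at hm1; simp at hm1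
    have e3 : addExp (-r) = (addExp r)⁻¹ := eq_inv_of_mul_eq_one_left hm1
    rw [e3]
    set z := addExp r
    have h1 : z - 1 ≠ 0 := sub_ne_zero.2 hne
    have h2 : z⁻¹ - 1 = -(z - 1) / z := by field_simp; ring
    rw [h2, inv_div, div_neg]
    field_simp
    ring
  rw [Finset.sum_congr rfl hpair, Finset.sum_sub_distrib] at hrefl
  simp only [Finset.sum_const, Finset.card_range, nsmul_eq_mul] at hrefl
  push_cast at hrefl ⊢
  linear_combination -hrefl / 2

lemma saw_eq_sum (m n : ℕ) (hm : 0 < m) :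
    ((saw m n + 1 / (2 * m) : ℝ) : ℂ)
      = (1 / m) * ∑ j ∈ Finset.range m, sawMult (j / m) * addExp (n * (j / m)) := by
  have hm' : (m:ℂ) ≠ 0 := by exact_mod_cast hm.ne'
  induction n with
  | zero =>
    simp only [Nat.cast_zero, zero_mul, addExp_zero, mul_one]
    rw [sum_sawMult m hm, saw]
    simp only [Nat.zero_mod]
    push_cast; field_simp; ring
  | succ n ih =>
    have h1 := saw_succ_sub m n hm
    have h2 : saw m (n + 1) = saw m n + (1 / m - if m ∣ n + 1 then 1 else 0) := by linarith
    have h3 : ∑ j ∈ Finset.range m, sawMult (j / m) * addExp (((n + 1 : ℕ) : ℝ) * (j / m))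
        = ∑ j ∈ Finset.range m, sawMult (j / m) * addExp (n * (j / m))
          + (1 - ∑ j ∈ Finset.range m, addExp (((n + 1 : ℕ) : ℝ) * (j / m))) := by
      obtain ⟨k, rfl⟩ : ∃ k, m = k + 1 := ⟨m - 1, by omega⟩
      rw [Finset.sum_range_succ', Finset.sum_range_succ', Finset.sum_range_succ']
      have hz : sawMult (((0:ℕ):ℝ) / ((k + 1 : ℕ) : ℝ)) = 0 := by simp [sawMult]
      rw [hz]
      have hone : addExp (((n + 1 : ℕ):ℝ) * (((0:ℕ):ℝ) / ((k + 1 : ℕ) : ℝ))) = 1 := by simp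
      rw [hone]
      have : ∀ j ∈ Finset.range k, sawMult (((j + 1 : ℕ):ℝ) / ((k + 1 : ℕ) : ℝ))
            * addExp (((n + 1 : ℕ) : ℝ) * (((j + 1 : ℕ):ℝ) / ((k + 1 : ℕ) : ℝ)))
          = sawMult (((j + 1 : ℕ):ℝ) / ((k + 1 : ℕ) : ℝ))
            * addExp (n * (((j + 1 : ℕ):ℝ) / ((k + 1 : ℕ) : ℝ)))
            - addExp (((n + 1 : ℕ) : ℝ) * (((j + 1 : ℕ):ℝ) / ((k + 1 : ℕ) : ℝ))) := by
        intro j hj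
        have hne := addExp_ne_one (j := j + 1) (m := k + 1) (by omega)
          (by have := Finset.mem_range.1 hj; omega)
        set r : ℝ := ((j + 1 : ℕ):ℝ) / ((k + 1 : ℕ) : ℝ)
        have e : ((n + 1 : ℕ) : ℝ) * r = n * r + r := by push_cast; ring
        rw [e, addExp_add]
        have hm1 := addExp_neg_mul r
        have hz : addExp r ≠ 0 := fun h => by rw [h] at hm1; simp at hm1
        have e3 : addExp (-r) = (addExp r)⁻¹ := eq_inv_of_mul_eq_one_left hm1
        rw [sawMult, e3]
        set z := addExp r
        have h1 : z - 1 ≠ 0 := sub_ne_zero.2 hne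
        have h2 : z⁻¹ - 1 = -(z - 1) / z := by field_simp; ring
        rw [h2, inv_div, div_neg]
        field_simp
        ring
      rw [Finset.sum_congr rfl this, Finset.sum_sub_distrib]
      ring
    rw [h3, sum_addExp_div m (n + 1) hm, mul_add, ← ih, h2]
    split_ifs with hd
    · push_cast; field_simp; ring
    · push_cast; field_simp; ring

lemma sum_inv_Icc_le (N : ℕ) : ∑ l ∈ Finset.Icc 1 N, (1:ℝ) / l ≤ 1 + Real.log N := by
  have h := harmonic_le_one_add_log N
  rw [harmonic_eq_sum_Icc] at h
  push_cast at h
  simpa [one_div] using h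

/-- Index set of the fractions `j/m` with `1 ≤ m ≤ N`, `0 ≤ j < m`. -/
def fracPairs (N : ℕ) : Finset (Σ _ : ℕ, ℕ) := (Finset.Icc 1 N).sigma fun m => Finset.range m

lemma mem_fracPairs {N : ℕ} {p : Σ _ : ℕ, ℕ} :
    p ∈ fracPairs N ↔ (1 ≤ p.1 ∧ p.1 ≤ N) ∧ p.2 < p.1 := by
  simp [fracPairs]

/-- The fraction attached to a pair. -/
def pairFrac (p : Σ _ : ℕ, ℕ) : ℚ := (p.2 : ℚ) / p.1

lemma pairFrac_cast (p : Σ _ : ℕ, ℕ) : ((pairFrac p : ℚ) : ℝ) = (p.2 : ℝ) / p.1 := by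
  simp [pairFrac]

lemma pairFrac_den_dvd (p : Σ _ : ℕ, ℕ) : (pairFrac p).den ∣ p.1 := by
  have h := Rat.den_dvd (p.2 : ℤ) (p.1 : ℤ)
  rw [Rat.divInt_eq_div, Int.cast_natCast, Int.cast_natCast] at h
  exact Int.natCast_dvd_natCast.1 h

lemma norm_fiber_sum_le (N : ℕ) (w : ℕ → ℂ) (W : ℝ) (hw : ∀ m, ‖w m‖ ≤ W)
    (r : ℚ) : ‖∑ p ∈ fracPairs N with pairFrac p = r, w p.1 / p.1‖
      ≤ W * (1 + Real.log N) / r.den := by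
  have hW : 0 ≤ W := (norm_nonneg _).trans (hw 0)
  have hden : (0:ℝ) < r.den := by exact_mod_cast r.den_pos
  set F := (fracPairs N).filter fun p => pairFrac p = r with hF
  have hdvd : ∀ p ∈ F, r.den ∣ p.1 := by
    intro p hp
    have h2 := (Finset.mem_filter.1 hp).2
    rw [← h2]
    exact pairFrac_den_dvd p
  calc ‖∑ p ∈ F, w p.1 / p.1‖ ≤ ∑ p ∈ F, W * (1 / (p.1 : ℝ)) := by
        refine norm_sum_le_of_le _ fun p _ => ?_
        rw [norm_div, Complex.norm_natCast, div_eq_mul_one_div]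
        exact mul_le_mul_of_nonneg_right (hw _) (by positivity)
    _ = ∑ p ∈ F, W / r.den * (1 / ((p.1 / r.den : ℕ) : ℝ)) := by
        refine Finset.sum_congr rfl fun p hp => ?_
        obtain ⟨k, hk⟩ := hdvd p hp
        rw [hk, Nat.mul_div_cancel_left _ r.den_pos]
        push_cast
        rw [div_mul_div_comm, mul_one_div, mul_one]
    _ = ∑ l ∈ F.image (fun p => p.1 / r.den), W / r.den * (1 / (l:ℝ)) := by
        rw [Finset.sum_image]
        intro p hp q hq hpq
        have e1 := (Finset.mem_filter.1 hp)
        have e2 := (Finset.mem_filter.1 hq)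
        have m1 := mem_fracPairs.1 e1.1
        have m2 := mem_fracPairs.1 e2.1
        have h1 : p.1 = q.1 := by
          rw [← Nat.mul_div_cancel' (hdvd p hp), ← Nat.mul_div_cancel' (hdvd q hq)]
          simp only at hpq
          rw [hpq]
        have h2 : pairFrac p = pairFrac q := e1.2.trans e2.2.symm
        rw [pairFrac, pairFrac, h1, div_left_inj' (by have := m2.1.1; positivity)] at h2
        have h3 : p.2 = q.2 := by exact_mod_cast h2
        exact Sigma.ext h1 (heq_of_eq h3)
    _ ≤ ∑ l ∈ Finset.Icc 1 N, W / r.den * (1 / (l:ℝ)) := by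
        refine Finset.sum_le_sum_of_subset_of_nonneg ?_ fun _ _ _ => by positivity
        intro l hl
        obtain ⟨p, hp, rfl⟩ := Finset.mem_image.1 hl
        have m1 := mem_fracPairs.1 (Finset.mem_filter.1 hp).1
        rw [Finset.mem_Icc]
        exact ⟨Nat.div_pos (Nat.le_of_dvd m1.1.1 (hdvd p hp)) r.den_pos,
          (Nat.div_le_self _ _).trans m1.1.2⟩
    _ ≤ W / r.den * (1 + Real.log N) := by
        rw [← Finset.mul_sum]
        exact mul_le_mul_of_nonneg_left (sum_inv_Icc_le N) (by positivity)
    _ = _ := by ring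

lemma large_sieve_fractions (N X : ℕ) (hN : 1 ≤ N) (hX : N ^ 2 ≤ 2 * X) (w : ℕ → ℂ) (W : ℝ)
    (hw : ∀ m, ‖w m‖ ≤ W) (g : ℝ → ℂ) :
    ∑ n ∈ Finset.range X, ‖∑ m ∈ Finset.Icc 1 N,
        w m * ((1 / m) * ∑ j ∈ Finset.range m, g (j / m) * addExp (n * (j / m)))‖ ^ 2
      ≤ 6 * X * (W * (1 + Real.log N)) ^ 2 *
        ∑ q ∈ Finset.Icc 1 N, ∑ a ∈ Finset.range q, ‖g (a / q)‖ ^ 2 / q ^ 2 := by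
  classical
  have hX0 : 0 < X := by
    have : 1 ≤ N ^ 2 := Nat.one_le_pow _ _ hN
    omega
  have hXr : (0:ℝ) < X := by exact_mod_cast hX0
  have hX' : (N:ℝ) ^ 2 ≤ 2 * X := by exact_mod_cast hX
  have hN' : (1:ℝ) ≤ N := by exact_mod_cast hN
  have hlog : 0 ≤ Real.log N := Real.log_nonneg hN'
  set R : Finset ℚ := (fracPairs N).image pairFrac with hR
  set c : ℚ → ℂ := fun r => (∑ p ∈ fracPairs N with pairFrac p = r, w p.1 / p.1) * g r with hc
  have hrew : ∀ n : ℕ, ∑ m ∈ Finset.Icc 1 N,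
        w m * ((1 / m) * ∑ j ∈ Finset.range m, g (j / m) * addExp (n * (j / m)))
      = ∑ r ∈ R, c r * Complex.exp (2 * Real.pi * Complex.I * n * ((r:ℝ):ℂ)) := by
    intro n
    have e1 : ∑ m ∈ Finset.Icc 1 N,
        w m * ((1 / m) * ∑ j ∈ Finset.range m, g (j / m) * addExp (n * (j / m)))
        = ∑ p ∈ fracPairs N, w p.1 / p.1 * (g (pairFrac p) * addExp (n * (pairFrac p : ℝ))) := by
      rw [fracPairs, Finset.sum_sigma]
      refine Finset.sum_congr rfl fun m _ => ?_
      rw [← mul_assoc, Finset.mul_sum]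
      refine Finset.sum_congr rfl fun j _ => ?_
      rw [pairFrac_cast]
      simp only
      ring
    rw [e1, ← Finset.sum_fiberwise_of_maps_to (t := R) (g := pairFrac)
      (fun p hp => Finset.mem_image_of_mem _ hp)]
    refine Finset.sum_congr rfl fun r _ => ?_
    rw [hc]
    simp only
    rw [Finset.sum_mul, Finset.sum_mul]
    refine Finset.sum_congr rfl fun p hp => ?_
    rw [(Finset.mem_filter.1 hp).2, mul_assoc]
    congr 2
    rw [addExp]
    congr 1
    push_cast; ring
  have hsieve := large_sieve_spaced R (fun r => (r:ℝ)) c (1 / (2 * X)) X (by positivity)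
    (by
      intro r hr
      obtain ⟨p, hp, rfl⟩ := Finset.mem_image.1 hr
      rw [pairFrac_cast]; positivity)
    (by
      intro r hr
      obtain ⟨p, hp, rfl⟩ := Finset.mem_image.1 hr
      rw [pairFrac_cast]
      obtain ⟨⟨h1, h2⟩, h3⟩ := mem_fracPairs.1 hp
      have hp0 : (0:ℝ) < p.1 := by exact_mod_cast h1
      have h3' : (p.2:ℝ) + 1 ≤ p.1 := by exact_mod_cast h3
      have h2' : (p.1:ℝ) ≤ N := by exact_mod_cast h2
      have e1 : (p.2:ℝ) / p.1 ≤ 1 - 1 / p.1 := by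
        rw [div_le_iff₀ hp0, sub_mul, one_div, inv_mul_cancel₀ hp0.ne']; linarith
      have e2 : (1:ℝ) / (2 * X) ≤ 1 / p.1 := by
        apply one_div_le_one_div_of_le hp0
        nlinarith
      linarith)
    (by
      intro r hr r' hr' hne
      obtain ⟨p, hp, rfl⟩ := Finset.mem_image.1 hr
      obtain ⟨q, hq, rfl⟩ := Finset.mem_image.1 hr'
      rw [pairFrac_cast, pairFrac_cast]
      obtain ⟨⟨h1, h2⟩, h3⟩ := mem_fracPairs.1 hp
      obtain ⟨⟨k1, k2⟩, k3⟩ := mem_fracPairs.1 hq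
      have hp0 : (0:ℝ) < p.1 := by exact_mod_cast h1
      have hq0 : (0:ℝ) < q.1 := by exact_mod_cast k1
      have h2' : (p.1:ℝ) ≤ N := by exact_mod_cast h2
      have k2' : (q.1:ℝ) ≤ N := by exact_mod_cast k2
      rw [div_sub_div _ _ hp0.ne' hq0.ne', abs_div, abs_of_pos (mul_pos hp0 hq0)]
      have hint_eq : (1:ℝ) ≤ |(p.2:ℝ) * q.1 - p.1 * q.2| := by
        have hz : ((p.2:ℤ) * q.1 - p.1 * q.2) ≠ 0 := by
          intro h0
          apply hne
          rw [pairFrac, pairFrac, div_eq_div_iff (by positivity) (by positivity)]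
          have : (p.2:ℤ) * q.1 = q.2 * p.1 := by linarith
          exact_mod_cast this
        have := Int.one_le_abs hz
        exact_mod_cast this
      apply div_le_div₀ (abs_nonneg _) hint_eq (mul_pos hp0 hq0)
      nlinarith)
    (by field_simp; norm_num)
  simp only [hrew]
  refine hsieve.trans ?_
  have h3 : (3:ℝ) / (1 / (2 * X)) = 6 * X := by field_simp; norm_num
  rw [h3, mul_assoc (6 * (X:ℝ))]
  refine mul_le_mul_of_nonneg_left ?_ (by positivity)
  set G : (Σ _ : ℕ, ℕ) → ℝ := fun p => ‖g ((p.2:ℝ) / p.1)‖ ^ 2 / (p.1:ℝ) ^ 2 with hG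
  set φ : ℚ → (Σ _ : ℕ, ℕ) := fun r => ⟨r.den, r.num.toNat⟩ with hφ
  have hRmem : ∀ r ∈ R, 0 ≤ r ∧ r < 1 ∧ r.den ≤ N := by
    intro r hr
    obtain ⟨p, hp, rfl⟩ := Finset.mem_image.1 hr
    obtain ⟨⟨h1, h2⟩, h3⟩ := mem_fracPairs.1 hp
    have hp0 : (0:ℚ) < p.1 := by exact_mod_cast h1
    refine ⟨by rw [pairFrac]; positivity, ?_, ?_⟩
    · rw [pairFrac, div_lt_one hp0]; exact_mod_cast h3
    · exact (Nat.le_of_dvd h1 (pairFrac_den_dvd p)).trans h2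
  have hcast : ∀ r ∈ R, ((r.num.toNat : ℕ) : ℝ) / r.den = r := by
    intro r hr
    have h0 := (hRmem r hr).1
    have h1 : ((r.num.toNat : ℕ) : ℤ) = r.num := Int.toNat_of_nonneg (Rat.num_nonneg.2 h0)
    have h2 : ((r.num.toNat : ℕ) : ℝ) = (r.num : ℝ) := by exact_mod_cast h1
    rw [h2, Rat.cast_def]
  calc ∑ r ∈ R, ‖c r‖ ^ 2 ≤ ∑ r ∈ R, (W * (1 + Real.log N)) ^ 2 * G (φ r) := by
        refine Finset.sum_le_sum fun r hr => ?_
        rw [hc, hG, hφ]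
        simp only
        rw [hcast r hr, norm_mul, mul_pow]
        have := norm_fiber_sum_le N w W hw r
        have h5 := pow_le_pow_left₀ (norm_nonneg _) this 2
        rw [div_pow] at h5
        calc _ ≤ (W * (1 + Real.log N)) ^ 2 / (r.den:ℝ) ^ 2 * ‖g r‖ ^ 2 :=
              mul_le_mul_of_nonneg_right h5 (sq_nonneg _)
          _ = _ := by ring
    _ = (W * (1 + Real.log N)) ^ 2 * ∑ p ∈ R.image φ, G p := by
        rw [← Finset.mul_sum]
        congr 1
        symm
        apply Finset.sum_image
        intro r hr r' hr' h
        have e1 : r.den = r'.den := congrArg Sigma.fst h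
        have e2 : r.num.toNat = r'.num.toNat := by
          have := congrArg Sigma.snd h
          exact this
        have h1 := hcast r hr
        rw [e1, e2, hcast r' hr'] at h1
        exact_mod_cast h1.symm
    _ ≤ (W * (1 + Real.log N)) ^ 2 * ∑ p ∈ fracPairs N, G p := by
        refine mul_le_mul_of_nonneg_left ?_ (sq_nonneg _)
        refine Finset.sum_le_sum_of_subset_of_nonneg ?_ fun p _ _ => by rw [hG]; positivity
        intro p hp
        obtain ⟨r, hr, rfl⟩ := Finset.mem_image.1 hp
        obtain ⟨h0, h1, h2⟩ := hRmem r hr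
        rw [mem_fracPairs]
        refine ⟨⟨r.den_pos, h2⟩, ?_⟩
        have h3 := hcast r hr
        have hd : (0:ℝ) < r.den := by exact_mod_cast r.den_pos
        have h4 : ((r.num.toNat : ℕ) : ℝ) / r.den < 1 := by rw [h3]; exact_mod_cast h1
        rw [div_lt_one hd] at h4
        exact_mod_cast h4
    _ = _ := by
        rw [fracPairs, Finset.sum_sigma]

lemma norm_sawMult_div_le (q a : ℕ) (ha : a < q) :
    ‖sawMult (a / q)‖ ≤ q / 4 * (1 / a + 1 / ((q - a : ℕ) : ℝ)) := by
  have hq : (0:ℝ) < q := by exact_mod_cast (Nat.zero_le a).trans_lt ha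
  rcases Nat.eq_zero_or_pos a with rfl | ha0
  · simp [sawMult]; positivity
  have ha0' : (0:ℝ) < a := by exact_mod_cast ha0
  have haq : (a:ℝ) < q := by exact_mod_cast ha
  refine (norm_sawMult_le (r := a / q) (by positivity) ((div_lt_one hq).2 haq)).trans (le_of_eq ?_)
  rw [Nat.cast_sub ha.le]
  have : (q:ℝ) - a ≠ 0 := by linarith [sub_pos.2 haq]
  have h2 : 1 - (a:ℝ) / q = (q - a) / q := by field_simp
  rw [h2]
  field_simp

lemma sum_inv_range_le (q : ℕ) : ∑ a ∈ Finset.range q, (1:ℝ) / a ≤ 1 + Real.log q := by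
  refine le_trans ?_ (sum_inv_Icc_le q)
  rcases q with _ | q
  · simp
  rw [Finset.sum_range_succ', Nat.cast_zero, div_zero, add_zero]
  have : ∑ l ∈ Finset.Icc 1 (q + 1), (1:ℝ) / l
      = ∑ a ∈ Finset.range (q + 1), (1:ℝ) / ((a + 1 : ℕ) : ℝ) := by
    rw [Finset.range_eq_Ico, Finset.sum_Ico_add' (fun l : ℕ => (1:ℝ) / l) 0 (q + 1) 1]
    rfl
  rw [this]
  exact Finset.sum_le_sum_of_subset_of_nonneg (Finset.range_mono (Nat.le_succ q))
    fun _ _ _ => by positivity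

lemma sum_inv_sub_range_le (q : ℕ) :
    ∑ a ∈ Finset.range q, (1:ℝ) / ((q - a : ℕ) : ℝ) ≤ 1 + Real.log q := by
  refine le_trans (le_of_eq ?_) (sum_inv_Icc_le q)
  rw [← Finset.sum_range_reflect]
  have : ∑ l ∈ Finset.Icc 1 q, (1:ℝ) / l
      = ∑ a ∈ Finset.range q, (1:ℝ) / ((a + 1 : ℕ) : ℝ) := by
    rw [Finset.range_eq_Ico, Finset.sum_Ico_add' (fun l : ℕ => (1:ℝ) / l) 0 q 1]
    rfl
  rw [this]
  refine Finset.sum_congr rfl fun a ha => ?_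
  have := Finset.mem_range.1 ha
  congr 2
  omega

lemma sum_norm_sawMult_le (q : ℕ) :
    ∑ a ∈ Finset.range q, ‖sawMult (a / q)‖ ≤ q / 2 * (1 + Real.log q) := by
  calc _ ≤ ∑ a ∈ Finset.range q, (q:ℝ) / 4 * (1 / a + 1 / ((q - a : ℕ) : ℝ)) :=
        Finset.sum_le_sum fun a ha => norm_sawMult_div_le q a (Finset.mem_range.1 ha)
    _ = (q:ℝ) / 4 * (∑ a ∈ Finset.range q, (1:ℝ) / a
          + ∑ a ∈ Finset.range q, (1:ℝ) / ((q - a : ℕ) : ℝ)) := by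
        rw [← Finset.mul_sum, Finset.sum_add_distrib]
    _ ≤ (q:ℝ) / 4 * ((1 + Real.log q) + (1 + Real.log q)) := by
        gcongr
        · exact sum_inv_range_le q
        · exact sum_inv_sub_range_le q
    _ = _ := by ring

lemma norm_sawMult_div_le_half (q a : ℕ) (ha : a < q) : ‖sawMult (a / q)‖ ≤ q / 2 := by
  refine (norm_sawMult_div_le q a ha).trans ?_
  have h1 : (1:ℝ) / a ≤ 1 := by
    rcases Nat.eq_zero_or_pos a with rfl | h
    · simp
    · exact (div_le_one (by exact_mod_cast h)).2 (by exact_mod_cast h)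
  have h2 : (1:ℝ) / ((q - a : ℕ) : ℝ) ≤ 1 :=
    (div_le_one (by exact_mod_cast Nat.sub_pos_of_lt ha)).2
      (by exact_mod_cast Nat.sub_pos_of_lt ha)
  have : (0:ℝ) ≤ q := Nat.cast_nonneg q
  nlinarith

/-- The weighted sawtooth sum `Σ_{m ≤ N} w_m ({n/m} - 1/2)`. -/
noncomputable def sawSum (N : ℕ) (w : ℕ → ℂ) (n : ℕ) : ℂ :=
  ∑ m ∈ Finset.Icc 1 N, w m * (saw m n : ℂ)

lemma sum_sawMult_sq_le (N : ℕ) (hN : 1 ≤ N) :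
    ∑ q ∈ Finset.Icc 1 N, ∑ a ∈ Finset.range q, ‖sawMult (a / q)‖ ^ 2 / q ^ 2
      ≤ N * (1 + Real.log N) := by
  have hlog : 0 ≤ Real.log N := Real.log_nonneg (by exact_mod_cast hN)
  calc _ ≤ ∑ q ∈ Finset.Icc 1 N, (1 + Real.log N) := by
        refine Finset.sum_le_sum fun q hq => ?_
        obtain ⟨h1, h2⟩ := Finset.mem_Icc.1 hq
        have hq0 : (0:ℝ) < q := by exact_mod_cast h1
        have hlq : Real.log q ≤ Real.log N := Real.log_le_log hq0 (by exact_mod_cast h2)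
        calc _ ≤ ∑ a ∈ Finset.range q, (1 / (2 * q)) * ‖sawMult (a / q)‖ := by
              refine Finset.sum_le_sum fun a ha => ?_
              have := norm_sawMult_div_le_half q a (Finset.mem_range.1 ha)
              rw [div_le_iff₀ (by positivity)]
              have e : 1 / (2 * (q:ℝ)) * ‖sawMult (a / q)‖ * q ^ 2 = ‖sawMult (a / q)‖ * (q / 2) := by
                field_simp
              rw [e, sq]
              exact mul_le_mul_of_nonneg_left this (norm_nonneg _)
          _ ≤ 1 / (2 * q) * (q / 2 * (1 + Real.log q)) := by
              rw [← Finset.mul_sum]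
              exact mul_le_mul_of_nonneg_left (sum_norm_sawMult_le q) (by positivity)
          _ = 1 / 4 * (1 + Real.log q) := by field_simp; norm_num
          _ ≤ _ := by linarith
    _ = _ := by simp; ring

lemma sum_sawMult_diff_sq_le (N k : ℕ) (hN : 1 ≤ N) :
    ∑ q ∈ Finset.Icc 1 N, ∑ a ∈ Finset.range q,
        ‖sawMult (a / q) * (addExp (k * (a / q)) - 1)‖ ^ 2 / q ^ 2
      ≤ k * (1 + Real.log N) ^ 2 := by
  have hlog : 0 ≤ Real.log N := Real.log_nonneg (by exact_mod_cast hN)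
  calc _ ≤ ∑ q ∈ Finset.Icc 1 N, k * (1 + Real.log N) * (1 / q) := by
        refine Finset.sum_le_sum fun q hq => ?_
        obtain ⟨h1, h2⟩ := Finset.mem_Icc.1 hq
        have hq0 : (0:ℝ) < q := by exact_mod_cast h1
        have hlq : Real.log q ≤ Real.log N := Real.log_le_log hq0 (by exact_mod_cast h2)
        calc _ ≤ ∑ a ∈ Finset.range q, (2 * k / (q:ℝ) ^ 2) * ‖sawMult (a / q)‖ := by
              refine Finset.sum_le_sum fun a ha => ?_
              have e1 := norm_sawMult_mul_le k (a / q)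
              have e2 : ‖sawMult (a / q) * (addExp (k * (a / q)) - 1)‖ ≤ 2 * ‖sawMult (a / q)‖ := by
                rw [norm_mul, mul_comm]
                refine mul_le_mul_of_nonneg_right ?_ (norm_nonneg _)
                refine (norm_sub_le _ _).trans ?_
                rw [norm_addExp, norm_one]; norm_num
              rw [div_mul_eq_mul_div]
              refine div_le_div_of_nonneg_right ?_ (by positivity)
              rw [sq]
              calc _ ≤ (k:ℝ) * (2 * ‖sawMult (a / q)‖) :=
                    mul_le_mul e1 e2 (norm_nonneg _) (by positivity)
                _ = _ := by ring
          _ ≤ 2 * k / (q:ℝ) ^ 2 * (q / 2 * (1 + Real.log q)) := by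
              rw [← Finset.mul_sum]
              exact mul_le_mul_of_nonneg_left (sum_norm_sawMult_le q) (by positivity)
          _ = k * (1 + Real.log q) * (1 / q) := by field_simp
          _ ≤ _ := by gcongr
    _ ≤ k * (1 + Real.log N) * (1 + Real.log N) := by
        rw [← Finset.mul_sum]
        exact mul_le_mul_of_nonneg_left (sum_inv_Icc_le N) (by positivity)
    _ = _ := by ring

lemma sum_sawSum_diff_sq_le (N X k : ℕ) (hN : 1 ≤ N) (hX : N ^ 2 ≤ 2 * X) (w : ℕ → ℂ) (W : ℝ)
    (hw : ∀ m, ‖w m‖ ≤ W) :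
    ∑ n ∈ Finset.range X, ‖sawSum N w (n + k) - sawSum N w n‖ ^ 2
      ≤ 6 * X * W ^ 2 * (1 + Real.log N) ^ 4 * k := by
  have h := large_sieve_fractions N X hN hX w W hw
    (fun r => sawMult r * (addExp (k * r) - 1))
  have e : ∀ n, sawSum N w (n + k) - sawSum N w n = ∑ m ∈ Finset.Icc 1 N,
        w m * ((1 / m) * ∑ j ∈ Finset.range m,
          (sawMult (j / m) * (addExp (k * (j / m)) - 1)) * addExp (n * (j / m))) := by
    intro n
    rw [sawSum, sawSum, ← Finset.sum_sub_distrib]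
    refine Finset.sum_congr rfl fun m hm => ?_
    have hm1 := (Finset.mem_Icc.1 hm).1
    have h1 := saw_eq_sum m (n + k) hm1
    have h2 := saw_eq_sum m n hm1
    have h3 : (saw m (n + k) : ℂ) - saw m n
        = (1 / m) * ∑ j ∈ Finset.range m,
          (sawMult (j / m) * (addExp (k * (j / m)) - 1)) * addExp (n * (j / m)) := by
      push_cast at h1 h2
      have : (saw m (n + k) : ℂ) - saw m n
        = (saw m (n + k) + 1 / (2 * m)) - (saw m n + 1 / (2 * m)) := by ring
      rw [this, h1, h2, ← mul_sub, ← Finset.sum_sub_distrib]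
      congr 1
      refine Finset.sum_congr rfl fun j _ => ?_
      rw [add_mul, addExp_add]
      ring
    rw [← h3]; ring
  simp only [e]
  refine h.trans ?_
  calc _ ≤ 6 * X * (W * (1 + Real.log N)) ^ 2 * (k * (1 + Real.log N) ^ 2) :=
        mul_le_mul_of_nonneg_left (sum_sawMult_diff_sq_le N k hN) (by positivity)
    _ = _ := by ring

lemma sum_sawSum_sq_le (N X : ℕ) (hN : 1 ≤ N) (hX : N ^ 2 ≤ 2 * X) (w : ℕ → ℂ) (W : ℝ)
    (hw : ∀ m, ‖w m‖ ≤ W) :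
    ∑ n ∈ Finset.range X, ‖sawSum N w n‖ ^ 2
      ≤ 14 * X * W ^ 2 * (1 + Real.log N) ^ 4 * N := by
  have h := large_sieve_fractions N X hN hX w W hw sawMult
  have hW : 0 ≤ W := (norm_nonneg _).trans (hw 0)
  have hN' : (1:ℝ) ≤ N := by exact_mod_cast hN
  have hlog : 0 ≤ Real.log N := Real.log_nonneg hN'
  set c : ℂ := ∑ m ∈ Finset.Icc 1 N, w m * (1 / (2 * m)) with hc
  have hcn : ‖c‖ ≤ W * (1 + Real.log N) := by
    calc ‖c‖ ≤ ∑ m ∈ Finset.Icc 1 N, W * (1 / (m:ℝ)) := by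
          refine norm_sum_le_of_le _ fun m hm => ?_
          have hm1 : (0:ℝ) < m := by exact_mod_cast (Finset.mem_Icc.1 hm).1
          rw [norm_mul, norm_div, norm_one, norm_mul, Complex.norm_natCast]
          refine mul_le_mul (hw m) ?_ (by positivity) hW
          apply one_div_le_one_div_of_le hm1
          norm_num; linarith
      _ ≤ _ := by
          rw [← Finset.mul_sum]
          exact mul_le_mul_of_nonneg_left (sum_inv_Icc_le N) hW
  have e : ∀ n, sawSum N w n + c = ∑ m ∈ Finset.Icc 1 N,
        w m * ((1 / m) * ∑ j ∈ Finset.range m, sawMult (j / m) * addExp (n * (j / m))) := by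
    intro n
    rw [sawSum, hc, ← Finset.sum_add_distrib]
    refine Finset.sum_congr rfl fun m hm => ?_
    rw [← saw_eq_sum m n (Finset.mem_Icc.1 hm).1]
    push_cast; ring
  have h1 : ∑ n ∈ Finset.range X, ‖sawSum N w n + c‖ ^ 2
      ≤ 6 * X * (W * (1 + Real.log N)) ^ 2 * (N * (1 + Real.log N)) := by
    simp only [e]
    exact h.trans (mul_le_mul_of_nonneg_left (sum_sawMult_sq_le N hN) (by positivity))
  have h2 : ∀ n, ‖sawSum N w n‖ ^ 2 ≤ 2 * ‖sawSum N w n + c‖ ^ 2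
      + 2 * (W * (1 + Real.log N)) ^ 2 := by
    intro n
    have e1 : ‖sawSum N w n‖ ≤ ‖sawSum N w n + c‖ + ‖c‖ := by
      have : sawSum N w n = (sawSum N w n + c) - c := by ring
      conv_lhs => rw [this]
      exact norm_sub_le _ _
    have e2 : ‖sawSum N w n‖ ≤ ‖sawSum N w n + c‖ + W * (1 + Real.log N) := by linarith
    have e3 := pow_le_pow_left₀ (norm_nonneg _) e2 2
    nlinarith [sq_nonneg (‖sawSum N w n + c‖ - W * (1 + Real.log N))]
  calc _ ≤ ∑ n ∈ Finset.range X, (2 * ‖sawSum N w n + c‖ ^ 2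
        + 2 * (W * (1 + Real.log N)) ^ 2) := Finset.sum_le_sum fun n _ => h2 n
    _ = 2 * ∑ n ∈ Finset.range X, ‖sawSum N w n + c‖ ^ 2
        + X * (2 * (W * (1 + Real.log N)) ^ 2) := by
        rw [Finset.sum_add_distrib, Finset.mul_sum]; simp
    _ ≤ 2 * (6 * X * (W * (1 + Real.log N)) ^ 2 * (N * (1 + Real.log N)))
        + X * (2 * (W * (1 + Real.log N)) ^ 2) := by linarith
    _ ≤ _ := by
        set T := 1 + Real.log N with hT
        have hT1 : 1 ≤ T := by linarith
        have p0 : 0 ≤ (X:ℝ) * W ^ 2 * T ^ 2 := by positivity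
        have p1 : 1 ≤ T ^ 2 := one_le_pow₀ hT1
        have p2 : T ≤ T ^ 2 := by nlinarith
        have p3 : 1 ≤ T ^ 2 * N := by nlinarith
        have p4 : T * N ≤ T ^ 2 * N := by nlinarith
        nlinarith [mul_le_mul_of_nonneg_left p3 p0, mul_le_mul_of_nonneg_left p4 p0]

/-- Fourier coefficients, modulo `N`, of the indicator function of `{1, …, B}`. -/
noncomputable def cutCoeff (N B t : ℕ) : ℂ :=
  (1 / N) * ∑ m ∈ Finset.Icc 1 B, addExp (-(m * (t / N)))

/-- A majorant of `cutCoeff` that is uniform in the cut. -/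
noncomputable def cutBound (N t : ℕ) : ℝ :=
  2 / N * ‖sawMult (t / N)‖ + if t = 0 then 1 else 0

lemma cutBound_nonneg (N t : ℕ) : 0 ≤ cutBound N t := by
  rw [cutBound]
  split_ifs <;> positivity

lemma sum_cutBound_le (N : ℕ) (hN : 1 ≤ N) :
    ∑ t ∈ Finset.range N, cutBound N t ≤ 2 + Real.log N := by
  have hN' : (0:ℝ) < N := by exact_mod_cast hN
  simp only [cutBound]
  rw [Finset.sum_add_distrib, ← Finset.mul_sum]
  have h1 := mul_le_mul_of_nonneg_left (sum_norm_sawMult_le N) (by positivity : (0:ℝ) ≤ 2 / N)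
  have h2 : (2:ℝ) / N * (N / 2 * (1 + Real.log N)) = 1 + Real.log N := by field_simp
  have h3 : ∑ t ∈ Finset.range N, (if t = 0 then (1:ℝ) else 0) ≤ 1 := by
    rw [Finset.sum_ite_eq']
    split_ifs <;> norm_num
  linarith

lemma norm_cutCoeff_le (N B t : ℕ) (hB : B ≤ N) (ht : t < N) :
    ‖cutCoeff N B t‖ ≤ cutBound N t := by
  have hN' : (0:ℝ) < N := by exact_mod_cast (Nat.zero_le t).trans_lt ht
  rw [cutCoeff, cutBound, norm_mul, norm_div, norm_one, Complex.norm_natCast]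
  split_ifs with h0
  · have h1 : ‖∑ m ∈ Finset.Icc 1 B, addExp (-(m * (t / N)))‖ ≤ N := by
      refine (norm_sum_le _ _).trans ?_
      simp only [norm_addExp]
      simp
      exact_mod_cast hB
    have h2 : 1 / (N:ℝ) * ‖∑ m ∈ Finset.Icc 1 B, addExp (-(m * (t / N)))‖ ≤ 1 := by
      rw [one_div, inv_mul_le_iff₀ hN']; linarith
    have : 0 ≤ 2 / (N:ℝ) * ‖sawMult (t / N)‖ := by positivity
    linarith
  · have hne := addExp_ne_one (j := t) (m := N) (Nat.pos_of_ne_zero h0) ht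
    have hz1 : 0 < ‖addExp (-((t:ℝ) / N)) - 1‖ := by
      rw [norm_addExp_neg_sub_one, norm_pos_iff]
      exact sub_ne_zero.2 hne
    have e1 : ∀ m : ℕ, addExp (-(m * (t / N))) = addExp (-((t:ℝ) / N)) ^ m := by
      intro m
      rw [← addExp_nat_mul, mul_neg]
    have h2 : ‖∑ m ∈ Finset.Icc 1 B, addExp (-(m * (t / N)))‖ * ‖addExp (-((t:ℝ) / N)) - 1‖ ≤ 2 := by
      rw [← norm_mul]
      simp only [e1]
      have hI : Finset.Icc 1 B = Finset.Ico 1 (B + 1) := rfl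
      rw [hI, Finset.sum_mul]
      have : ∀ m ∈ Finset.Ico 1 (B + 1), addExp (-((t:ℝ) / N)) ^ m * (addExp (-((t:ℝ) / N)) - 1)
          = addExp (-((t:ℝ) / N)) ^ (m + 1) - addExp (-((t:ℝ) / N)) ^ m := by
        intro m _; ring
      rw [Finset.sum_congr rfl this, Finset.sum_Ico_sub _ (by omega)]
      refine (norm_sub_le _ _).trans ?_
      rw [norm_pow, norm_pow, norm_addExp]; norm_num
    rw [add_zero, sawMult, norm_inv, div_mul_eq_mul_div, one_mul, div_mul_eq_mul_div]
    refine div_le_div_of_nonneg_right ?_ hN'.le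
    rw [← div_eq_mul_inv, le_div_iff₀ hz1]
    exact h2

lemma sum_Icc_eq_sum_cutCoeff (N B : ℕ) (hN : 1 ≤ N) (hB : B ≤ N) (x : ℕ → ℂ) :
    ∑ m ∈ Finset.Icc 1 B, x m = ∑ t ∈ Finset.range N, cutCoeff N B t *
      ∑ m ∈ Finset.Icc 1 N, x m * addExp (m * (t / N)) := by
  have hN0 : (N:ℂ) ≠ 0 := by exact_mod_cast (by omega : N ≠ 0)
  have hN0' : (N:ℝ) ≠ 0 := by exact_mod_cast (by omega : N ≠ 0)
  have key : ∀ m ∈ Finset.Icc 1 N, ∑ t ∈ Finset.range N, cutCoeff N B t * addExp (m * (t / N))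
      = if m ≤ B then 1 else 0 := by
    intro m hm
    obtain ⟨hm1, hm2⟩ := Finset.mem_Icc.1 hm
    have e1 : ∀ t, cutCoeff N B t * addExp (m * (t / N))
        = ∑ l ∈ Finset.Icc 1 B, (1 / N) * addExp (((m + N - l : ℕ) : ℝ) * (t / N)) := by
      intro t
      rw [cutCoeff, Finset.mul_sum, Finset.sum_mul]
      refine Finset.sum_congr rfl fun l hl => ?_
      have hl2 := (Finset.mem_Icc.1 hl).2
      rw [mul_assoc, ← addExp_add]
      have : ((m + N - l : ℕ) : ℝ) * (t / N) = -(l * (t / N)) + m * (t / N) + (t:ℕ) := by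
        rw [Nat.cast_sub (by omega)]
        push_cast
        field_simp; ring
      rw [this, addExp_add _ (t:ℝ), addExp_natCast, mul_one]
    simp only [e1]
    rw [Finset.sum_comm]
    simp only [← Finset.mul_sum]
    have e2 : ∀ l ∈ Finset.Icc 1 B,
        ∑ t ∈ Finset.range N, addExp (((m + N - l : ℕ) : ℝ) * (t / N))
          = if l = m then (N:ℂ) else 0 := by
      intro l hl
      obtain ⟨hl1, hl2⟩ := Finset.mem_Icc.1 hl
      rw [sum_addExp_div N _ (by omega)]
      have : N ∣ m + N - l ↔ l = m := by
        constructor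
        · rintro ⟨c, hc⟩
          have h0 : 0 < c := by
            rcases Nat.eq_zero_or_pos c with rfl | h
            · simp at hc; omega
            · exact h
          have h1 : c < 2 := by
            by_contra h
            push Not at h
            have : N * 2 ≤ N * c := Nat.mul_le_mul_left _ h
            omega
          have : c = 1 := by omega
          subst this; omega
        · rintro rfl
          exact ⟨1, by omega⟩
      simp only [this]
    rw [Finset.sum_congr rfl e2, Finset.sum_ite_eq']
    by_cases hmB : m ≤ B
    · rw [if_pos (Finset.mem_Icc.2 ⟨hm1, hmB⟩), if_pos hmB]
      field_simp
    · rw [if_neg (fun h => hmB (Finset.mem_Icc.1 h).2), if_neg hmB, mul_zero]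
  simp only [Finset.mul_sum]
  rw [Finset.sum_comm]
  have e3 : ∀ m ∈ Finset.Icc 1 N,
      ∑ t ∈ Finset.range N, cutCoeff N B t * (x m * addExp (m * (t / N)))
        = if m ≤ B then x m else 0 := by
    intro m hm
    have : ∀ t ∈ Finset.range N, cutCoeff N B t * (x m * addExp (m * (t / N)))
        = x m * (cutCoeff N B t * addExp (m * (t / N))) := fun t _ => by ring
    rw [Finset.sum_congr rfl this, ← Finset.mul_sum, key m hm]
    split_ifs <;> simp
  rw [Finset.sum_congr rfl e3, ← Finset.sum_filter]
  refine Finset.sum_congr ?_ fun _ _ => rfl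
  ext m
  simp only [Finset.mem_Icc, Finset.mem_filter]
  omega

lemma norm_sum_mul_sq_le {ι : Type*} (s : Finset ι) (κ y : ι → ℂ) (b : ι → ℝ)
    (hb : ∀ i ∈ s, ‖κ i‖ ≤ b i) :
    ‖∑ i ∈ s, κ i * y i‖ ^ 2 ≤ (∑ i ∈ s, b i) * ∑ i ∈ s, b i * ‖y i‖ ^ 2 := by
  have h1 : ‖∑ i ∈ s, κ i * y i‖ ≤ ∑ i ∈ s, b i * ‖y i‖ := by
    refine norm_sum_le_of_le _ fun i hi => ?_
    rw [norm_mul]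
    exact mul_le_mul_of_nonneg_right (hb i hi) (norm_nonneg _)
  have h0 : ∀ i ∈ s, 0 ≤ b i := fun i hi => (norm_nonneg _).trans (hb i hi)
  refine (pow_le_pow_left₀ (norm_nonneg _) h1 2).trans ?_
  refine Finset.sum_sq_le_sum_mul_sum_of_sq_le_mul s h0 ?_ ?_
  · intro i hi
    exact mul_nonneg (h0 i hi) (sq_nonneg _)
  · intro i _; exact le_of_eq (by ring)

lemma sawSum_eq_sum_cutCoeff (N B : ℕ) (hN : 1 ≤ N) (hB : B ≤ N) (w : ℕ → ℂ) (n : ℕ) :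
    sawSum B w n = ∑ t ∈ Finset.range N, cutCoeff N B t *
      sawSum N (fun m => w m * addExp (m * (t / N))) n := by
  rw [sawSum, sum_Icc_eq_sum_cutCoeff N B hN hB]
  refine Finset.sum_congr rfl fun t _ => ?_
  rw [sawSum]
  congr 1
  refine Finset.sum_congr rfl fun m _ => ?_
  ring

/-- Short differences of sawtooth sums are small in mean square, uniformly in the cut. -/
lemma exists_sawSum_sub_bound (N X K : ℕ) (hN : 1 ≤ N) (hK : 1 ≤ K) (hX : N ^ 2 ≤ 2 * X)
    (w : ℕ → ℂ) (W : ℝ) (hw : ∀ m, ‖w m‖ ≤ W) :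
    ∃ Φ : ℕ → ℝ, (∀ n, 0 ≤ Φ n) ∧
      ∑ n ∈ Finset.range X, Φ n ≤ 192 * X * K * W ^ 2 * (1 + Real.log N) ^ 6 ∧
      ∀ B ≤ N, ∀ n n', n' ≤ n → n ≤ n' + K →
        ‖sawSum B w n - sawSum B w n'‖ ^ 2 ≤ Φ n + Φ n' := by
  have hN' : (1:ℝ) ≤ N := by exact_mod_cast hN
  have hK' : (1:ℝ) ≤ K := by exact_mod_cast hK
  have hlog : 0 ≤ Real.log N := Real.log_nonneg hN'
  set v : ℕ → ℕ → ℂ := fun t m => w m * addExp (m * (t / N)) with hv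
  have hvW : ∀ t m, ‖v t m‖ ≤ W := by
    intro t m
    simp only [hv]
    rw [norm_mul, norm_addExp, mul_one]; exact hw m
  set φ : ℕ → ℕ → ℝ := fun t n => 2 / K * ∑ k ∈ Finset.Icc 1 (2 * K),
    ‖sawSum N (v t) (n + k) - sawSum N (v t) n‖ ^ 2 with hφ
  set S : ℝ := ∑ t ∈ Finset.range N, cutBound N t with hS
  have hS0 : 0 ≤ S := Finset.sum_nonneg fun t _ => cutBound_nonneg N t
  have hS2 : S ≤ 2 * (1 + Real.log N) := by
    have := sum_cutBound_le N hN
    linarith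
  have hφ0 : ∀ t n, 0 ≤ φ t n := fun t n => by
    simp only [hφ]
    exact mul_nonneg (by positivity) (Finset.sum_nonneg fun _ _ => sq_nonneg _)
  refine ⟨fun n => S * ∑ t ∈ Finset.range N, cutBound N t * φ t n, ?_, ?_, ?_⟩
  · intro n
    exact mul_nonneg hS0 (Finset.sum_nonneg fun t _ => mul_nonneg (cutBound_nonneg N t) (hφ0 t n))
  · have hφs : ∀ t, ∑ n ∈ Finset.range X, φ t n ≤ 48 * X * K * W ^ 2 * (1 + Real.log N) ^ 4 := by
      intro t
      simp only [hφ]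
      rw [← Finset.mul_sum, Finset.sum_comm]
      calc _ ≤ 2 / (K:ℝ) * ∑ k ∈ Finset.Icc 1 (2 * K),
              (6 * X * W ^ 2 * (1 + Real.log N) ^ 4 * (2 * K)) := by
            refine mul_le_mul_of_nonneg_left ?_ (by positivity)
            refine Finset.sum_le_sum fun k hk => ?_
            refine (sum_sawSum_diff_sq_le N X k hN hX (v t) W (hvW t)).trans ?_
            have hk2 : (k:ℝ) ≤ 2 * K := by exact_mod_cast (Finset.mem_Icc.1 hk).2
            exact mul_le_mul_of_nonneg_left hk2 (by positivity)
        _ = 48 * X * K * W ^ 2 * (1 + Real.log N) ^ 4 := by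
            rw [Finset.sum_const, Nat.card_Icc, nsmul_eq_mul]
            have hK0 : (K:ℝ) ≠ 0 := by positivity
            push_cast [Nat.add_sub_cancel]
            field_simp
            ring
    rw [← Finset.mul_sum, Finset.sum_comm]
    simp only [← Finset.mul_sum]
    calc _ ≤ S * ∑ t ∈ Finset.range N, cutBound N t *
              (48 * X * K * W ^ 2 * (1 + Real.log N) ^ 4) := by
          refine mul_le_mul_of_nonneg_left ?_ hS0
          exact Finset.sum_le_sum fun t _ =>
            mul_le_mul_of_nonneg_left (hφs t) (cutBound_nonneg N t)
      _ = S ^ 2 * (48 * X * K * W ^ 2 * (1 + Real.log N) ^ 4) := by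
          rw [← Finset.sum_mul]; ring
      _ ≤ (2 * (1 + Real.log N)) ^ 2 * (48 * X * K * W ^ 2 * (1 + Real.log N) ^ 4) := by
          refine mul_le_mul_of_nonneg_right ?_ (by positivity)
          exact pow_le_pow_left₀ hS0 hS2 2
      _ = _ := by ring
  · intro B hB n n' hnn hnK
    have e : sawSum B w n - sawSum B w n' = ∑ t ∈ Finset.range N, cutCoeff N B t *
        (sawSum N (v t) n - sawSum N (v t) n') := by
      rw [sawSum_eq_sum_cutCoeff N B hN hB, sawSum_eq_sum_cutCoeff N B hN hB,
        ← Finset.sum_sub_distrib]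
      exact Finset.sum_congr rfl fun t _ => by ring
    rw [e]
    refine (norm_sum_mul_sq_le _ _ _ (cutBound N)
      fun t ht => norm_cutCoeff_le N B t hB (Finset.mem_range.1 ht)).trans ?_
    rw [← mul_add, ← Finset.sum_add_distrib]
    refine mul_le_mul_of_nonneg_left ?_ hS0
    refine Finset.sum_le_sum fun t _ => ?_
    rw [← mul_add]
    refine mul_le_mul_of_nonneg_left ?_ (cutBound_nonneg N t)
    set G := sawSum N (v t) with hG
    have hpt : ∀ k, ‖G n - G n'‖ ^ 2 ≤ 2 * ‖G (n + k) - G n‖ ^ 2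
        + 2 * ‖G (n + k) - G n'‖ ^ 2 := by
      intro k
      have h1 : ‖G n - G n'‖ ≤ ‖G (n + k) - G n‖ + ‖G (n + k) - G n'‖ := by
        have : G n - G n' = (G (n + k) - G n') - (G (n + k) - G n) := by ring
        rw [this]
        exact (norm_sub_le _ _).trans (le_of_eq (add_comm _ _))
      have h2 := pow_le_pow_left₀ (norm_nonneg _) h1 2
      nlinarith [sq_nonneg (‖G (n + k) - G n‖ - ‖G (n + k) - G n'‖)]
    have hsum : (K:ℝ) * ‖G n - G n'‖ ^ 2 ≤ ∑ k ∈ Finset.Icc 1 K,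
        (2 * ‖G (n + k) - G n‖ ^ 2 + 2 * ‖G (n + k) - G n'‖ ^ 2) := by
      have := Finset.sum_le_sum fun k (_ : k ∈ Finset.Icc 1 K) => hpt k
      rw [Finset.sum_const, Nat.card_Icc, nsmul_eq_mul] at this
      simpa using this
    rw [Finset.sum_add_distrib, ← Finset.mul_sum, ← Finset.mul_sum] at hsum
    have hA : ∑ k ∈ Finset.Icc 1 K, ‖G (n + k) - G n‖ ^ 2
        ≤ ∑ k ∈ Finset.Icc 1 (2 * K), ‖G (n + k) - G n‖ ^ 2 :=
      Finset.sum_le_sum_of_subset_of_nonneg (Finset.Icc_subset_Icc_right (by omega))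
        fun _ _ _ => sq_nonneg _
    have hB' : ∑ k ∈ Finset.Icc 1 K, ‖G (n + k) - G n'‖ ^ 2
        ≤ ∑ k ∈ Finset.Icc 1 (2 * K), ‖G (n' + k) - G n'‖ ^ 2 := by
      have e2 : ∑ k ∈ Finset.Icc 1 K, ‖G (n + k) - G n'‖ ^ 2
          = ∑ k ∈ (Finset.Icc 1 K).image (fun k => n - n' + k), ‖G (n' + k) - G n'‖ ^ 2 := by
        rw [Finset.sum_image (by intro a _ b _ h; simpa using h)]
        refine Finset.sum_congr rfl fun k _ => ?_
        have : n' + (n - n' + k) = n + k := by omega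
        rw [this]
      rw [e2]
      refine Finset.sum_le_sum_of_subset_of_nonneg ?_ fun _ _ _ => sq_nonneg _
      intro l hl
      obtain ⟨k, hk, rfl⟩ := Finset.mem_image.1 hl
      have := Finset.mem_Icc.1 hk
      rw [Finset.mem_Icc]; omega
    simp only [hφ]
    rw [← mul_add, div_mul_eq_mul_div, le_div_iff₀ (by linarith)]
    linarith

/-- Sawtooth sums are small in mean square, uniformly in the cut. -/
lemma exists_sawSum_bound (N X : ℕ) (hN : 1 ≤ N) (hX : N ^ 2 ≤ 2 * X)
    (w : ℕ → ℂ) (W : ℝ) (hw : ∀ m, ‖w m‖ ≤ W) :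
    ∃ Φ : ℕ → ℝ, (∀ n, 0 ≤ Φ n) ∧
      ∑ n ∈ Finset.range X, Φ n ≤ 56 * X * N * W ^ 2 * (1 + Real.log N) ^ 6 ∧
      ∀ B ≤ N, ∀ n, ‖sawSum B w n‖ ^ 2 ≤ Φ n := by
  have hN' : (1:ℝ) ≤ N := by exact_mod_cast hN
  have hlog : 0 ≤ Real.log N := Real.log_nonneg hN'
  set v : ℕ → ℕ → ℂ := fun t m => w m * addExp (m * (t / N)) with hv
  have hvW : ∀ t m, ‖v t m‖ ≤ W := by
    intro t m
    simp only [hv]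
    rw [norm_mul, norm_addExp, mul_one]; exact hw m
  set S : ℝ := ∑ t ∈ Finset.range N, cutBound N t with hS
  have hS0 : 0 ≤ S := Finset.sum_nonneg fun t _ => cutBound_nonneg N t
  have hS2 : S ≤ 2 * (1 + Real.log N) := by
    have := sum_cutBound_le N hN
    linarith
  refine ⟨fun n => S * ∑ t ∈ Finset.range N, cutBound N t * ‖sawSum N (v t) n‖ ^ 2, ?_, ?_, ?_⟩
  · intro n
    exact mul_nonneg hS0 (Finset.sum_nonneg fun t _ =>
      mul_nonneg (cutBound_nonneg N t) (sq_nonneg _))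
  · rw [← Finset.mul_sum, Finset.sum_comm]
    simp only [← Finset.mul_sum]
    calc _ ≤ S * ∑ t ∈ Finset.range N, cutBound N t *
              (14 * X * W ^ 2 * (1 + Real.log N) ^ 4 * N) := by
          refine mul_le_mul_of_nonneg_left ?_ hS0
          exact Finset.sum_le_sum fun t _ =>
            mul_le_mul_of_nonneg_left (sum_sawSum_sq_le N X hN hX (v t) W (hvW t))
              (cutBound_nonneg N t)
      _ = S ^ 2 * (14 * X * W ^ 2 * (1 + Real.log N) ^ 4 * N) := by
          rw [← Finset.sum_mul]; ring
      _ ≤ (2 * (1 + Real.log N)) ^ 2 * (14 * X * W ^ 2 * (1 + Real.log N) ^ 4 * N) := by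
          refine mul_le_mul_of_nonneg_right ?_ (by positivity)
          exact pow_le_pow_left₀ hS0 hS2 2
      _ = _ := by ring
  · intro B hB n
    rw [sawSum_eq_sum_cutCoeff N B hN hB]
    exact norm_sum_mul_sq_le _ _ _ (cutBound N)
      fun t ht => norm_cutCoeff_le N B t hB (Finset.mem_range.1 ht)

lemma exists_abs_eval_le_exp (P : Polynomial ℝ) {ε : ℝ} (hε : 0 < ε) :
    ∃ K : ℝ, 0 < K ∧ ∀ u : ℝ, 0 ≤ u → |P.eval u| ≤ K * Real.exp (ε * u) := by
  induction P using Polynomial.induction_on' with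
  | add p q hp hq =>
    obtain ⟨K1, h1, hp⟩ := hp
    obtain ⟨K2, h2, hq⟩ := hq
    refine ⟨K1 + K2, by positivity, fun u hu => ?_⟩
    rw [Polynomial.eval_add, add_mul]
    exact (abs_add_le _ _).trans (add_le_add (hp u hu) (hq u hu))
  | monomial n a =>
    refine ⟨|a| * (n.factorial / ε ^ n) + 1, by positivity, fun u hu => ?_⟩
    rw [Polynomial.eval_monomial, abs_mul, abs_of_nonneg (pow_nonneg hu n)]
    have h := Real.pow_div_factorial_le_exp (x := ε * u) (by positivity) n
    rw [div_le_iff₀ (by positivity), mul_pow] at h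
    have h2 : u ^ n ≤ n.factorial / ε ^ n * Real.exp (ε * u) := by
      rw [div_mul_eq_mul_div, le_div_iff₀ (by positivity)]; linarith
    have := mul_le_mul_of_nonneg_left h2 (abs_nonneg a)
    nlinarith [Real.exp_pos (ε * u)]

lemma exp_mul_log {x : ℝ} (hx : 0 < x) (ε : ℝ) : Real.exp (ε * Real.log x) = x ^ ε := by
  rw [Real.rpow_def_of_pos hx, mul_comm]

lemma exists_abs_eval_log_le (P : Polynomial ℝ) {ε : ℝ} (hε : 0 < ε) :
    ∃ K : ℝ, 0 < K ∧ ∀ x : ℝ, 1 ≤ x → |P.eval (Real.log x)| ≤ K * x ^ ε := by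
  obtain ⟨K, hK, h⟩ := exists_abs_eval_le_exp P hε
  refine ⟨K, hK, fun x hx => ?_⟩
  rw [← exp_mul_log (by linarith)]
  exact h _ (Real.log_nonneg hx)

lemma exists_log_pow_le (k : ℕ) {ε : ℝ} (hε : 0 < ε) :
    ∃ K : ℝ, 0 < K ∧ ∀ x : ℝ, 1 ≤ x → Real.log x ^ k ≤ K * x ^ ε := by
  obtain ⟨K, hK, h⟩ := exists_abs_eval_log_le (Polynomial.X ^ k) hε
  refine ⟨K, hK, fun x hx => ?_⟩
  have := h x hx
  rw [Polynomial.eval_pow, Polynomial.eval_X] at this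
  exact (le_abs_self _).trans this

lemma exists_card_divisors_le {ε : ℝ} (hε : 0 < ε) :
    ∃ K : ℝ, 0 < K ∧ ∀ n : ℕ, 1 ≤ n → (n.divisors.card : ℝ) ≤ K * (n:ℝ) ^ ε := by
  have hl2 : 0 < Real.log 2 := Real.log_pos (by norm_num)
  set C : ℝ := 1 + 1 / (ε * Real.log 2) with hC
  have hC1 : 1 ≤ C := by
    have : 0 < 1 / (ε * Real.log 2) := by positivity
    linarith
  set M : ℕ := ⌈(2:ℝ) ^ (1 / ε)⌉₊ with hM
  have hsmall : ∀ p e : ℕ, 2 ≤ p → (e:ℝ) + 1 ≤ C * ((p:ℝ) ^ e) ^ ε := by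
    intro p e hp
    have hp' : (2:ℝ) ≤ p := by exact_mod_cast hp
    have h1 : Real.exp (ε * (e * Real.log 2)) ≤ ((p:ℝ) ^ e) ^ ε := by
      rw [← exp_mul_log (by positivity), Real.log_pow]
      apply Real.exp_le_exp.2
      have := Real.log_le_log (by norm_num) hp'
      gcongr
    have h2 := Real.add_one_le_exp (ε * (e * Real.log 2))
    have h3 : (e:ℝ) + 1 ≤ C * (ε * (e * Real.log 2) + 1) := by
      have : C * (ε * (e * Real.log 2) + 1)
          = e + 1 + (ε * (e * Real.log 2) + 1 / (ε * Real.log 2)) := by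
        rw [hC]; field_simp; ring
      rw [this]
      have : 0 ≤ ε * (e * Real.log 2) + 1 / (ε * Real.log 2) := by positivity
      linarith
    exact h3.trans (mul_le_mul_of_nonneg_left (h2.trans h1) (by linarith))
  have hlarge : ∀ p e : ℕ, M ≤ p → (e:ℝ) + 1 ≤ ((p:ℝ) ^ e) ^ ε := by
    intro p e hp
    have hp' : (2:ℝ) ^ (1 / ε) ≤ p := (Nat.le_ceil _).trans (by exact_mod_cast hp)
    have h2 : (2:ℝ) ≤ (p:ℝ) ^ ε := by
      have := Real.rpow_le_rpow (by positivity) hp' hε.le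
      rwa [← Real.rpow_mul (by norm_num), one_div, inv_mul_cancel₀ hε.ne', Real.rpow_one] at this
    have h3 : ((p:ℝ) ^ e) ^ ε = ((p:ℝ) ^ ε) ^ e := by
      rw [← Real.rpow_natCast, ← Real.rpow_natCast, ← Real.rpow_mul (by positivity),
        ← Real.rpow_mul (by positivity), mul_comm]
    rw [h3]
    calc (e:ℝ) + 1 ≤ 2 ^ e := by exact_mod_cast Nat.succ_le_of_lt Nat.lt_two_pow_self
      _ ≤ _ := by gcongr
  refine ⟨C ^ M, by positivity, fun n hn => ?_⟩
  have hn0 : n ≠ 0 := by omega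
  rw [Nat.card_divisors hn0]
  push_cast
  have hfac : (n:ℝ) ^ ε = ∏ p ∈ n.primeFactors, ((p:ℝ) ^ (n.factorization p)) ^ ε := by
    rw [Real.finsetProd_rpow _ _ (fun p _ => by positivity)]
    congr 1
    conv_lhs => rw [← Nat.prod_factorization_pow_eq_self hn0]
    rw [Finsupp.prod, Nat.support_factorization]
    push_cast; rfl
  have hterm : ∀ p ∈ n.primeFactors, ((n.factorization p : ℕ) : ℝ) + 1
      ≤ (if p < M then C else 1) * ((p:ℝ) ^ (n.factorization p)) ^ ε := by
    intro p hp
    split_ifs with h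
    · exact hsmall p _ (Nat.prime_of_mem_primeFactors hp).two_le
    · rw [one_mul]; exact hlarge p _ (by omega)
  calc _ ≤ ∏ p ∈ n.primeFactors, (if p < M then C else 1) * ((p:ℝ) ^ (n.factorization p)) ^ ε :=
        Finset.prod_le_prod (fun _ _ => by positivity) hterm
    _ = (∏ p ∈ n.primeFactors, (if p < M then C else 1)) * (n:ℝ) ^ ε := by
        rw [Finset.prod_mul_distrib, hfac]
    _ ≤ C ^ M * (n:ℝ) ^ ε := by
        refine mul_le_mul_of_nonneg_right ?_ (by positivity)
        rw [← Finset.prod_filter, Finset.prod_const]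
        refine pow_le_pow_right₀ hC1 ?_
        calc _ ≤ (Finset.range M).card := by
              refine Finset.card_le_card fun p hp => ?_
              exact Finset.mem_range.2 (Finset.mem_filter.1 hp).2
          _ = M := Finset.card_range M

lemma dGen_nonneg (i j n : ℕ) : 0 ≤ dGen i j n :=
  Finset.sum_nonneg fun _ _ => mul_nonneg (pow_nonneg (Real.log_natCast_nonneg _) _)
    (pow_nonneg (Real.log_natCast_nonneg _) _)

lemma exists_dGen_le (i j : ℕ) {ε : ℝ} (hε : 0 < ε) :
    ∃ K : ℝ, 0 < K ∧ ∀ n : ℕ, 1 ≤ n → dGen i j n ≤ K * (n:ℝ) ^ ε := by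
  obtain ⟨K1, hK1, h1⟩ := exists_card_divisors_le (half_pos hε)
  obtain ⟨K2, hK2, h2⟩ := exists_log_pow_le (i + j) (half_pos hε)
  refine ⟨K1 * K2, by positivity, fun n hn => ?_⟩
  have hn1 : (1:ℝ) ≤ n := by exact_mod_cast hn
  have hlog : ∀ d, d ∣ n → Real.log d ≤ Real.log n := by
    intro d hd
    have hd0 : 0 < d := Nat.pos_of_dvd_of_pos hd hn
    exact Real.log_le_log (by exact_mod_cast hd0) (by exact_mod_cast Nat.le_of_dvd hn hd)
  calc dGen i j n ≤ ∑ x ∈ n.divisorsAntidiagonal, Real.log n ^ (i + j) := by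
        refine Finset.sum_le_sum fun x hx => ?_
        have hx := (Nat.mem_divisorsAntidiagonal.1 hx).1
        rw [pow_add]
        have := Real.log_natCast_nonneg x.1
        have := Real.log_natCast_nonneg x.2
        have := Real.log_natCast_nonneg n
        have a1 := hlog x.1 ⟨_, hx.symm⟩
        have a2 := hlog x.2 ⟨x.1, by rw [← hx, mul_comm]⟩
        gcongr
    _ = n.divisors.card * Real.log n ^ (i + j) := by
        refine (Nat.sum_divisorsAntidiagonal (n := n)
          (fun _ _ : ℕ => Real.log n ^ (i + j))).trans ?_
        rw [Finset.sum_const, nsmul_eq_mul]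
    _ ≤ (K1 * (n:ℝ) ^ (ε / 2)) * (K2 * (n:ℝ) ^ (ε / 2)) := by
        have := pow_nonneg (Real.log_natCast_nonneg n) (i + j)
        exact mul_le_mul (h1 n hn) (h2 n hn1) this (by positivity)
    _ = K1 * K2 * (n:ℝ) ^ ε := by
        rw [mul_mul_mul_comm, ← Real.rpow_add (by linarith), add_halves]

lemma hasDerivAt_eval_log_div_pow (P : Polynomial ℝ) (k : ℕ) {y : ℝ} (hy : 0 < y) :
    HasDerivAt (fun y => P.eval (Real.log y) / y ^ k)
      ((Polynomial.derivative P - (k : ℝ) • P).eval (Real.log y) / y ^ (k + 1)) y := by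
  have h1 : HasDerivAt (fun y => P.eval (Real.log y))
      ((Polynomial.derivative P).eval (Real.log y) * y⁻¹) y :=
    (P.hasDerivAt (Real.log y)).comp y (Real.hasDerivAt_log hy.ne')
  refine (h1.fun_div (hasDerivAt_pow k y) (pow_ne_zero k hy.ne')).congr_deriv ?_
  rw [Polynomial.eval_sub, Polynomial.eval_smul, smul_eq_mul]
  rcases k with _ | k
  · simp; field_simp
  · field_simp
    rw [Nat.add_sub_cancel]
    ring

lemma exists_abs_eval_log_div_pow_le (P : Polynomial ℝ) (k : ℕ) {ε : ℝ} (hε : 0 < ε) :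
    ∃ K : ℝ, 0 < K ∧ ∀ x : ℝ, 1 ≤ x → |P.eval (Real.log x) / x ^ k| ≤ K * x ^ (-(k:ℝ) + ε) := by
  obtain ⟨K, hK, h⟩ := exists_abs_eval_log_le P hε
  refine ⟨K, hK, fun x hx => ?_⟩
  have hx0 : 0 < x := by linarith
  rw [abs_div, abs_of_pos (pow_pos hx0 k), div_le_iff₀ (pow_pos hx0 k), mul_assoc,
    ← Real.rpow_natCast x k, ← Real.rpow_add hx0]
  have : -(k:ℝ) + ε + k = ε := by ring
  rw [this]; exact h x hx

lemma rpow_neg_sub_rpow_neg_ge (p : ℝ) (hp : 1 ≤ p) (n : ℕ) (hn : 1 ≤ n) :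
    2 ^ (-p) * (n:ℝ) ^ (-p - 1) ≤ (n:ℝ) ^ (-p) - ((n + 1 : ℕ) : ℝ) ^ (-p) := by
  have hn' : (1:ℝ) ≤ n := by exact_mod_cast hn
  have hn0 : (0:ℝ) < n := by linarith
  have hb := one_add_mul_self_le_rpow_one_add (s := 1 / (n:ℝ)) (by
    have : 0 ≤ 1 / (n:ℝ) := by positivity
    linarith) hp
  have e1 : (n:ℝ) ^ (-p) = ((n + 1 : ℕ) : ℝ) ^ (-p) * (1 + 1 / (n:ℝ)) ^ p := by
    have : (1 + 1 / (n:ℝ)) = (n + 1 : ℕ) / n := by push_cast; field_simp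
    rw [this, Real.div_rpow (by positivity) (by positivity), Real.rpow_neg (by positivity),
      Real.rpow_neg (by positivity)]
    have : (((n + 1 : ℕ) : ℝ)) ^ p ≠ 0 := by positivity
    field_simp
  have e2 : (2 * (n:ℝ)) ^ (-p) ≤ ((n + 1 : ℕ) : ℝ) ^ (-p) := by
    apply Real.rpow_le_rpow_of_nonpos (by positivity) _ (by linarith)
    push_cast; linarith
  have e3 : 2 ^ (-p) * (n:ℝ) ^ (-p - 1) = (2 * (n:ℝ)) ^ (-p) * (1 / n) := by
    rw [Real.mul_rpow (by norm_num) hn0.le, Real.rpow_sub hn0, Real.rpow_one]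
    ring
  rw [e3, e1]
  have e4 : 0 ≤ ((n + 1 : ℕ) : ℝ) ^ (-p) := by positivity
  have e5 : 1 / (n:ℝ) ≤ p * (1 / (n:ℝ)) := by
    have : 0 ≤ 1 / (n:ℝ) := by positivity
    nlinarith
  calc _ ≤ ((n + 1 : ℕ) : ℝ) ^ (-p) * (p * (1 / n)) :=
        mul_le_mul e2 e5 (by positivity) e4
    _ ≤ ((n + 1 : ℕ) : ℝ) ^ (-p) * ((1 + 1 / (n:ℝ)) ^ p - 1) :=
        mul_le_mul_of_nonneg_left (by linarith) e4
    _ = _ := by ring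

lemma exists_limit_of_summable_steps (s : ℕ → ℝ) (p K : ℝ) (hp : 1 ≤ p) (hK : 0 ≤ K)
    (hs : ∀ n : ℕ, 1 ≤ n → |s (n + 1) - s n| ≤ K * (n:ℝ) ^ (-p - 1)) :
    ∃ γ : ℝ, ∀ n : ℕ, 1 ≤ n → |s n - γ| ≤ K * 2 ^ p * (n:ℝ) ^ (-p) := by
  set C := K * 2 ^ p with hC
  have hC0 : 0 ≤ C := by positivity
  have hstep : ∀ n : ℕ, 1 ≤ n → |s (n + 1) - s n|
      ≤ C * (n:ℝ) ^ (-p) - C * ((n + 1 : ℕ) : ℝ) ^ (-p) := by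
    intro n hn
    refine (hs n hn).trans ?_
    have h := mul_le_mul_of_nonneg_left (rpow_neg_sub_rpow_neg_ge p hp n hn) hC0
    have e : C * (2 ^ (-p) * (n:ℝ) ^ (-p - 1)) = K * (n:ℝ) ^ (-p - 1) := by
      rw [hC, Real.rpow_neg (by norm_num)]
      have : (2:ℝ) ^ p ≠ 0 := by positivity
      field_simp
    linarith
  have hle : ∀ n : ℕ, 1 ≤ n → ∀ k, |s (n + k) - s n|
      ≤ C * (n:ℝ) ^ (-p) - C * ((n + k : ℕ) : ℝ) ^ (-p) := by
    intro n hn k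
    induction k with
    | zero => simp
    | succ k ih =>
      have h1 := hstep (n + k) (by omega)
      have h2 := abs_add_le (s (n + k + 1) - s (n + k)) (s (n + k) - s n)
      have e : s (n + (k + 1)) - s n = (s (n + k + 1) - s (n + k)) + (s (n + k) - s n) := by
        rw [← add_assoc]; ring
      rw [e]
      rw [← add_assoc]
      linarith
  have hbd : ∀ n m : ℕ, s (n + 1) - C * ((n + 1 : ℕ) : ℝ) ^ (-p)
      ≤ s (m + 1) + C * ((m + 1 : ℕ) : ℝ) ^ (-p) := by
    intro n m
    have p1 : 0 ≤ C * ((n + 1 : ℕ) : ℝ) ^ (-p) := by positivity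
    have p2 : 0 ≤ C * ((m + 1 : ℕ) : ℝ) ^ (-p) := by positivity
    rcases le_total n m with h | h
    · obtain ⟨k, rfl⟩ := Nat.exists_eq_add_of_le h
      have h1 := (abs_le.1 (hle (n + 1) (by omega) k)).1
      have e : n + 1 + k = n + k + 1 := by omega
      rw [e] at h1
      linarith
    · obtain ⟨k, rfl⟩ := Nat.exists_eq_add_of_le h
      have h1 := (abs_le.1 (hle (m + 1) (by omega) k)).2
      have e : m + 1 + k = m + k + 1 := by omega
      rw [e] at h1
      linarith
  refine ⟨⨆ n : ℕ, (s (n + 1) - C * ((n + 1 : ℕ) : ℝ) ^ (-p)), fun n hn => ?_⟩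
  obtain ⟨m, rfl⟩ : ∃ m, n = m + 1 := ⟨n - 1, by omega⟩
  have h1 : (⨆ n : ℕ, (s (n + 1) - C * ((n + 1 : ℕ) : ℝ) ^ (-p)))
      ≤ s (m + 1) + C * ((m + 1 : ℕ) : ℝ) ^ (-p) := ciSup_le fun n => hbd n m
  have h2 : s (m + 1) - C * ((m + 1 : ℕ) : ℝ) ^ (-p)
      ≤ ⨆ n : ℕ, (s (n + 1) - C * ((n + 1 : ℕ) : ℝ) ^ (-p)) :=
    le_ciSup (f := fun n : ℕ => s (n + 1) - C * ((n + 1 : ℕ) : ℝ) ^ (-p))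
      ⟨s 1 + C * ((0 + 1 : ℕ) : ℝ) ^ (-p), by rintro _ ⟨n, rfl⟩; exact hbd n 0⟩ m
  rw [abs_le]
  constructor <;> linarith

lemma abs_sub_le_of_deriv_bound {g g' : ℝ → ℝ} {a b M : ℝ} (hab : a ≤ b)
    (hg : ∀ x ∈ Set.Icc a b, HasDerivAt g (g' x) x) (hM : ∀ x ∈ Set.Icc a b, |g' x| ≤ M) :
    |g b - g a| ≤ M * (b - a) := by
  have := Convex.norm_image_sub_le_of_norm_hasDerivWithin_le (f := g) (f' := g')
    (s := Set.Icc a b) (C := M) (x := a) (y := b)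
    (fun x hx => (hg x hx).hasDerivWithinAt) hM (convex_Icc a b)
    (Set.left_mem_Icc.2 hab) (Set.right_mem_Icc.2 hab)
  rwa [Real.norm_eq_abs, Real.norm_eq_abs, abs_of_nonneg (sub_nonneg.2 hab)] at this

lemma abs_trapezoid_le {F f f' f'' : ℝ → ℝ} {a M : ℝ}
    (hF : ∀ x ∈ Set.Icc a (a + 1), HasDerivAt F (f x) x)
    (hf : ∀ x ∈ Set.Icc a (a + 1), HasDerivAt f (f' x) x)
    (hf' : ∀ x ∈ Set.Icc a (a + 1), HasDerivAt f' (f'' x) x)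
    (hM : ∀ x ∈ Set.Icc a (a + 1), |f'' x| ≤ M) :
    |F (a + 1) - F a - (f a + f (a + 1)) / 2| ≤ M := by
  have hM0 : 0 ≤ M := (abs_nonneg _).trans (hM a ⟨le_rfl, by linarith⟩)
  set g : ℝ → ℝ := fun x => F x - F a - (x - a) / 2 * (f x + f a) with hg
  have hgd : ∀ x ∈ Set.Icc a (a + 1), HasDerivAt g
      (f x - (1 / 2 * (f x + f a) + (x - a) / 2 * f' x)) x := by
    intro x hx
    have h1 : HasDerivAt (fun x => (x - a) / 2) (1 / 2) x := by
      simpa using ((hasDerivAt_id x).sub_const a).div_const 2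
    exact ((hF x hx).sub_const (F a)).sub (h1.mul ((hf x hx).add_const (f a)))
  have hb : ∀ x ∈ Set.Icc a (a + 1), |f x - (1 / 2 * (f x + f a) + (x - a) / 2 * f' x)| ≤ M := by
    intro x hx
    set h : ℝ → ℝ := fun y => f y - f' x * y with hh
    have hd : ∀ y ∈ Set.Icc a x, HasDerivAt h (f' y - f' x) y := by
      intro y hy
      exact ((hf y ⟨hy.1, hy.2.trans hx.2⟩).fun_sub ((hasDerivAt_id' y).const_mul (f' x))).congr_deriv
        (by rw [mul_one])
    have hxa : x - a ≤ 1 := by linarith [hx.2]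
    have hb2 : ∀ y ∈ Set.Icc a x, |f' y - f' x| ≤ M := by
      intro y hy
      have := abs_sub_le_of_deriv_bound (g := f') (g' := f'') (a := y) (b := x) (M := M) hy.2
        (fun z hz => hf' z ⟨hy.1.trans hz.1, hz.2.trans hx.2⟩)
        (fun z hz => hM z ⟨hy.1.trans hz.1, hz.2.trans hx.2⟩)
      rw [abs_sub_comm]
      refine this.trans ?_
      have : x - y ≤ 1 := by linarith [hy.1]
      nlinarith
    have h3 := abs_sub_le_of_deriv_bound hx.1 hd hb2
    have h4 : f x - (1 / 2 * (f x + f a) + (x - a) / 2 * f' x) = (h x - h a) / 2 := by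
      simp only [hh]; ring
    rw [h4, abs_div, abs_two]
    have : M * (x - a) ≤ M := by nlinarith [hx.1]
    linarith
  have h5 := abs_sub_le_of_deriv_bound (by linarith : a ≤ a + 1) hgd hb
  have h6 : g (a + 1) - g a = F (a + 1) - F a - (f a + f (a + 1)) / 2 := by
    simp only [hg]; ring
  rw [h6] at h5
  linarith

/-- `Σ_{n ≤ y} (log n)^j / n`. -/
noncomputable def logSum (j : ℕ) (y : ℝ) : ℝ := ∑ n ∈ Finset.Icc 1 ⌊y⌋₊, Real.log n ^ j / n

lemma hasDerivAt_log_pow_div (j : ℕ) {y : ℝ} (hy : 0 < y) :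
    HasDerivAt (fun y => Real.log y ^ (j + 1) / (j + 1)) (Real.log y ^ j / y) y := by
  have h := ((Real.hasDerivAt_log hy.ne').pow (j + 1)).div_const ((j:ℝ) + 1)
  refine h.congr_deriv ?_
  rw [Nat.add_sub_cancel]
  have : (j:ℝ) + 1 ≠ 0 := by positivity
  push_cast
  field_simp

lemma exists_logSum_asymptotic_small (j : ℕ) : ∃ γ : ℝ, ∀ ε : ℝ, 0 < ε → ε ≤ 1 →
    ∃ K : ℝ, 0 < K ∧ ∀ y : ℝ, 1 ≤ y →
      |logSum j y - (Real.log y ^ (j + 1) / (j + 1) + γ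
        - (y - ⌊y⌋₊ - 1 / 2) * (Real.log y ^ j / y))| ≤ K * y ^ (-2 + ε) := by
  set F : ℝ → ℝ := fun y => Real.log y ^ (j + 1) / (j + 1) with hF
  set f : ℝ → ℝ := fun y => Real.log y ^ j / y with hf
  set P1 : Polynomial ℝ := Polynomial.derivative (Polynomial.X ^ j) - ((1:ℕ) : ℝ) • Polynomial.X ^ j
    with hP1
  set P2 : Polynomial ℝ := Polynomial.derivative P1 - ((2:ℕ) : ℝ) • P1 with hP2
  have hFd : ∀ y, 0 < y → HasDerivAt F (f y) y := fun y hy => hasDerivAt_log_pow_div j hy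
  have hfd : ∀ y, 0 < y → HasDerivAt f (P1.eval (Real.log y) / y ^ 2) y := by
    intro y hy
    have h := hasDerivAt_eval_log_div_pow (Polynomial.X ^ j) 1 hy
    simp only [Polynomial.eval_pow, Polynomial.eval_X, pow_one] at h
    exact h
  have hfd2 : ∀ y, 0 < y → HasDerivAt (fun y => P1.eval (Real.log y) / y ^ 2)
      (P2.eval (Real.log y) / y ^ 3) y := fun y hy => hasDerivAt_eval_log_div_pow P1 2 hy
  set s : ℕ → ℝ := fun n => logSum j n - F n - f n / 2 with hs
  have hLs : ∀ n : ℕ, logSum j ((n + 1 : ℕ) : ℝ) = logSum j n + f ((n + 1 : ℕ) : ℝ) := by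
    intro n
    simp only [logSum, Nat.floor_natCast, hf]
    rw [Finset.sum_Icc_succ_top (by omega)]
  have hconv : ∀ ε : ℝ, 0 < ε → ε ≤ 1 → ∃ γ K : ℝ, 0 < K ∧
      ∀ n : ℕ, 1 ≤ n → |s n - γ| ≤ K * (n:ℝ) ^ (-2 + ε) := by
    intro ε hε hε1
    obtain ⟨K, hK, hb⟩ := exists_abs_eval_log_div_pow_le P2 3 hε
    obtain ⟨γ, hγ⟩ := exists_limit_of_summable_steps s (2 - ε) K (by linarith) hK.le (by
      intro n hn
      have hn' : (1:ℝ) ≤ n := by exact_mod_cast hn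
      have ht := abs_trapezoid_le (a := (n:ℝ)) (M := K * (n:ℝ) ^ (-3 + ε))
        (fun x hx => hFd x (by linarith [hx.1])) (fun x hx => hfd x (by linarith [hx.1]))
        (fun x hx => hfd2 x (by linarith [hx.1])) (by
          intro x hx
          refine (hb x (by linarith [hx.1])).trans ?_
          refine mul_le_mul_of_nonneg_left ?_ hK.le
          push_cast
          exact Real.rpow_le_rpow_of_nonpos (by linarith) hx.1 (by linarith))
      have e1 : s (n + 1) - s n = -(F (n + 1) - F n - (f n + f (n + 1)) / 2) := by
        simp only [hs, hLs]
        push_cast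
        ring
      rw [e1, abs_neg]
      have e2 : -(2 - ε) - 1 = -3 + ε := by ring
      rw [e2]; exact ht)
    refine ⟨γ, K * 2 ^ (2 - ε), by positivity, fun n hn => ?_⟩
    have e3 : -2 + ε = -(2 - ε) := by ring
    rw [e3]; exact hγ n hn
  obtain ⟨γ, K0, hK0, hγ0⟩ := hconv 1 one_pos le_rfl
  have hlim : ∀ (ε : ℝ), ε ≤ 1 → ∀ (γb K : ℝ),
      (∀ n : ℕ, 1 ≤ n → |s n - γb| ≤ K * (n:ℝ) ^ (-2 + ε)) →
      Filter.Tendsto s Filter.atTop (nhds γb) := by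
    intro ε hε γb K h
    rw [tendsto_iff_norm_sub_tendsto_zero]
    have h1 : Filter.Tendsto (fun n : ℕ => K * (n:ℝ) ^ (-(2 - ε))) Filter.atTop (nhds (K * 0)) :=
      ((tendsto_rpow_neg_atTop (by linarith : 0 < 2 - ε)).comp
        tendsto_natCast_atTop_atTop).const_mul K
    rw [mul_zero] at h1
    refine squeeze_zero' (Filter.Eventually.of_forall fun _ => norm_nonneg _) ?_ h1
    filter_upwards [Filter.eventually_ge_atTop 1] with n hn
    have := h n hn
    have e3 : -2 + ε = -(2 - ε) := by ring
    rw [e3] at this; exact this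
  refine ⟨γ, fun ε hε hε1 => ?_⟩
  obtain ⟨γb, K1, hK1, hγ1⟩ := hconv ε hε hε1
  have hγγ : γb = γ := tendsto_nhds_unique (hlim ε hε1 γb K1 hγ1) (hlim 1 le_rfl γ K0 hγ0)
  subst hγγ
  obtain ⟨K2, hK2, hb2⟩ := exists_abs_eval_log_div_pow_le P1 2 hε
  refine ⟨(K1 + K2) * 2 ^ (2 - ε), by positivity, fun y hy => ?_⟩
  set n := ⌊y⌋₊ with hn
  have hn1 : 1 ≤ n := Nat.le_floor (by exact_mod_cast hy)
  have hn1' : (1:ℝ) ≤ n := by exact_mod_cast hn1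
  have hny : (n:ℝ) ≤ y := Nat.floor_le (by linarith)
  have hyn : y < n + 1 := Nat.lt_floor_add_one y
  have hd : ∀ x ∈ Set.Icc (n:ℝ) y, HasDerivAt
      (fun x => -F x + (x - n - 1 / 2) * f x)
      ((x - n - 1 / 2) * (P1.eval (Real.log x) / x ^ 2)) x := by
    intro x hx
    have hx0 : 0 < x := by linarith [hx.1]
    have h1 : HasDerivAt (fun x : ℝ => x - n - 1 / 2) 1 x :=
      ((hasDerivAt_id' x).sub_const _).sub_const _
    refine ((hFd x hx0).fun_neg.fun_add (h1.fun_mul (hfd x hx0))).congr_deriv ?_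
    ring
  have hdb := abs_sub_le_of_deriv_bound hny hd (M := K2 * (n:ℝ) ^ (-2 + ε)) (by
    intro x hx
    rw [abs_mul]
    have h1 : |x - n - 1 / 2| ≤ 1 := by
      rw [abs_le]; constructor <;> linarith [hx.1, hx.2]
    have h2 := hb2 x (by linarith [hx.1])
    have h3 : x ^ (-((2:ℕ):ℝ) + ε) ≤ (n:ℝ) ^ (-2 + ε) := by
      push_cast
      exact Real.rpow_le_rpow_of_nonpos (by linarith) hx.1 (by linarith)
    have h4 : |P1.eval (Real.log x) / x ^ 2| ≤ K2 * (n:ℝ) ^ (-2 + ε) :=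
      h2.trans (mul_le_mul_of_nonneg_left h3 hK2.le)
    calc _ ≤ 1 * (K2 * (n:ℝ) ^ (-2 + ε)) := mul_le_mul h1 h4 (abs_nonneg _) zero_le_one
      _ = _ := one_mul _)
  have hyn' : (n:ℝ) ^ (-2 + ε) ≤ 2 ^ (2 - ε) * y ^ (-2 + ε) := by
    have e : (y / 2) ^ (-2 + ε) = 2 ^ (2 - ε) * y ^ (-2 + ε) := by
      rw [Real.div_rpow (by linarith) (by norm_num)]
      have : -2 + ε = -(2 - ε) := by ring
      rw [this, Real.rpow_neg (by norm_num : (0:ℝ) ≤ 2)]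
      field_simp
    rw [← e]
    exact Real.rpow_le_rpow_of_nonpos (by linarith) (by linarith) (by linarith)
  have hsn := hγ1 n hn1
  have hBy : logSum j y = logSum j n := by
    simp only [logSum, Nat.floor_natCast]
    rfl
  have hfin : logSum j y - (F y + γb - (y - n - 1 / 2) * f y)
      = (s n - γb) + ((-F y + (y - n - 1 / 2) * f y) - (-F n + (n - n - 1 / 2) * f n)) := by
    simp only [hs, hBy]; ring
  rw [hfin]
  have hp : 0 ≤ (n:ℝ) ^ (-2 + ε) := by positivity
  calc _ ≤ K1 * (n:ℝ) ^ (-2 + ε) + K2 * (n:ℝ) ^ (-2 + ε) * (y - n) :=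
        (abs_add_le _ _).trans (add_le_add hsn hdb)
    _ ≤ (K1 + K2) * (n:ℝ) ^ (-2 + ε) := by
        have : K2 * (n:ℝ) ^ (-2 + ε) * (y - n) ≤ K2 * (n:ℝ) ^ (-2 + ε) * 1 :=
          mul_le_mul_of_nonneg_left (by linarith) (by positivity)
        linarith
    _ ≤ _ := by
        rw [mul_assoc]
        exact mul_le_mul_of_nonneg_left hyn' (by positivity)

/-- Partial sums of `(log n)^j / n` with the first Euler–Maclaurin correction. -/
lemma exists_logSum_asymptotic (j : ℕ) : ∃ γ : ℝ, ∀ ε : ℝ, 0 < ε →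
    ∃ K : ℝ, 0 < K ∧ ∀ y : ℝ, 1 ≤ y →
      |logSum j y - (Real.log y ^ (j + 1) / (j + 1) + γ
        - (y - ⌊y⌋₊ - 1 / 2) * (Real.log y ^ j / y))| ≤ K * y ^ (-2 + ε) := by
  obtain ⟨γ, h⟩ := exists_logSum_asymptotic_small j
  refine ⟨γ, fun ε hε => ?_⟩
  obtain ⟨K, hK, h⟩ := h (min ε 1) (by positivity) (min_le_right _ _)
  refine ⟨K, hK, fun y hy => (h y hy).trans ?_⟩
  refine mul_le_mul_of_nonneg_left ?_ hK.le
  exact Real.rpow_le_rpow_of_exponent_le hy (by linarith [min_le_left ε 1])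

/-- `F(n) = O(n^{p+ε})` for every `ε > 0`. -/
def EpsBound (p : ℝ) (F : ℕ → ℝ) : Prop :=
  ∀ ε : ℝ, 0 < ε → ∃ K : ℝ, 0 < K ∧ ∀ n : ℕ, 1 ≤ n → |F n| ≤ K * (n : ℝ) ^ (p + ε)

namespace EpsBound

variable {p q : ℝ} {F G : ℕ → ℝ}

lemma of_le (h : EpsBound p F) (hG : ∀ n, 1 ≤ n → |G n| ≤ |F n|) : EpsBound p G := by
  intro ε hε
  obtain ⟨K, hK, h⟩ := h ε hε
  exact ⟨K, hK, fun n hn => (hG n hn).trans (h n hn)⟩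

lemma congr (h : EpsBound p F) (hG : ∀ n, 1 ≤ n → G n = F n) : EpsBound p G :=
  h.of_le fun n hn => by rw [hG n hn]

lemma add (hF : EpsBound p F) (hG : EpsBound p G) : EpsBound p (fun n => F n + G n) := by
  intro ε hε
  obtain ⟨K, hK, h⟩ := hF ε hε
  obtain ⟨K', hK', h'⟩ := hG ε hε
  refine ⟨K + K', by positivity, fun n hn => (abs_add_le _ _).trans ?_⟩
  rw [add_mul]
  exact add_le_add (h n hn) (h' n hn)

lemma neg (hF : EpsBound p F) : EpsBound p (fun n => - F n) :=
  hF.of_le fun n _ => by rw [abs_neg]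

lemma sub (hF : EpsBound p F) (hG : EpsBound p G) : EpsBound p (fun n => F n - G n) :=
  (hF.add hG.neg).congr fun _ _ => sub_eq_add_neg _ _

lemma mul (hF : EpsBound p F) (hG : EpsBound q G) : EpsBound (p + q) (fun n => F n * G n) := by
  intro ε hε
  obtain ⟨K, hK, h⟩ := hF (ε / 2) (by positivity)
  obtain ⟨K', hK', h'⟩ := hG (ε / 2) (by positivity)
  refine ⟨K * K', by positivity, fun n hn => ?_⟩
  have hn0 : (0:ℝ) < n := by exact_mod_cast hn
  rw [abs_mul, show p + q + ε = (p + ε / 2) + (q + ε / 2) by ring, Real.rpow_add hn0]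
  calc _ ≤ (K * (n:ℝ) ^ (p + ε / 2)) * (K' * (n:ℝ) ^ (q + ε / 2)) :=
        mul_le_mul (h n hn) (h' n hn) (abs_nonneg _) (by positivity)
    _ = _ := by ring

lemma mono (hF : EpsBound p F) (hpq : p ≤ q) : EpsBound q F := by
  intro ε hε
  obtain ⟨K, hK, h⟩ := hF ε hε
  refine ⟨K, hK, fun n hn => (h n hn).trans (mul_le_mul_of_nonneg_left ?_ hK.le)⟩
  exact Real.rpow_le_rpow_of_exponent_le (by exact_mod_cast hn) (by linarith)

lemma zero : EpsBound p (fun _ => 0) := fun ε _ => ⟨1, one_pos, fun n _ => by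
  simp only [abs_zero]; positivity⟩

lemma sum {ι : Type*} (s : Finset ι) (F : ι → ℕ → ℝ) (h : ∀ i ∈ s, EpsBound p (F i)) :
    EpsBound p (fun n => ∑ i ∈ s, F i n) := by
  classical
  induction s using Finset.induction_on with
  | empty => simpa using zero
  | insert a s ha ih =>
    simp only [Finset.sum_insert ha]
    exact (h a (Finset.mem_insert_self _ _)).add
      (ih fun i hi => h i (Finset.mem_insert_of_mem hi))

lemma rpow (p : ℝ) : EpsBound p (fun n => (n : ℝ) ^ p) := fun ε hε => ⟨1, one_pos, fun n hn => by
  rw [one_mul, abs_of_nonneg (by positivity)]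
  exact Real.rpow_le_rpow_of_exponent_le (by exact_mod_cast hn) (by linarith)⟩

lemma polyLog (P : Polynomial ℝ) : EpsBound 0 (fun n => P.eval (Real.log n)) := by
  intro ε hε
  obtain ⟨K, hK, h⟩ := exists_abs_eval_log_le P hε
  refine ⟨K, hK, fun n hn => ?_⟩
  rw [zero_add]
  exact h n (by exact_mod_cast hn)

lemma logPow (k : ℕ) : EpsBound 0 (fun n => Real.log n ^ k) :=
  (polyLog (Polynomial.X ^ k)).congr fun n _ => by simp

lemma of_bounded (c : ℝ) (h : ∀ n, 1 ≤ n → |F n| ≤ c) : EpsBound 0 F := by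
  intro ε hε
  refine ⟨|c| + 1, by positivity, fun n hn => (h n hn).trans ?_⟩
  rw [zero_add]
  have h1 : (1:ℝ) ≤ (n:ℝ) ^ ε := Real.one_le_rpow (by exact_mod_cast hn) hε.le
  nlinarith [le_abs_self c, abs_nonneg c]

lemma const_mul (c : ℝ) (h : EpsBound p F) : EpsBound p (fun n => c * F n) := by
  have := (of_bounded (F := fun _ => c) |c| fun _ _ => le_rfl).mul h
  rwa [zero_add] at this

lemma polyLog_mul (P : Polynomial ℝ) (h : EpsBound p F) :
    EpsBound p (fun n => P.eval (Real.log n) * F n) := by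
  have := (polyLog P).mul h
  rwa [zero_add] at this

end EpsBound

/-- The sawtooth function at `√n`. -/
noncomputable def sqrtSaw (n : ℕ) : ℝ := Real.sqrt n - Nat.sqrt n - 1 / 2

/-- The main term of `logSum j y`, as a polynomial in `log y`. -/
noncomputable def logSumMain (j : ℕ) (γ : ℝ) : Polynomial ℝ :=
  Polynomial.C (1 / ((j : ℝ) + 1)) * Polynomial.X ^ (j + 1) + Polynomial.C γ

lemma logSumMain_eval (j : ℕ) (γ u : ℝ) :
    (logSumMain j γ).eval u = u ^ (j + 1) / (j + 1) + γ := by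
  simp [logSumMain]; ring

lemma log_sqrt_natCast (n : ℕ) : Real.log (Real.sqrt n) = Real.log n / 2 :=
  Real.log_sqrt (Nat.cast_nonneg n)

lemma EpsBound.sqrtSaw : EpsBound 0 sqrtSaw := by
  refine EpsBound.of_bounded 1 fun n hn => ?_
  have h1 : (Nat.sqrt n : ℝ) ≤ Real.sqrt n := Real.nat_sqrt_le_real_sqrt
  have h2 : Real.sqrt n ≤ Nat.sqrt n + 1 := Real.real_sqrt_le_nat_sqrt_succ
  rw [_root_.sqrtSaw, abs_le]
  constructor <;> linarith

lemma EpsBound.logPow_div_sqrt (j : ℕ) :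
    EpsBound (-(1 / 2)) (fun n => (Real.log n / 2) ^ j / Real.sqrt n) := by
  have h := (EpsBound.polyLog ((Polynomial.C (1 / 2) * Polynomial.X) ^ j)).mul
    (EpsBound.rpow (-(1 / 2)))
  rw [zero_add] at h
  refine h.congr fun n hn => ?_
  rw [Real.rpow_neg (Nat.cast_nonneg n), ← Real.sqrt_eq_rpow]
  simp only [Polynomial.eval_pow, Polynomial.eval_mul, Polynomial.eval_C, Polynomial.eval_X]
  ring

lemma logSum_sqrt_asymptotic (j : ℕ) (γ : ℝ) (h : ∀ ε : ℝ, 0 < ε →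
    ∃ K : ℝ, 0 < K ∧ ∀ y : ℝ, 1 ≤ y →
      |logSum j y - (Real.log y ^ (j + 1) / (j + 1) + γ
        - (y - ⌊y⌋₊ - 1 / 2) * (Real.log y ^ j / y))| ≤ K * y ^ (-2 + ε)) :
    EpsBound (-1) (fun n => logSum j (Real.sqrt n) - ((logSumMain j γ).eval (Real.log n / 2)
      - sqrtSaw n * ((Real.log n / 2) ^ j / Real.sqrt n))) := by
  intro ε hε
  obtain ⟨K, hK, h⟩ := h (2 * ε) (by positivity)
  refine ⟨K, hK, fun n hn => ?_⟩
  have hn' : (1:ℝ) ≤ n := by exact_mod_cast hn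
  have := h (Real.sqrt n) (Real.one_le_sqrt.2 hn')
  rw [Real.nat_floor_real_sqrt_eq_nat_sqrt, log_sqrt_natCast] at this
  beta_reduce
  rw [logSumMain_eval]
  refine this.trans (le_of_eq ?_)
  rw [Real.sqrt_eq_rpow, ← Real.rpow_mul (by linarith)]
  ring_nf

lemma logSum_sqrt (j n : ℕ) :
    logSum j (Real.sqrt n) = ∑ m ∈ Finset.Icc 1 (Nat.sqrt n), Real.log m ^ j / m := by
  rw [logSum, Real.nat_floor_real_sqrt_eq_nat_sqrt]

lemma exists_sum_mul_log_div_pow (k : ℕ) : ∀ i : ℕ, ∃ P : Polynomial ℝ, EpsBound (-1) (fun n =>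
    (∑ m ∈ Finset.Icc 1 (Nat.sqrt n), Real.log m ^ i / m * (Real.log n - Real.log m) ^ k)
      - (P.eval (Real.log n)
        - sqrtSaw n * ((Real.log n / 2) ^ i / Real.sqrt n) * (Real.log n / 2) ^ k)) := by
  induction k with
  | zero =>
    intro i
    obtain ⟨γ, h⟩ := exists_logSum_asymptotic i
    refine ⟨(logSumMain i γ).comp (Polynomial.C (1 / 2) * Polynomial.X),
      (logSum_sqrt_asymptotic i γ h).congr fun n _ => ?_⟩
    rw [logSum_sqrt]
    simp only [pow_zero, mul_one, Polynomial.eval_comp, Polynomial.eval_mul, Polynomial.eval_C,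
      Polynomial.eval_X]
    ring_nf
  | succ k ih =>
    intro i
    obtain ⟨P, hP⟩ := ih i
    obtain ⟨P', hP'⟩ := ih (i + 1)
    refine ⟨Polynomial.X * P - P', ((hP.polyLog_mul Polynomial.X).sub hP').congr fun n _ => ?_⟩
    have e : ∑ m ∈ Finset.Icc 1 (Nat.sqrt n),
          Real.log m ^ i / m * (Real.log n - Real.log m) ^ (k + 1)
        = Real.log n * ∑ m ∈ Finset.Icc 1 (Nat.sqrt n),
            Real.log m ^ i / m * (Real.log n - Real.log m) ^ k
          - ∑ m ∈ Finset.Icc 1 (Nat.sqrt n),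
            Real.log m ^ (i + 1) / m * (Real.log n - Real.log m) ^ k := by
      rw [Finset.mul_sum, ← Finset.sum_sub_distrib]
      exact Finset.sum_congr rfl fun m _ => by ring
    rw [e]
    simp only [Polynomial.eval_sub, Polynomial.eval_mul, Polynomial.eval_X]
    ring

lemma exists_sum_mul_eval_log_div (i : ℕ) (e : Polynomial ℝ) :
    ∃ P : Polynomial ℝ, EpsBound (-1) (fun n =>
    (∑ m ∈ Finset.Icc 1 (Nat.sqrt n), Real.log m ^ i / m * e.eval (Real.log n - Real.log m))
      - (P.eval (Real.log n)
        - sqrtSaw n * ((Real.log n / 2) ^ i / Real.sqrt n) * e.eval (Real.log n / 2))) := by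
  induction e using Polynomial.induction_on' with
  | add p q hp hq =>
    obtain ⟨P, hP⟩ := hp
    obtain ⟨P', hP'⟩ := hq
    refine ⟨P + P', (hP.add hP').congr fun n _ => ?_⟩
    simp only [Polynomial.eval_add, mul_add, Finset.sum_add_distrib]
    ring
  | monomial k a =>
    obtain ⟨P, hP⟩ := exists_sum_mul_log_div_pow k i
    refine ⟨Polynomial.C a * P, (hP.const_mul a).congr fun n _ => ?_⟩
    simp only [Polynomial.eval_monomial, Polynomial.eval_mul, Polynomial.eval_C, mul_sub,
      Finset.mul_sum]
    congr 1
    · exact Finset.sum_congr rfl fun m _ => by ring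
    · ring

lemma log_natCast_div (n m : ℕ) (hn : 1 ≤ n) (hm : 1 ≤ m) :
    Real.log ((n : ℝ) / m) = Real.log n - Real.log m :=
  Real.log_div (by positivity) (by positivity)

lemma div_sub_floor_div (n m : ℕ) (hm : 1 ≤ m) :
    (n : ℝ) / m - ((n / m : ℕ) : ℝ) - 1 / 2 = saw m n := by
  have h : ((m * (n / m) + n % m : ℕ) : ℝ) = n := by rw [Nat.div_add_mod]
  push_cast at h
  have hm' : (m:ℝ) ≠ 0 := by positivity
  rw [saw, ← h]
  field_simp
  ring

lemma exists_sum_mul_logSum_div (i j : ℕ) (γ : ℝ) (h : ∀ ε : ℝ, 0 < ε →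
    ∃ K : ℝ, 0 < K ∧ ∀ y : ℝ, 1 ≤ y →
      |logSum j y - (Real.log y ^ (j + 1) / (j + 1) + γ
        - (y - ⌊y⌋₊ - 1 / 2) * (Real.log y ^ j / y))| ≤ K * y ^ (-2 + ε)) :
    ∃ P : Polynomial ℝ, EpsBound (-1) (fun n =>
    (∑ m ∈ Finset.Icc 1 (Nat.sqrt n), Real.log m ^ i / m * logSum j ((n : ℝ) / m))
      - (P.eval (Real.log n)
        - sqrtSaw n * ((Real.log n / 2) ^ i / Real.sqrt n)
            * (logSumMain j γ).eval (Real.log n / 2)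
        - (∑ m ∈ Finset.Icc 1 (Nat.sqrt n),
            Real.log m ^ i * (Real.log n - Real.log m) ^ j * saw m n) / n)) := by
  obtain ⟨P, hP⟩ := exists_sum_mul_eval_log_div i (logSumMain j γ)
  refine ⟨P, ?_⟩
  have herr : EpsBound (-1) (fun n => ∑ m ∈ Finset.Icc 1 (Nat.sqrt n), Real.log m ^ i / m *
      (logSum j ((n : ℝ) / m) - ((logSumMain j γ).eval (Real.log n - Real.log m)
        - saw m n * ((Real.log n - Real.log m) ^ j * m / n)))) := by
    intro ε hε
    obtain ⟨K, hK, h⟩ := h ε hε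
    obtain ⟨K', hK', h'⟩ := exists_log_pow_le i hε
    refine ⟨K' * K, by positivity, fun n hn => ?_⟩
    have hn0 : (0:ℝ) < n := by exact_mod_cast hn
    refine (Finset.abs_sum_le_sum_abs _ _).trans ?_
    have hterm : ∀ m ∈ Finset.Icc 1 (Nat.sqrt n), |Real.log m ^ i / m *
      (logSum j ((n : ℝ) / m) - ((logSumMain j γ).eval (Real.log n - Real.log m)
        - saw m n * ((Real.log n - Real.log m) ^ j * m / n)))| ≤
          K' * K * Real.sqrt n * (n:ℝ) ^ (-2 + ε) := by
      intro m hm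
      obtain ⟨hm1, hm2⟩ := Finset.mem_Icc.1 hm
      have hm0 : (0:ℝ) < m := by exact_mod_cast hm1
      have hmn : (m:ℝ) ≤ n := by exact_mod_cast hm2.trans (Nat.sqrt_le_self n)
      have hms : (m:ℝ) ≤ Real.sqrt n :=
        le_trans (by exact_mod_cast hm2) Real.nat_sqrt_le_real_sqrt
      have h1 := h ((n:ℝ) / m) ((one_le_div hm0).2 hmn)
      rw [Nat.floor_div_natCast, Nat.floor_natCast, div_sub_floor_div n m hm1,
        log_natCast_div n m hn hm1] at h1
      have h2 : |Real.log m ^ i / m| ≤ K' * (m:ℝ) ^ ε / m := by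
        rw [abs_div, abs_of_pos hm0]
        exact div_le_div_of_nonneg_right (by
          have := h' m (by exact_mod_cast hm1)
          rwa [abs_of_nonneg (pow_nonneg (Real.log_nonneg (by exact_mod_cast hm1)) _)])  hm0.le
      have h3 : (logSumMain j γ).eval (Real.log n - Real.log m)
        - saw m n * ((Real.log n - Real.log m) ^ j * m / n) =
          (Real.log n - Real.log m) ^ (j + 1) / (j + 1) + γ -
          saw m n * ((Real.log n - Real.log m) ^ j / (n / m)) := by
        rw [logSumMain_eval]; field_simp
      rw [h3, abs_mul]
      have e1 : ((n:ℝ) / m) ^ (-2 + ε) = n ^ (-2 + ε) * (m * m / m ^ ε) := by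
        rw [Real.div_rpow hn0.le hm0.le, div_eq_mul_inv, ← Real.rpow_neg hm0.le,
          show -(-2 + ε) = 2 - ε by ring, Real.rpow_sub hm0]
        norm_num [sq]
      rw [e1] at h1
      have hme : (0:ℝ) < (m:ℝ) ^ ε := by positivity
      calc _ ≤ (K' * (m:ℝ) ^ ε / m) * (K * (n ^ (-2 + ε) * (m * m / m ^ ε))) :=
            mul_le_mul h2 h1 (abs_nonneg _) (by positivity)
        _ = K' * K * m * (n:ℝ) ^ (-2 + ε) := by field_simp
        _ ≤ _ := by gcongr
    refine (Finset.sum_le_card_nsmul _ _ _ hterm).trans ?_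
    rw [Nat.card_Icc, nsmul_eq_mul, Nat.add_sub_cancel]
    have e2 : (n:ℝ) ^ (-1 + ε) = (Real.sqrt n * Real.sqrt n) * (n:ℝ) ^ (-2 + ε) := by
      rw [Real.mul_self_sqrt hn0.le]
      nth_rewrite 2 [← Real.rpow_one (n:ℝ)]
      rw [← Real.rpow_add hn0]
      ring_nf
    rw [e2]
    calc _ ≤ Real.sqrt n * (K' * K * Real.sqrt n * (n:ℝ) ^ (-2 + ε)) :=
          mul_le_mul_of_nonneg_right Real.nat_sqrt_le_real_sqrt (by positivity)
      _ = _ := by ring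
  refine (hP.add herr).congr fun n hn => ?_
  have e : ∑ m ∈ Finset.Icc 1 (Nat.sqrt n), Real.log m ^ i / m *
      (logSum j ((n : ℝ) / m) - ((logSumMain j γ).eval (Real.log n - Real.log m)
        - saw m n * ((Real.log n - Real.log m) ^ j * m / n)))
      = (∑ m ∈ Finset.Icc 1 (Nat.sqrt n), Real.log m ^ i / m * logSum j ((n : ℝ) / m))
        - (∑ m ∈ Finset.Icc 1 (Nat.sqrt n), Real.log m ^ i / m *
          (logSumMain j γ).eval (Real.log n - Real.log m))
        + (∑ m ∈ Finset.Icc 1 (Nat.sqrt n),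
            Real.log m ^ i * (Real.log n - Real.log m) ^ j * saw m n) / n := by
    rw [Finset.sum_div, ← Finset.sum_sub_distrib, ← Finset.sum_add_distrib]
    refine Finset.sum_congr rfl fun m hm => ?_
    have hm0 : (m:ℝ) ≠ 0 := by have := (Finset.mem_Icc.1 hm).1; positivity
    field_simp
    ring
  rw [e]
  ring

lemma sum_Icc_sum_divisorsAntidiagonal {M : Type*} [AddCommMonoid M] (G : ℕ → ℕ → M) (N : ℕ) :
    ∑ n ∈ Finset.Icc 1 N, ∑ x ∈ n.divisorsAntidiagonal, G x.1 x.2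
      = ∑ a ∈ Finset.Icc 1 N, ∑ b ∈ Finset.Icc 1 N, if a * b ≤ N then G a b else 0 := by
  have e : Finset.Icc 1 N = Finset.Ioc 0 N := by ext; simp; omega
  rw [← Finset.sum_product']
  trans ∑ n ∈ Finset.Icc 1 N,
    ∑ x ∈ Finset.Icc 1 N ×ˢ Finset.Icc 1 N with x.1 * x.2 = n, G x.1 x.2
  · refine Finset.sum_congr rfl fun n hn => ?_
    rw [Finset.mem_Icc] at hn
    rw [Nat.divisorsAntidiagonal_eq_prod_filter_of_le (by omega) hn.2, e]
  · simp_rw [Finset.sum_filter]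
    rw [Finset.sum_comm]
    refine Finset.sum_congr rfl fun x hx => ?_
    simp only [Finset.mem_product, Finset.mem_Icc] at hx
    rw [Finset.sum_ite_eq]
    have : 1 ≤ x.1 * x.2 := Nat.mul_pos hx.1.1 hx.2.1
    simp [Finset.mem_Icc, this]

lemma sum_Icc_ite_mul_le {M : Type*} [AddCommMonoid M] (g : ℕ → M) (N a : ℕ) (ha : 1 ≤ a) :
    (∑ b ∈ Finset.Icc 1 N, if a * b ≤ N then g b else 0) = ∑ b ∈ Finset.Icc 1 (N / a), g b := by
  rw [← Finset.sum_filter]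
  congr 1
  ext b
  simp only [Finset.mem_filter, Finset.mem_Icc, Nat.le_div_iff_mul_le ha, mul_comm a b]
  constructor
  · rintro ⟨⟨h1, h2⟩, h3⟩; exact ⟨h1, h3⟩
  · rintro ⟨h1, h3⟩; exact ⟨⟨h1, le_trans (Nat.le_mul_of_pos_right b ha) h3⟩, h3⟩

lemma sum_Icc_sum_divisorsAntidiagonal' {M : Type*} [AddCommMonoid M] (G : ℕ → ℕ → M) (N : ℕ) :
    ∑ n ∈ Finset.Icc 1 N, ∑ x ∈ n.divisorsAntidiagonal, G x.1 x.2
      = ∑ a ∈ Finset.Icc 1 N, ∑ b ∈ Finset.Icc 1 (N / a), G a b := by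
  rw [sum_Icc_sum_divisorsAntidiagonal]
  exact Finset.sum_congr rfl fun a ha => sum_Icc_ite_mul_le _ _ _ (Finset.mem_Icc.1 ha).1

/-- Dirichlet's hyperbola method, symmetric cut. -/
lemma sum_divisorsAntidiagonal_hyperbola (G : ℕ → ℕ → ℝ) (N : ℕ) :
    ∑ n ∈ Finset.Icc 1 N, ∑ x ∈ n.divisorsAntidiagonal, G x.1 x.2
      = (∑ a ∈ Finset.Icc 1 (Nat.sqrt N), ∑ b ∈ Finset.Icc 1 (N / a), G a b)
        + (∑ b ∈ Finset.Icc 1 (Nat.sqrt N), ∑ a ∈ Finset.Icc 1 (N / b), G a b)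
        - ∑ a ∈ Finset.Icc 1 (Nat.sqrt N), ∑ b ∈ Finset.Icc 1 (Nat.sqrt N), G a b := by
  set r := Nat.sqrt N with hr
  have hrN : r ≤ N := Nat.sqrt_le_self N
  have hcut : ∀ g : ℕ → ℝ, ∑ a ∈ Finset.Icc 1 r, g a
      = ∑ a ∈ Finset.Icc 1 N, if a ≤ r then g a else 0 := by
    intro g
    rw [← Finset.sum_filter]
    congr 1
    ext a
    simp only [Finset.mem_filter, Finset.mem_Icc]
    omega
  rw [sum_Icc_sum_divisorsAntidiagonal]
  have h1 : ∑ a ∈ Finset.Icc 1 r, ∑ b ∈ Finset.Icc 1 (N / a), G a b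
      = ∑ a ∈ Finset.Icc 1 N, ∑ b ∈ Finset.Icc 1 N,
        if a ≤ r then (if a * b ≤ N then G a b else 0) else 0 := by
    rw [Finset.sum_congr rfl fun a ha =>
      (sum_Icc_ite_mul_le (G a) N a (Finset.mem_Icc.1 ha).1).symm, hcut]
    refine Finset.sum_congr rfl fun a _ => ?_
    split_ifs <;> simp
  have h2 : ∑ b ∈ Finset.Icc 1 r, ∑ a ∈ Finset.Icc 1 (N / b), G a b
      = ∑ a ∈ Finset.Icc 1 N, ∑ b ∈ Finset.Icc 1 N,
        if b ≤ r then (if a * b ≤ N then G a b else 0) else 0 := by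
    rw [Finset.sum_congr rfl fun b hb =>
      (sum_Icc_ite_mul_le (fun a => G a b) N b (Finset.mem_Icc.1 hb).1).symm, hcut,
      Finset.sum_comm (s := Finset.Icc 1 N)]
    refine Finset.sum_congr rfl fun b _ => ?_
    split_ifs <;> simp [mul_comm]
  have h3 : ∑ a ∈ Finset.Icc 1 r, ∑ b ∈ Finset.Icc 1 r, G a b
      = ∑ a ∈ Finset.Icc 1 N, ∑ b ∈ Finset.Icc 1 N,
        if a ≤ r then (if b ≤ r then G a b else 0) else 0 := by
    rw [hcut]
    refine Finset.sum_congr rfl fun a _ => ?_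
    rw [hcut]
    split_ifs <;> simp
  rw [h1, h2, h3, ← Finset.sum_add_distrib, ← Finset.sum_sub_distrib]
  refine Finset.sum_congr rfl fun a _ => ?_
  rw [← Finset.sum_add_distrib, ← Finset.sum_sub_distrib]
  refine Finset.sum_congr rfl fun b _ => ?_
  by_cases ha : a ≤ r <;> by_cases hb : b ≤ r
  · have : a * b ≤ N := (Nat.mul_le_mul ha hb).trans (Nat.sqrt_le N)
    simp [ha, hb, this]
  · simp [ha, hb]
  · simp [ha, hb]
  · have : ¬ a * b ≤ N := by
      have h4 : N < (r + 1) * (r + 1) := Nat.lt_succ_sqrt N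
      have : (r + 1) * (r + 1) ≤ a * b := Nat.mul_le_mul (by omega) (by omega)
      omega
    simp [ha, hb, this]

/-- The summatory function of `dGen i j l / l`. -/
noncomputable def genSum (i j n : ℕ) : ℝ := ∑ l ∈ Finset.Icc 1 n, dGen i j l / l

lemma logSum_div_natCast (j n m : ℕ) :
    logSum j ((n : ℝ) / m) = ∑ b ∈ Finset.Icc 1 (n / m), Real.log b ^ j / b := by
  rw [logSum, Nat.floor_div_natCast, Nat.floor_natCast]

lemma dGen_div (i j l : ℕ) : dGen i j l / l
    = ∑ x ∈ l.divisorsAntidiagonal, Real.log x.1 ^ i / x.1 * (Real.log x.2 ^ j / x.2) := by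
  rw [dGen, Finset.sum_div]
  refine Finset.sum_congr rfl fun x hx => ?_
  have : ((x.1 * x.2 : ℕ) : ℝ) = l := by rw [(Nat.mem_divisorsAntidiagonal.1 hx).1]
  rw [← this]
  push_cast
  rw [div_mul_div_comm]

lemma genSum_eq_hyperbola (i j n : ℕ) : genSum i j n
    = (∑ m ∈ Finset.Icc 1 (Nat.sqrt n), Real.log m ^ i / m * logSum j ((n : ℝ) / m))
      + (∑ m ∈ Finset.Icc 1 (Nat.sqrt n), Real.log m ^ j / m * logSum i ((n : ℝ) / m))
      - logSum i (Real.sqrt n) * logSum j (Real.sqrt n) := by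
  simp only [genSum, dGen_div]
  rw [sum_divisorsAntidiagonal_hyperbola
    (fun a b => Real.log a ^ i / a * (Real.log b ^ j / b)), logSum_sqrt, logSum_sqrt,
    Finset.sum_mul_sum]
  simp only [logSum_div_natCast, Finset.mul_sum]
  congr 2
  exact Finset.sum_congr rfl fun b _ => Finset.sum_congr rfl fun a _ => mul_comm _ _

/-- The oscillating part in the hyperbola formula for `genSum`. -/
noncomputable def genTheta (i j n : ℕ) : ℝ :=
  ∑ m ∈ Finset.Icc 1 (Nat.sqrt n), Real.log m ^ i * (Real.log n - Real.log m) ^ j * saw m n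

/-- Asymptotics of `genSum` at integers, keeping the sawtooth terms. -/
lemma exists_genSum_asymptotic (i j : ℕ) : ∃ P : Polynomial ℝ, EpsBound (-1) (fun n =>
    genSum i j n - (P.eval (Real.log n) - (genTheta i j n + genTheta j i n) / n)) := by
  obtain ⟨γi, hi⟩ := exists_logSum_asymptotic i
  obtain ⟨γj, hj⟩ := exists_logSum_asymptotic j
  obtain ⟨P, hP⟩ := exists_sum_mul_logSum_div i j γj hj
  obtain ⟨P', hP'⟩ := exists_sum_mul_logSum_div j i γi hi
  have hEi := logSum_sqrt_asymptotic i γi hi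
  have hEj := logSum_sqrt_asymptotic j γj hj
  set Ei := (logSumMain i γi).comp (Polynomial.C (1 / 2) * Polynomial.X) with hEid
  set Ej := (logSumMain j γj).comp (Polynomial.C (1 / 2) * Polynomial.X) with hEjd
  have ei : ∀ u : ℝ, (logSumMain i γi).eval (u / 2) = Ei.eval u := fun u => by
    simp [hEid, Polynomial.eval_comp]; ring_nf
  have ej : ∀ u : ℝ, (logSumMain j γj).eval (u / 2) = Ej.eval u := fun u => by
    simp [hEjd, Polynomial.eval_comp]; ring_nf
  simp only [ei, ej] at hP hP' hEi hEj
  set si : ℕ → ℝ := fun n => sqrtSaw n * ((Real.log n / 2) ^ i / Real.sqrt n) with hsi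
  set sj : ℕ → ℝ := fun n => sqrtSaw n * ((Real.log n / 2) ^ j / Real.sqrt n) with hsj
  have bsi : EpsBound (-(1 / 2)) si := by
    have := EpsBound.sqrtSaw.mul (EpsBound.logPow_div_sqrt i)
    rwa [zero_add] at this
  have bsj : EpsBound (-(1 / 2)) sj := by
    have := EpsBound.sqrtSaw.mul (EpsBound.logPow_div_sqrt j)
    rwa [zero_add] at this
  have h1 : EpsBound (-1) (fun n => si n * sj n) := by
    have := bsi.mul bsj
    norm_num at this
    exact this
  set ri : ℕ → ℝ := fun n => logSum i (Real.sqrt n) - (Ei.eval (Real.log n) - si n) with hri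
  set rj : ℕ → ℝ := fun n => logSum j (Real.sqrt n) - (Ej.eval (Real.log n) - sj n) with hrj
  have h2 : EpsBound (-1) (fun n => si n * rj n) := (bsi.mul hEj).mono (by norm_num)
  have h3 : EpsBound (-1) (fun n => sj n * ri n) := (bsj.mul hEi).mono (by norm_num)
  have h4 : EpsBound (-1) (fun n => ri n * rj n) := (hEi.mul hEj).mono (by norm_num)
  refine ⟨P + P' - Ei * Ej, ((((((hP.add hP').sub h1).sub h4).add h2).add h3).sub
    ((hEj.polyLog_mul Ei).add (hEi.polyLog_mul Ej))).congr fun n hn => ?_⟩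
  rw [genSum_eq_hyperbola]
  simp only [genTheta, hri, hrj, hsi, hsj, Polynomial.eval_add, Polynomial.eval_sub,
    Polynomial.eval_mul]
  ring

/-- `F` has small mean-square variation over multiplicatively short intervals `[n', n]` with
`n / n' ≈ 1 + δ`. -/
def ShortVar (F : ℕ → ℝ) : Prop :=
  ∀ ε : ℝ, 0 < ε → ∃ K : ℝ, 0 < K ∧ ∀ δ : ℝ, 0 < δ → δ ≤ 1 → ∃ Ψ : ℕ → ℝ, (∀ n, 0 ≤ Ψ n) ∧
    (∀ X : ℕ, ∑ n ∈ Finset.range X, Ψ n ≤ K * δ ^ (1 - ε)) ∧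
    ∀ n n' : ℕ, n' ≤ n → n ≤ 4 * n' → 16 ≤ δ * n → n ≤ n' + 2 * δ * n →
      (F n - F n') ^ 2 ≤ Ψ n + Ψ n'

namespace ShortVar

variable {F G : ℕ → ℝ}

lemma add (hF : ShortVar F) (hG : ShortVar G) : ShortVar (fun n => F n + G n) := by
  intro ε hε
  obtain ⟨K, hK, h⟩ := hF ε hε
  obtain ⟨K', hK', h'⟩ := hG ε hε
  refine ⟨2 * K + 2 * K', by positivity, fun δ hδ hδ1 => ?_⟩
  obtain ⟨Ψ, h0, h1, h2⟩ := h δ hδ hδ1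
  obtain ⟨Ψ', h0', h1', h2'⟩ := h' δ hδ hδ1
  refine ⟨fun n => 2 * Ψ n + 2 * Ψ' n, fun n => by have := h0 n; have := h0' n; positivity,
    fun X => ?_, fun n n' a b c d => ?_⟩
  · rw [Finset.sum_add_distrib, ← Finset.mul_sum, ← Finset.mul_sum]
    nlinarith [h1 X, h1' X]
  · have e1 := h2 n n' a b c d
    have e2 := h2' n n' a b c d
    nlinarith [sq_nonneg ((F n - F n') - (G n - G n'))]

lemma congr (hF : ShortVar F) (h : ∀ n, 1 ≤ n → G n = F n) : ShortVar G := by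
  intro ε hε
  obtain ⟨K, hK, h'⟩ := hF ε hε
  refine ⟨K, hK, fun δ hδ hδ1 => ?_⟩
  obtain ⟨Ψ, h0, h1, h2⟩ := h' δ hδ hδ1
  refine ⟨Ψ, h0, h1, fun n n' a b c d => ?_⟩
  have hn : 1 ≤ n := by
    rcases Nat.eq_zero_or_pos n with rfl | h
    · norm_num at c
    · exact h
  rw [h n hn, h n' (by omega)]
  exact h2 n n' a b c d

lemma neg (hF : ShortVar F) : ShortVar (fun n => - F n) := by
  intro ε hε
  obtain ⟨K, hK, h⟩ := hF ε hε
  refine ⟨K, hK, fun δ hδ hδ1 => ?_⟩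
  obtain ⟨Ψ, h0, h1, h2⟩ := h δ hδ hδ1
  refine ⟨Ψ, h0, h1, fun n n' a b c d => ?_⟩
  have := h2 n n' a b c d
  calc _ = (F n - F n') ^ 2 := by ring
    _ ≤ _ := this

lemma sub (hF : ShortVar F) (hG : ShortVar G) : ShortVar (fun n => F n - G n) :=
  (hF.add hG.neg).congr fun _ _ => sub_eq_add_neg _ _

lemma of_le_one (key : ∀ ε : ℝ, 0 < ε → ε ≤ 1 → ∃ K : ℝ, 0 < K ∧ ∀ δ : ℝ, 0 < δ → δ ≤ 1 →
      ∃ Ψ : ℕ → ℝ, (∀ n, 0 ≤ Ψ n) ∧ (∀ X : ℕ, ∑ n ∈ Finset.range X, Ψ n ≤ K * δ ^ (1 - ε)) ∧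
      ∀ n n' : ℕ, n' ≤ n → n ≤ 4 * n' → 16 ≤ δ * n → n ≤ n' + 2 * δ * n →
      (F n - F n') ^ 2 ≤ Ψ n + Ψ n') : ShortVar F := by
  intro ε hε
  obtain ⟨K, hK, h⟩ := key (min ε 1) (by positivity) (min_le_right _ _)
  refine ⟨K, hK, fun δ hδ hδ1 => ?_⟩
  obtain ⟨Ψ, h0, h1, h2⟩ := h δ hδ hδ1
  refine ⟨Ψ, h0, fun X => (h1 X).trans ?_, h2⟩
  exact mul_le_mul_of_nonneg_left (Real.rpow_le_rpow_of_exponent_ge hδ hδ1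
    (by linarith [min_le_left ε 1])) hK.le

end ShortVar

lemma exists_sum_rpow_le {p : ℝ} (hp : p < -1) :
    ∃ S : ℝ, 0 < S ∧ ∀ X : ℕ, ∑ n ∈ Finset.range X, (n:ℝ) ^ p ≤ S := by
  have hs : Summable fun n : ℕ => (n:ℝ) ^ p := Real.summable_nat_rpow.2 hp
  have h0 : 0 ≤ ∑' n : ℕ, (n:ℝ) ^ p := tsum_nonneg fun n => by positivity
  refine ⟨(∑' n : ℕ, (n:ℝ) ^ p) + 1, by positivity, fun X => ?_⟩
  have := hs.sum_le_tsum (Finset.range X) (fun n _ => by positivity)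
  linarith

/-- A function of size `n^{-1+ε}` has small short variation. -/
lemma EpsBound.shortVar {F : ℕ → ℝ} (h : EpsBound (-1) F) : ShortVar F := by
  have key : ∀ ε : ℝ, 0 < ε → ε ≤ 1 → ∃ K : ℝ, 0 < K ∧ ∀ δ : ℝ, 0 < δ → δ ≤ 1 →
      ∃ Ψ : ℕ → ℝ, (∀ n, 0 ≤ Ψ n) ∧ (∀ X : ℕ, ∑ n ∈ Finset.range X, Ψ n ≤ K * δ ^ (1 - ε)) ∧
      ∀ n n' : ℕ, n' ≤ n → n ≤ 4 * n' → 16 ≤ δ * n → n ≤ n' + 2 * δ * n →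
      (F n - F n') ^ 2 ≤ Ψ n + Ψ n' := by
    intro ε hε hε1
    obtain ⟨K, hK, h⟩ := h (ε / 4) (by positivity)
    obtain ⟨S, hS, hsum⟩ := exists_sum_rpow_le (p := -1 - ε / 2) (by linarith)
    refine ⟨2 * K ^ 2 * S, by positivity, fun δ hδ hδ1 => ?_⟩
    refine ⟨fun n => 2 * K ^ 2 * δ ^ (1 - ε) * (n:ℝ) ^ (-1 - ε / 2), fun n => by positivity,
      fun X => ?_, fun n n' a b c d => ?_⟩
    · rw [← Finset.mul_sum]
      calc _ ≤ 2 * K ^ 2 * δ ^ (1 - ε) * S := mul_le_mul_of_nonneg_left (hsum X) (by positivity)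
        _ = _ := by ring
    · have hpt : ∀ l : ℕ, 1 ≤ δ * l →
          2 * F l ^ 2 ≤ 2 * K ^ 2 * δ ^ (1 - ε) * (l:ℝ) ^ (-1 - ε / 2) := by
        intro l hl
        have hl0 : 0 < l := by
          rcases Nat.eq_zero_or_pos l with rfl | h
          · norm_num at hl
          · exact h
        have hl0' : (0:ℝ) < l := by exact_mod_cast hl0
        have h1 := h l hl0
        have h2 : F l ^ 2 ≤ (K * (l:ℝ) ^ (-1 + ε / 4)) ^ 2 := sq_le_sq' (by
          linarith [neg_abs_le (F l)]) ((le_abs_self _).trans h1)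
        have h3 : (1:ℝ) ≤ (δ * l) ^ (1 - ε) := Real.one_le_rpow hl (by linarith)
        rw [Real.mul_rpow hδ.le hl0'.le] at h3
        have e1 : ((l:ℝ) ^ (-1 + ε / 4)) ^ 2 * (l:ℝ) ^ (1 - ε) = (l:ℝ) ^ (-1 - ε / 2) := by
          rw [← Real.rpow_natCast, ← Real.rpow_mul hl0'.le, ← Real.rpow_add hl0']
          push_cast; ring_nf
        rw [← e1]
        rw [mul_pow] at h2
        have h4 : 0 ≤ K ^ 2 * ((l:ℝ) ^ (-1 + ε / 4)) ^ 2 := by positivity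
        nlinarith
      have b' : (n:ℝ) ≤ 4 * n' := by exact_mod_cast b
      have e1 := hpt n (by linarith)
      have e2 := hpt n' (by nlinarith)
      nlinarith [sq_nonneg (F n + F n')]
  exact ShortVar.of_le_one key

lemma abs_saw_le (m n : ℕ) : |saw m n| ≤ 1 := by
  rw [saw, abs_le]
  rcases Nat.eq_zero_or_pos m with rfl | hm
  · norm_num
  · have hm' : (0:ℝ) < m := by exact_mod_cast hm
    have h1 : ((n % m : ℕ) : ℝ) / m ≤ 1 := by
      rw [div_le_one hm']
      exact_mod_cast (Nat.mod_lt n hm).le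
    have h2 : 0 ≤ ((n % m : ℕ) : ℝ) / m := by positivity
    constructor <;> linarith

/-- Weights `(log m)^v` cut off beyond `N`. -/
noncomputable def cutLogPow (v N : ℕ) (m : ℕ) : ℂ := if m ≤ N then ((Real.log m ^ v : ℝ) : ℂ) else 0

lemma norm_cutLogPow_le (v N : ℕ) {ℓ : ℝ} (hℓ : 1 + Real.log N ≤ ℓ) (m : ℕ) :
    ‖cutLogPow v N m‖ ≤ ℓ ^ v := by
  have hN0 : 0 ≤ Real.log N := Real.log_natCast_nonneg N
  rw [cutLogPow]
  split_ifs with h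
  · rw [Complex.norm_real, Real.norm_eq_abs, abs_of_nonneg (pow_nonneg (Real.log_natCast_nonneg m) _)]
    refine pow_le_pow_left₀ (Real.log_natCast_nonneg m) ?_ v
    rcases Nat.eq_zero_or_pos m with rfl | hm
    · simp; linarith
    · have : Real.log m ≤ Real.log N := Real.log_le_log (by exact_mod_cast hm) (by exact_mod_cast h)
      linarith
  · rw [norm_zero]; exact pow_nonneg (by linarith) _

lemma genTheta_eq_sawSum (v N n : ℕ) (h : Nat.sqrt n ≤ N) :
    ((genTheta v 0 n : ℝ) : ℂ) = sawSum (Nat.sqrt n) (cutLogPow v N) n := by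
  rw [genTheta, sawSum, Complex.ofReal_sum]
  refine Finset.sum_congr rfl fun m hm => ?_
  rw [cutLogPow, if_pos ((Finset.mem_Icc.1 hm).2.trans h)]
  push_cast
  ring

lemma norm_sawSum_sub_le (B B' n : ℕ) (hB : B' ≤ B) (w : ℕ → ℂ) (W : ℝ) (hw : ∀ m, ‖w m‖ ≤ W) :
    ‖sawSum B w n - sawSum B' w n‖ ≤ ((B : ℝ) - B') * W := by
  have hW : 0 ≤ W := (norm_nonneg _).trans (hw 0)
  have hsub : Finset.Icc 1 B' ⊆ Finset.Icc 1 B := Finset.Icc_subset_Icc_right hB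
  rw [sawSum, sawSum, ← Finset.sum_sdiff hsub, add_sub_cancel_right]
  refine (norm_sum_le_of_le _ (f := fun m => w m * (saw m n : ℂ)) (n := fun _ => W) ?_).trans ?_
  · intro m _
    rw [norm_mul, Complex.norm_real, Real.norm_eq_abs]
    calc _ ≤ W * 1 := mul_le_mul (hw m) (abs_saw_le m n) (abs_nonneg _) hW
      _ = W := mul_one W
  · rw [Finset.sum_const, Finset.card_sdiff_of_subset hsub, Nat.card_Icc, Nat.card_Icc,
      nsmul_eq_mul, Nat.add_sub_cancel, Nat.add_sub_cancel, Nat.cast_sub hB]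

lemma abs_genTheta_zero_le (v n : ℕ) {ℓ : ℝ} (hℓ : 1 + Real.log n ≤ ℓ) :
    |genTheta v 0 n| ≤ Real.sqrt n * ℓ ^ v := by
  have hℓ0 : 0 ≤ ℓ := by linarith [Real.log_natCast_nonneg n]
  have hle : 1 + Real.log (Nat.sqrt n) ≤ ℓ := by
    rcases Nat.eq_zero_or_pos (Nat.sqrt n) with h | h
    · rw [h]; simp; linarith [Real.log_natCast_nonneg n]
    · have : Real.log (Nat.sqrt n) ≤ Real.log n :=
        Real.log_le_log (by exact_mod_cast h) (by exact_mod_cast Nat.sqrt_le_self n)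
      linarith
  have h1 := norm_sawSum_sub_le (Nat.sqrt n) 0 n (Nat.zero_le _) (cutLogPow v (Nat.sqrt n)) (ℓ ^ v)
    (norm_cutLogPow_le v _ hle)
  rw [← genTheta_eq_sawSum v _ n le_rfl] at h1
  simp only [sawSum, Finset.Icc_eq_empty_of_lt zero_lt_one, Finset.sum_empty, sub_zero,
    Complex.norm_real, Real.norm_eq_abs, Nat.cast_zero] at h1
  exact h1.trans (mul_le_mul_of_nonneg_right Real.nat_sqrt_le_real_sqrt (by positivity))

lemma abs_log_pow_div_le (k n : ℕ) {ℓ y : ℝ} (hy : 0 < y) (hyn : y ≤ n)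
    (hℓ : 1 + Real.log n ≤ ℓ) : |Real.log n ^ k / n| ≤ ℓ ^ k / y := by
  have h0 := Real.log_natCast_nonneg n
  rw [abs_of_nonneg (by positivity)]
  have : Real.log n ^ k ≤ ℓ ^ k := pow_le_pow_left₀ h0 (by linarith) k
  exact div_le_div₀ (pow_nonneg (by linarith) _) this hy hyn

lemma abs_log_pow_div_sub_le (k n n' : ℕ) {ℓ y : ℝ} (hy : 1 ≤ y) (hyn : y ≤ n') (hn : n' ≤ n)
    (hℓ : 1 + Real.log n ≤ ℓ) :
    |Real.log n ^ k / n - Real.log n' ^ k / n'| ≤ (k + 1) * ℓ ^ k / y ^ 2 * ((n:ℝ) - n') := by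
  have hn' : (n':ℝ) ≤ n := by exact_mod_cast hn
  refine abs_sub_le_of_deriv_bound (g := fun y : ℝ => Real.log y ^ k / y)
    (g' := fun y : ℝ => (k * Real.log y ^ (k - 1) - Real.log y ^ k) / y ^ 2) hn' ?_ ?_
  · intro x hx
    have hx0 : 0 < x := by linarith [hx.1]
    refine (((Real.hasDerivAt_log hx0.ne').fun_pow k).fun_div (hasDerivAt_id' x) hx0.ne').congr_deriv ?_
    field_simp
  · intro x hx
    have hx1 : 1 ≤ x := by linarith [hx.1]
    have hl0 : 0 ≤ Real.log x := Real.log_nonneg hx1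
    have hl : Real.log x ≤ ℓ := by
      have : Real.log x ≤ Real.log n := Real.log_le_log (by linarith) hx.2
      linarith
    have hℓ1 : 1 ≤ ℓ := by linarith [Real.log_natCast_nonneg n]
    rw [abs_div, abs_of_pos (by positivity : 0 < x ^ 2)]
    have h1 : Real.log x ^ (k - 1) ≤ ℓ ^ k :=
      (pow_le_pow_left₀ hl0 hl _).trans (pow_le_pow_right₀ hℓ1 (Nat.sub_le _ _))
    have h2 : Real.log x ^ k ≤ ℓ ^ k := pow_le_pow_left₀ hl0 hl k
    have h3 : |k * Real.log x ^ (k - 1) - Real.log x ^ k| ≤ (k + 1) * ℓ ^ k := by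
      have e1 : 0 ≤ (k:ℝ) * Real.log x ^ (k - 1) := by positivity
      have e2 : (k:ℝ) * Real.log x ^ (k - 1) ≤ k * ℓ ^ k :=
        mul_le_mul_of_nonneg_left h1 (by positivity)
      have e3 : 0 ≤ Real.log x ^ k := by positivity
      have e4 : 0 ≤ ℓ ^ k := by positivity
      have e5 : 0 ≤ (k:ℝ) * ℓ ^ k := by positivity
      rw [abs_le]; constructor <;> linarith
    refine div_le_div₀ (by positivity) h3 (by positivity) ?_
    exact pow_le_pow_left₀ (by linarith) (by linarith [hx.1]) 2

lemma exists_block_bound_large (v k : ℕ) (Y : ℕ) (hY : 1 ≤ Y) (ℓ : ℝ)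
    (hℓ : ℓ = 1 + Real.log (2 * Y : ℕ)) :
    ∃ Φ : ℕ → ℝ, (∀ n, 0 ≤ Φ n) ∧
      ∑ n ∈ Finset.range (2 * Y), Φ n ≤ 7168 * (1 / Real.sqrt Y) * ℓ ^ (2 * k + 2 * v + 6) ∧
      ∀ n n' : ℕ, Y ≤ n → n < 2 * Y → n' ≤ n → n ≤ 4 * n' →
        (Real.log n ^ k / n * genTheta v 0 n - Real.log n' ^ k / n' * genTheta v 0 n') ^ 2
          ≤ Φ n + Φ n' := by
  set N := Nat.sqrt (2 * Y) with hN
  have hN1 : 1 ≤ N := Nat.sqrt_pos.2 (by omega)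
  have hNX : N ^ 2 ≤ 2 * (2 * Y) := by
    have : N ^ 2 ≤ 2 * Y := Nat.sqrt_le' (2 * Y)
    omega
  have hY0 : (0:ℝ) < Y := by exact_mod_cast hY
  have hNl : 1 + Real.log N ≤ ℓ := by
    rw [hℓ]
    have : Real.log N ≤ Real.log (2 * Y : ℕ) :=
      Real.log_le_log (by exact_mod_cast hN1) (by exact_mod_cast Nat.sqrt_le_self _)
    linarith
  have hℓ1 : 1 ≤ ℓ := by linarith [Real.log_natCast_nonneg N]
  obtain ⟨Φ, h0, h1, h2⟩ := exists_sawSum_bound N (2 * Y) hN1 hNX (cutLogPow v N) (ℓ ^ v)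
    (norm_cutLogPow_le v N hNl)
  have hpt : ∀ n : ℕ, Y ≤ 4 * n → n ≤ 2 * Y →
      (Real.log n ^ k / n * genTheta v 0 n) ^ 2 ≤ (ℓ ^ k / (Y / 4)) ^ 2 * Φ n := by
    intro n hn hn2
    have hn' : (Y:ℝ) / 4 ≤ n := by
      have : (Y:ℝ) ≤ 4 * n := by exact_mod_cast hn
      linarith
    have hn0 : 0 < n := by omega
    have hlog : 1 + Real.log n ≤ ℓ := by
      rw [hℓ]
      have : Real.log n ≤ Real.log (2 * Y : ℕ) :=
        Real.log_le_log (by exact_mod_cast hn0) (by exact_mod_cast hn2)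
      linarith
    have e1 := abs_log_pow_div_le k n (by positivity) hn' hlog
    have hsq : Nat.sqrt n ≤ N := Nat.sqrt_le_sqrt hn2
    have e2 := h2 _ hsq n
    rw [← genTheta_eq_sawSum v N n hsq, Complex.norm_real, Real.norm_eq_abs, sq_abs] at e2
    rw [mul_pow]
    refine mul_le_mul ?_ e2 (sq_nonneg _) (sq_nonneg _)
    rw [← sq_abs]
    exact pow_le_pow_left₀ (abs_nonneg _) e1 2
  refine ⟨fun n => 2 * (ℓ ^ k / (Y / 4)) ^ 2 * Φ n, fun n => by have := h0 n; positivity, ?_, ?_⟩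
  · rw [← Finset.mul_sum]
    have hlogN : (1 + Real.log N) ^ 6 ≤ ℓ ^ 6 :=
      pow_le_pow_left₀ (by linarith [Real.log_natCast_nonneg N]) hNl 6
    have hs : (Real.sqrt Y) ^ 2 = Y := Real.sq_sqrt hY0.le
    have hs0 : 0 < Real.sqrt Y := Real.sqrt_pos.2 hY0
    have hNs : (N:ℝ) ≤ 2 * Real.sqrt Y := by
      have e : (N:ℝ) ^ 2 ≤ (2 * Real.sqrt Y) ^ 2 := by
        rw [mul_pow, hs]
        have : ((N ^ 2 : ℕ) : ℝ) ≤ ((2 * (2 * Y) : ℕ) : ℝ) := by exact_mod_cast hNX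
        push_cast at this
        linarith
      exact (sq_le_sq₀ (Nat.cast_nonneg N) (by positivity)).1 e
    calc _ ≤ 2 * (ℓ ^ k / (Y / 4)) ^ 2 *
          (56 * (2 * Y : ℕ) * (2 * Real.sqrt Y) * (ℓ ^ v) ^ 2 * ℓ ^ 6) := by
          refine mul_le_mul_of_nonneg_left (h1.trans ?_) (by positivity)
          gcongr
      _ = _ := by
          push_cast
          have hYs : (Y:ℝ) = Real.sqrt Y * Real.sqrt Y := by rw [← sq, hs]
          generalize Real.sqrt Y = s at *
          rw [hYs]
          field_simp
          ring
  · intro n n' a b c d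
    have e1 := hpt n (by omega) b.le
    have e2 := hpt n' (by omega) (by omega)
    beta_reduce
    nlinarith [sq_nonneg (Real.log n ^ k / n * genTheta v 0 n
      + Real.log n' ^ k / n' * genTheta v 0 n')]

lemma sqrt_sub_sqrt_le {n n' : ℕ} {Y δ : ℝ} (hY : 0 < Y) (h0 : n' ≤ n) (h1 : Y ≤ 4 * n')
    (h2 : (n:ℝ) ≤ n' + 4 * δ * Y) (hδY : δ * Real.sqrt Y ≤ 1) :
    (Nat.sqrt n : ℝ) - Nat.sqrt n' ≤ 9 := by
  have e1 : (Nat.sqrt n : ℝ) ≤ Real.sqrt n := Real.nat_sqrt_le_real_sqrt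
  have e2 : Real.sqrt n' ≤ Nat.sqrt n' + 1 := Real.real_sqrt_le_nat_sqrt_succ
  have hs : Real.sqrt Y ≤ 2 * Real.sqrt n' := by
    have : Real.sqrt Y ≤ Real.sqrt (2 ^ 2 * n') := Real.sqrt_le_sqrt (by linarith)
    rwa [Real.sqrt_mul (by norm_num), Real.sqrt_sq (by norm_num)] at this
  have hs0 : 0 < Real.sqrt Y := Real.sqrt_pos.2 hY
  have hss : Real.sqrt Y * Real.sqrt Y = Y := Real.mul_self_sqrt hY.le
  have hn : Real.sqrt n * Real.sqrt n = n := Real.mul_self_sqrt (Nat.cast_nonneg n)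
  have hn' : Real.sqrt n' * Real.sqrt n' = n' := Real.mul_self_sqrt (Nat.cast_nonneg n')
  have hle : Real.sqrt n' ≤ Real.sqrt n := Real.sqrt_le_sqrt (by exact_mod_cast h0)
  have h3 : (Real.sqrt n - Real.sqrt n') * Real.sqrt Y ≤ 8 * δ * Y := by
    have : (Real.sqrt n - Real.sqrt n') * Real.sqrt Y ≤ (Real.sqrt n - Real.sqrt n')
      * (2 * Real.sqrt n') := mul_le_mul_of_nonneg_left hs (by linarith)
    nlinarith
  have h4 : 8 * δ * Y ≤ 8 * Real.sqrt Y := by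
    calc 8 * δ * Y = 8 * δ * (Real.sqrt Y * Real.sqrt Y) := by rw [hss]
      _ = 8 * (δ * Real.sqrt Y) * Real.sqrt Y := by ring
      _ ≤ 8 * 1 * Real.sqrt Y := by gcongr
      _ = _ := by ring
  have h5 : Real.sqrt n - Real.sqrt n' ≤ 8 := le_of_mul_le_mul_right (h3.trans h4) hs0
  linarith

set_option maxHeartbeats 1000000 in
lemma exists_block_bound_small (v k : ℕ) (Y : ℕ) (hY : 1 ≤ Y) (ℓ δ : ℝ)
    (hℓ : ℓ = 1 + Real.log (2 * Y : ℕ)) (hδ : 0 < δ) (hδY : 8 ≤ δ * Y)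
    (hδs : δ * Real.sqrt Y ≤ 1) :
    ∃ Φ : ℕ → ℝ, (∀ n, 0 ≤ Φ n) ∧
      ∑ n ∈ Finset.range (2 * Y), Φ n ≤
        60000 * (k + 1) ^ 2 * δ * ℓ ^ (2 * k + 2 * v + 6) ∧
      ∀ n n' : ℕ, Y ≤ n → n < 2 * Y → n' ≤ n → n ≤ 4 * n' → n ≤ n' + 2 * δ * n →
        (Real.log n ^ k / n * genTheta v 0 n - Real.log n' ^ k / n' * genTheta v 0 n') ^ 2
          ≤ Φ n + Φ n' := by
  set N := Nat.sqrt (2 * Y) with hN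
  have hN1 : 1 ≤ N := Nat.sqrt_pos.2 (by omega)
  have hNX : N ^ 2 ≤ 2 * (2 * Y) := by
    have : N ^ 2 ≤ 2 * Y := Nat.sqrt_le' (2 * Y)
    omega
  have hY0 : (0:ℝ) < Y := by exact_mod_cast hY
  have hNl : 1 + Real.log N ≤ ℓ := by
    rw [hℓ]
    have : Real.log N ≤ Real.log (2 * Y : ℕ) :=
      Real.log_le_log (by exact_mod_cast hN1) (by exact_mod_cast Nat.sqrt_le_self _)
    linarith
  have hℓ1 : 1 ≤ ℓ := by linarith [Real.log_natCast_nonneg N]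
  set Ks := ⌈4 * δ * Y⌉₊ with hKs
  have hKs1 : 1 ≤ Ks := Nat.one_le_ceil_iff.2 (by positivity)
  have hKs2 : (Ks:ℝ) ≤ 5 * δ * Y := by
    have := Nat.ceil_lt_add_one (show (0:ℝ) ≤ 4 * δ * Y by positivity)
    linarith
  have hKs3 : 4 * δ * Y ≤ Ks := Nat.le_ceil _
  obtain ⟨Φ, h0, h1, h2⟩ := exists_sawSum_sub_bound N (2 * Y) Ks hN1 hKs1 hNX (cutLogPow v N)
    (ℓ ^ v) (norm_cutLogPow_le v N hNl)
  set M : ℝ := (ℓ ^ k * ℓ ^ v) ^ 2 with hM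
  have hM0 : 0 ≤ M := sq_nonneg _
  set c : ℝ := 3 * (81 / Y ^ 2 + 8192 * (k + 1) ^ 2 * δ ^ 2 / Y) * M with hc
  have hc0 : 0 ≤ c := by positivity
  refine ⟨fun n => 3 * (ℓ ^ k / Y) ^ 2 * Φ n + c, fun n => by have := h0 n; positivity, ?_, ?_⟩
  · rw [Finset.sum_add_distrib, ← Finset.mul_sum, Finset.sum_const, Finset.card_range, nsmul_eq_mul]
    have hlogN : (1 + Real.log N) ^ 6 ≤ ℓ ^ 6 :=
      pow_le_pow_left₀ (by linarith [Real.log_natCast_nonneg N]) hNl 6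
    have hs1 : 3 * (ℓ ^ k / Y) ^ 2 * ∑ n ∈ Finset.range (2 * Y), Φ n ≤ 5760 * δ * (M * ℓ ^ 6) := by
      calc _ ≤ 3 * (ℓ ^ k / Y) ^ 2 *
          (192 * (2 * Y : ℕ) * (5 * δ * Y) * (ℓ ^ v) ^ 2 * ℓ ^ 6) := by
            refine mul_le_mul_of_nonneg_left (h1.trans ?_) (by positivity)
            gcongr
        _ = _ := by
            rw [hM]; push_cast; field_simp; ring
    have hMℓ : M ≤ M * ℓ ^ 6 := le_mul_of_one_le_right hM0 (one_le_pow₀ hℓ1)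
    have hδ1 : δ ^ 2 ≤ δ := by
      have : (1:ℝ) ≤ Real.sqrt Y := Real.one_le_sqrt.2 (by exact_mod_cast hY)
      have : δ ≤ 1 := by nlinarith
      nlinarith
    have hYδ : 1 / (Y:ℝ) ≤ δ / 8 := by
      rw [div_le_div_iff₀ hY0 (by norm_num)]; linarith
    have hk1 : (1:ℝ) ≤ (k + 1) ^ 2 := one_le_pow₀ (by linarith [(Nat.cast_nonneg k : (0:ℝ) ≤ k)])
    have hs2 : ((2 * Y : ℕ) : ℝ) * c ≤ 54000 * (k + 1) ^ 2 * δ * M := by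
      have e : ((2 * Y : ℕ) : ℝ) * c = (486 * (1 / Y) + 49152 * (k + 1) ^ 2 * δ ^ 2) * M := by
        rw [hc]; push_cast; field_simp; ring
      rw [e]
      refine mul_le_mul_of_nonneg_right ?_ hM0
      have e1 : (k + 1 : ℝ) ^ 2 * δ ^ 2 ≤ (k + 1) ^ 2 * δ :=
        mul_le_mul_of_nonneg_left hδ1 (by positivity)
      have e2 : δ ≤ (k + 1) ^ 2 * δ := le_mul_of_one_le_left hδ.le hk1
      linarith
    have e2 : δ ≤ (k + 1) ^ 2 * δ := le_mul_of_one_le_left hδ.le hk1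
    have hp : ℓ ^ (2 * k + 2 * v + 6) = M * ℓ ^ 6 := by rw [hM]; ring
    rw [hp]
    have e3 : δ * (M * ℓ ^ 6) ≤ (k + 1) ^ 2 * δ * (M * ℓ ^ 6) :=
      mul_le_mul_of_nonneg_right e2 (by positivity)
    have e4 : (k + 1) ^ 2 * δ * M ≤ (k + 1) ^ 2 * δ * (M * ℓ ^ 6) :=
      mul_le_mul_of_nonneg_left hMℓ (by positivity)
    have e5 : 0 ≤ (k + 1) ^ 2 * δ * (M * ℓ ^ 6) := by positivity
    linarith
  · intro n n' a b hnn d e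
    have hYn : (Y:ℝ) ≤ n := by exact_mod_cast a
    have hn2 : (n:ℝ) ≤ 2 * Y := by exact_mod_cast b.le
    have hYn' : (Y:ℝ) ≤ 4 * n' := by exact_mod_cast a.trans d
    have he : (n:ℝ) ≤ n' + 4 * δ * Y := by nlinarith
    have hlog : 1 + Real.log n ≤ ℓ := by
      rw [hℓ]
      have : Real.log n ≤ Real.log (2 * Y : ℕ) :=
        Real.log_le_log (by linarith) (by exact_mod_cast b.le)
      linarith
    have hlog' : 1 + Real.log n' ≤ ℓ := by
      have : Real.log n' ≤ Real.log n :=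
        Real.log_le_log (by linarith) (by exact_mod_cast hnn)
      linarith
    have hsq : Nat.sqrt n ≤ N := Nat.sqrt_le_sqrt b.le
    have hsq' : Nat.sqrt n' ≤ Nat.sqrt n := Nat.sqrt_le_sqrt hnn
    set g := Real.log n ^ k / n with hg
    set g' := Real.log n' ^ k / n' with hg'
    have hgb : |g| ≤ ℓ ^ k / Y := abs_log_pow_div_le k n hY0 hYn hlog
    have hY1 : (1:ℝ) ≤ (Y:ℝ) / 4 := by
      have : (1:ℝ) ≤ Real.sqrt Y := Real.one_le_sqrt.2 (by exact_mod_cast hY)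
      have : δ ≤ 1 := by nlinarith
      nlinarith
    have hgg : |g - g'| ≤ 64 * (k + 1) * ℓ ^ k * δ / Y := by
      refine (abs_log_pow_div_sub_le k n n' hY1 (by linarith) hnn hlog).trans ?_
      calc _ ≤ (k + 1) * ℓ ^ k / ((Y:ℝ) / 4) ^ 2 * (4 * δ * Y) :=
            mul_le_mul_of_nonneg_left (by linarith) (by positivity)
        _ = _ := by field_simp; ring
    have hS' : |genTheta v 0 n'| ^ 2 ≤ 2 * Y * (ℓ ^ v) ^ 2 := by
      have := pow_le_pow_left₀ (abs_nonneg _) (abs_genTheta_zero_le v n' hlog') 2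
      rw [mul_pow, Real.sq_sqrt (Nat.cast_nonneg _)] at this
      refine this.trans (mul_le_mul_of_nonneg_right ?_ (by positivity))
      exact le_trans (by exact_mod_cast hnn) hn2
    set z1 := sawSum (Nat.sqrt n) (cutLogPow v N) n - sawSum (Nat.sqrt n) (cutLogPow v N) n' with hz1
    set z2 := sawSum (Nat.sqrt n) (cutLogPow v N) n' - sawSum (Nat.sqrt n') (cutLogPow v N) n'
      with hz2
    have hz1b : ‖z1‖ ^ 2 ≤ Φ n + Φ n' := h2 _ hsq n n' hnn (by
      have : (n:ℝ) ≤ ((n' + Ks : ℕ) : ℝ) := by push_cast; linarith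
      exact_mod_cast this)
    have hz2b : ‖z2‖ ≤ 9 * ℓ ^ v := by
      refine (norm_sawSum_sub_le _ _ n' hsq' _ (ℓ ^ v) (norm_cutLogPow_le v N hNl)).trans ?_
      exact mul_le_mul_of_nonneg_right (sqrt_sub_sqrt_le hY0 hnn hYn' he hδs) (by positivity)
    have hdec : ((g * genTheta v 0 n - g' * genTheta v 0 n' : ℝ) : ℂ)
        = g * z1 + g * z2 + ((g - g' : ℝ) : ℂ) * (genTheta v 0 n' : ℝ) := by
      rw [hz1, hz2, ← genTheta_eq_sawSum v N n hsq, ← genTheta_eq_sawSum v N n' (hsq'.trans hsq)]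
      push_cast; ring
    have hnorm : |g * genTheta v 0 n - g' * genTheta v 0 n'| ≤
        |g| * ‖z1‖ + |g| * ‖z2‖ + |g - g'| * |genTheta v 0 n'| := by
      rw [← Real.norm_eq_abs (g * genTheta v 0 n - g' * genTheta v 0 n'), ← Complex.norm_real, hdec]
      refine (norm_add_le _ _).trans (add_le_add ((norm_add_le _ _).trans (add_le_add ?_ ?_)) ?_)
      all_goals rw [norm_mul]; simp only [Complex.norm_real, Real.norm_eq_abs]; rfl
    have t1 : (|g| * ‖z1‖) ^ 2 ≤ (ℓ ^ k / Y) ^ 2 * (Φ n + Φ n') := by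
      rw [mul_pow]
      exact mul_le_mul (pow_le_pow_left₀ (abs_nonneg _) hgb 2) hz1b (sq_nonneg _) (sq_nonneg _)
    have t2 : (|g| * ‖z2‖) ^ 2 ≤ 81 / Y ^ 2 * M := by
      calc _ ≤ ((ℓ ^ k / Y) * (9 * ℓ ^ v)) ^ 2 := by gcongr
        _ = _ := by rw [hM]; field_simp; ring
    have t3 : (|g - g'| * |genTheta v 0 n'|) ^ 2 ≤ 8192 * (k + 1) ^ 2 * δ ^ 2 / Y * M := by
      rw [mul_pow]
      calc _ ≤ (64 * (k + 1) * ℓ ^ k * δ / Y) ^ 2 * (2 * Y * (ℓ ^ v) ^ 2) :=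
            mul_le_mul (pow_le_pow_left₀ (abs_nonneg _) hgg 2) hS' (sq_nonneg _) (sq_nonneg _)
        _ = _ := by rw [hM]; field_simp; ring
    have hsq3 : ∀ x y z : ℝ, (x + y + z) ^ 2 ≤ 3 * (x ^ 2 + y ^ 2 + z ^ 2) := fun x y z => by
      nlinarith [sq_nonneg (x - y), sq_nonneg (x - z), sq_nonneg (y - z)]
    rw [← sq_abs]
    calc _ ≤ (|g| * ‖z1‖ + |g| * ‖z2‖ + |g - g'| * |genTheta v 0 n'|) ^ 2 :=
          pow_le_pow_left₀ (abs_nonneg _) hnorm 2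
      _ ≤ 3 * ((ℓ ^ k / Y) ^ 2 * (Φ n + Φ n') + 81 / Y ^ 2 * M
            + 8192 * (k + 1) ^ 2 * δ ^ 2 / Y * M) :=
          (hsq3 _ _ _).trans (by linarith)
      _ ≤ _ := by
          have e : 3 * ((ℓ ^ k / Y) ^ 2 * (Φ n + Φ n') + 81 / Y ^ 2 * M
            + 8192 * (k + 1) ^ 2 * δ ^ 2 / Y * M) = 3 * (ℓ ^ k / Y) ^ 2 * Φ n
              + 3 * (ℓ ^ k / Y) ^ 2 * Φ n' + c := by rw [hc]; ring
          rw [e]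
          linarith

lemma exists_block_bound (v k : ℕ) {ε : ℝ} (hε : 0 < ε) (hε1 : ε ≤ 1) :
    ∃ K : ℝ, 0 < K ∧ ∀ Y : ℕ, 1 ≤ Y → ∀ δ : ℝ, 0 < δ → 8 ≤ δ * Y →
    ∃ Φ : ℕ → ℝ, (∀ n, 0 ≤ Φ n) ∧
      ∑ n ∈ Finset.range (2 * Y), Φ n ≤ K * δ ^ (1 - ε) * (Y:ℝ) ^ (-(ε / 4)) ∧
      ∀ n n' : ℕ, Y ≤ n → n < 2 * Y → n' ≤ n → n ≤ 4 * n' → n ≤ n' + 2 * δ * n →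
        (Real.log n ^ k / n * genTheta v 0 n - Real.log n' ^ k / n' * genTheta v 0 n') ^ 2
          ≤ Φ n + Φ n' := by
  set M := 2 * k + 2 * v + 6 with hM
  obtain ⟨K, hK, hℓ⟩ := exists_abs_eval_log_le
    ((Polynomial.C (1 + Real.log 2) + Polynomial.X) ^ M) (ε := ε / 4) (by positivity)
  refine ⟨60000 * (k + 1) ^ 2 * K, by positivity, fun Y hY δ hδ hδY => ?_⟩
  have hY1 : (1:ℝ) ≤ Y := by exact_mod_cast hY
  have hY0 : (0:ℝ) < Y := by linarith
  have hℓY := hℓ Y hY1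
  have e : 1 + Real.log 2 + Real.log Y = 1 + Real.log (2 * Y : ℕ) := by
    push_cast
    rw [Real.log_mul (by norm_num) hY0.ne']; ring
  simp only [Polynomial.eval_pow, Polynomial.eval_add, Polynomial.eval_C, Polynomial.eval_X] at hℓY
  rw [e] at hℓY
  replace hℓY := (le_abs_self _).trans hℓY
  have hs : Real.sqrt Y = (Y:ℝ) ^ ((1:ℝ) / 2) := Real.sqrt_eq_rpow _
  have hYe : (Y:ℝ) ^ (-(ε / 2)) * (Y:ℝ) ^ (ε / 4) = (Y:ℝ) ^ (-(ε / 4)) := by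
    rw [← Real.rpow_add hY0]; ring_nf
  have hk1 : (1:ℝ) ≤ (k + 1) ^ 2 := one_le_pow₀ (by linarith [(Nat.cast_nonneg k : (0:ℝ) ≤ k)])
  rcases le_total (δ * Real.sqrt Y) 1 with h | h
  · obtain ⟨Φ, h0, h1, h2⟩ := exists_block_bound_small v k Y hY _ δ rfl hδ hδY h
    refine ⟨Φ, h0, h1.trans ?_, h2⟩
    have hd : δ ≤ δ ^ (1 - ε) * (Y:ℝ) ^ (-(ε / 2)) := by
      have h3 : (δ * Real.sqrt Y) ^ ε ≤ 1 := Real.rpow_le_one (by positivity) h hε.le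
      rw [Real.mul_rpow hδ.le (Real.sqrt_nonneg _), hs, ← Real.rpow_mul hY0.le] at h3
      have h4 : δ = δ ^ (1 - ε) * δ ^ ε := by
        rw [← Real.rpow_add hδ, sub_add_cancel, Real.rpow_one]
      have h5 : δ ^ ε ≤ (Y:ℝ) ^ (-(ε / 2)) := by
        rw [Real.rpow_neg hY0.le, le_inv_comm₀ (by positivity) (by positivity)]
        rw [le_inv_comm₀ (by positivity) (by positivity), ← one_div, le_div_iff₀ (by positivity)]
        convert! h3 using 3
        ring
      calc δ = δ ^ (1 - ε) * δ ^ ε := h4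
        _ ≤ _ := mul_le_mul_of_nonneg_left h5 (by positivity)
    calc _ ≤ 60000 * (k + 1) ^ 2 * (δ ^ (1 - ε) * (Y:ℝ) ^ (-(ε / 2))) * (K * (Y:ℝ) ^ (ε / 4)) := by
          refine mul_le_mul (mul_le_mul_of_nonneg_left hd (by positivity)) hℓY ?_ (by positivity)
          exact pow_nonneg (by linarith [Real.log_natCast_nonneg (2 * Y)]) _
      _ = 60000 * (k + 1) ^ 2 * K * δ ^ (1 - ε) * ((Y:ℝ) ^ (-(ε / 2)) * (Y:ℝ) ^ (ε / 4)) := by ring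
      _ = _ := by rw [hYe]
  · obtain ⟨Φ, h0, h1, h2⟩ := exists_block_bound_large v k Y hY _ rfl
    refine ⟨Φ, h0, h1.trans ?_, fun n n' a b c d _ => h2 n n' a b c d⟩
    have hs0 : 0 < Real.sqrt Y := Real.sqrt_pos.2 hY0
    have hd : 1 / Real.sqrt Y ≤ δ ^ (1 - ε) * (Y:ℝ) ^ (-(ε / 2)) := by
      have h3 : (1 / Real.sqrt Y) ^ (1 - ε) ≤ δ ^ (1 - ε) :=
        Real.rpow_le_rpow (by positivity) ((div_le_iff₀ hs0).2 h) (by linarith)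
      have h4 : 1 / Real.sqrt Y = (1 / Real.sqrt Y) ^ (1 - ε) * (Y:ℝ) ^ (-(ε / 2)) := by
        rw [hs, one_div, ← Real.rpow_neg hY0.le, ← Real.rpow_mul hY0.le, ← Real.rpow_add hY0]
        ring_nf
      rw [h4]
      exact mul_le_mul_of_nonneg_right h3 (by positivity)
    calc _ ≤ 7168 * (δ ^ (1 - ε) * (Y:ℝ) ^ (-(ε / 2))) * (K * (Y:ℝ) ^ (ε / 4)) := by
          refine mul_le_mul (mul_le_mul_of_nonneg_left hd (by positivity)) hℓY ?_ (by positivity)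
          exact pow_nonneg (by linarith [Real.log_natCast_nonneg (2 * Y)]) _
      _ = 7168 * (K * δ ^ (1 - ε) * ((Y:ℝ) ^ (-(ε / 2)) * (Y:ℝ) ^ (ε / 4))) := by ring
      _ ≤ (60000 * (k + 1) ^ 2) * (K * δ ^ (1 - ε) * ((Y:ℝ) ^ (-(ε / 2)) * (Y:ℝ) ^ (ε / 4))) :=
          mul_le_mul_of_nonneg_right (by linarith) (by positivity)
      _ = _ := by rw [hYe]; ring

lemma shortVar_genTheta_zero (v k : ℕ) :
    ShortVar (fun n => Real.log n ^ k / n * genTheta v 0 n) := by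
  refine ShortVar.of_le_one fun ε hε hε1 => ?_
  obtain ⟨K, hK, h⟩ := exists_block_bound v k hε hε1
  set r : ℝ := (2:ℝ) ^ (-(ε / 4)) with hr
  have hr0 : 0 < r := by positivity
  have hr1 : r < 1 := Real.rpow_lt_one_of_one_lt_of_neg (by norm_num) (by linarith)
  refine ⟨K * (1 / (1 - r)), by have : 0 < 1 - r := by linarith
                                positivity, fun δ hδ hδ1 => ?_⟩
  have hb : ∀ j : ℕ, ∃ Φ : ℕ → ℝ, (∀ n, 0 ≤ Φ n) ∧
      ∑ n ∈ Finset.range (2 * 2 ^ j), Φ n ≤ K * δ ^ (1 - ε) * r ^ j ∧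
      (8 ≤ δ * 2 ^ j → ∀ n n' : ℕ, 2 ^ j ≤ n → n < 2 * 2 ^ j → n' ≤ n → n ≤ 4 * n' →
        n ≤ n' + 2 * δ * n →
        (Real.log n ^ k / n * genTheta v 0 n - Real.log n' ^ k / n' * genTheta v 0 n') ^ 2
          ≤ Φ n + Φ n') := by
    intro j
    by_cases hj : 8 ≤ δ * 2 ^ j
    · obtain ⟨Φ, h0, h1, h2⟩ := h (2 ^ j) Nat.one_le_two_pow δ hδ (by push_cast; exact hj)
      refine ⟨Φ, h0, h1.trans (le_of_eq ?_), fun _ => h2⟩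
      push_cast
      rw [hr, ← Real.rpow_natCast (2 ^ _), ← Real.rpow_mul (by norm_num), ← Real.rpow_natCast 2,
        ← Real.rpow_mul (by norm_num), mul_comm (j:ℝ)]
    · exact ⟨fun _ => 0, fun _ => le_rfl, by simp; positivity, fun h => absurd h hj⟩
  choose Φ h0 h1 h2 using hb
  have hite : ∀ j n, 0 ≤ (if n < 2 * 2 ^ j then Φ j n else 0) := fun j n => by
    split_ifs; exacts [h0 j n, le_rfl]
  refine ⟨fun n => ∑ j ∈ Finset.range (n + 3), if n < 2 * 2 ^ j then Φ j n else 0,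
    fun n => Finset.sum_nonneg fun j _ => hite j n, fun X => ?_, fun n n' a b c d => ?_⟩
  · calc _ ≤ ∑ n ∈ Finset.range X, ∑ j ∈ Finset.range (X + 3),
            (if n < 2 * 2 ^ j then Φ j n else 0) := by
          refine Finset.sum_le_sum fun n hn => ?_
          refine Finset.sum_le_sum_of_subset_of_nonneg ?_ fun j _ _ => hite j n
          exact Finset.range_mono (by have := Finset.mem_range.1 hn; omega)
      _ = ∑ j ∈ Finset.range (X + 3), ∑ n ∈ Finset.range X,
            (if n < 2 * 2 ^ j then Φ j n else 0) := Finset.sum_comm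
      _ ≤ ∑ j ∈ Finset.range (X + 3), K * δ ^ (1 - ε) * r ^ j := by
          refine Finset.sum_le_sum fun j _ => le_trans ?_ (h1 j)
          rw [← Finset.sum_filter]
          refine Finset.sum_le_sum_of_subset_of_nonneg ?_ fun n _ _ => h0 j n
          intro n hn
          exact Finset.mem_range.2 (Finset.mem_filter.1 hn).2
      _ ≤ _ := by
          rw [← Finset.mul_sum]
          have hg : ∑ j ∈ Finset.range (X + 3), r ^ j ≤ 1 / (1 - r) := by
            rw [one_div, ← tsum_geometric_of_lt_one hr0.le hr1]
            exact (summable_geometric_of_lt_one hr0.le hr1).sum_le_tsum _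
              fun j _ => by positivity
          calc _ ≤ K * δ ^ (1 - ε) * (1 / (1 - r)) :=
                mul_le_mul_of_nonneg_left hg (by positivity)
            _ = _ := by ring
  · have hn : n ≠ 0 := by
      rintro rfl; norm_num at c
    set j := Nat.log 2 n with hj
    have hj1 : 2 ^ j ≤ n := Nat.pow_log_le_self 2 hn
    have hj2 : n < 2 * 2 ^ j := by
      have : n < 2 ^ (j + 1) := Nat.lt_pow_succ_log_self (b := 2) one_lt_two n
      rw [pow_succ] at this; omega
    have hjn : j < n := lt_of_lt_of_le Nat.lt_two_pow_self hj1
    have hjn' : j < n' + 3 := by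
      by_contra hcon
      have h3 : 2 ^ (n' + 3) ≤ 2 ^ j := Nat.pow_le_pow_right (by norm_num) (by omega)
      have h4 : n' < 2 ^ n' := Nat.lt_two_pow_self
      rw [pow_add] at h3
      omega
    have h8 : 8 ≤ δ * 2 ^ j := by
      have : (n:ℝ) ≤ 2 * 2 ^ j := by exact_mod_cast hj2.le
      nlinarith
    refine (h2 j h8 n n' hj1 hj2 a b d).trans (add_le_add ?_ ?_)
    · have := Finset.single_le_sum (f := fun j => if n < 2 * 2 ^ j then Φ j n else 0)
        (fun j _ => hite j n) (Finset.mem_range.2 (show j < n + 3 by omega))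
      beta_reduce at this
      rwa [if_pos hj2] at this
    · have := Finset.single_le_sum (f := fun j => if n' < 2 * 2 ^ j then Φ j n' else 0)
        (fun j _ => hite j n') (Finset.mem_range.2 hjn')
      beta_reduce at this
      rwa [if_pos (lt_of_le_of_lt a hj2)] at this

lemma shortVar_genTheta (j : ℕ) : ∀ v k : ℕ,
    ShortVar (fun n => Real.log n ^ k / n * genTheta v j n) := by
  induction j with
  | zero => exact shortVar_genTheta_zero
  | succ j ih =>
    intro v k
    refine ((ih v (k + 1)).sub (ih (v + 1) k)).congr fun n _ => ?_
    have e : genTheta v (j + 1) n = Real.log n * genTheta v j n - genTheta (v + 1) j n := by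
      rw [genTheta, genTheta, genTheta, Finset.mul_sum, ← Finset.sum_sub_distrib]
      exact Finset.sum_congr rfl fun m _ => by ring
    rw [e]
    ring

/-- The error term in the asymptotics of `genSum` has small short variation. -/
lemma shortVar_genSum_sub (i j : ℕ) (P : Polynomial ℝ)
    (hP : EpsBound (-1) (fun n =>
      genSum i j n - (P.eval (Real.log n) - (genTheta i j n + genTheta j i n) / n))) :
    ShortVar (fun n => genSum i j n - P.eval (Real.log n)) := by
  refine ((hP.shortVar.sub (shortVar_genTheta j i 0)).sub (shortVar_genTheta i j 0)).congr
    fun n _ => ?_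
  ring

/-- The remainder of a summatory function `A` against a polynomial in the logarithm, as a
function of `u = log x`. -/
noncomputable def logErr (A : ℕ → ℝ) (P : Polynomial ℝ) (u : ℝ) : ℝ :=
  if 0 ≤ u then A ⌊Real.exp u⌋₊ - P.eval u else 0

/-- `f(u) = O(e^{(-1/2+ε)u})` for every `ε > 0`. -/
def SqrtSmall (f : ℝ → ℝ) : Prop :=
  ∀ ε : ℝ, 0 < ε → ∃ K : ℝ, 0 < K ∧ ∀ u : ℝ, 0 ≤ u → |f u| ≤ K * Real.exp ((-(1:ℝ)/2 + ε) * u)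

/-- Mean-square bound for the differences of `f`. -/
def MeanSqShift (f : ℝ → ℝ) : Prop :=
  ∀ ε : ℝ, 0 < ε → ∃ K : ℝ, 0 < K ∧ ∀ δ : ℝ, 0 < δ → δ ≤ 1 →
    ∫⁻ u, ENNReal.ofReal ((f u - f (u - δ)) ^ 2 * Real.exp u) ≤ ENNReal.ofReal (K * δ ^ (1 - ε))

lemma exists_abs_eval_sub_le (P : Polynomial ℝ) {ε : ℝ} (hε : 0 < ε) :
    ∃ K : ℝ, 0 < K ∧ ∀ v u : ℝ, 0 ≤ v → v ≤ u →
      |P.eval u - P.eval v| ≤ K * Real.exp (ε * u) * (u - v) := by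
  obtain ⟨K, hK, h⟩ := exists_abs_eval_le_exp P.derivative hε
  refine ⟨K, hK, fun v u hv hvu => ?_⟩
  refine abs_sub_le_of_deriv_bound (g := fun x => P.eval x) (g' := fun x => P.derivative.eval x)
    hvu (fun x _ => P.hasDerivAt x) fun x hx => (h x (hv.trans hx.1)).trans ?_
  have : ε * x ≤ ε * u := mul_le_mul_of_nonneg_left hx.2 hε.le
  exact mul_le_mul_of_nonneg_left (Real.exp_le_exp.2 this) hK.le

lemma floor_exp_bounds {u : ℝ} (hu : 0 ≤ u) :
    1 ≤ ⌊Real.exp u⌋₊ ∧ Real.log ⌊Real.exp u⌋₊ ≤ u ∧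
      u < Real.log ⌊Real.exp u⌋₊ + 1 / (⌊Real.exp u⌋₊ : ℝ) ∧
      (⌊Real.exp u⌋₊ : ℝ) ≤ Real.exp u ∧ Real.exp u < ⌊Real.exp u⌋₊ + 1 := by
  have h1 : 1 ≤ ⌊Real.exp u⌋₊ := Nat.le_floor (by simpa using hu)
  have h0 : (0:ℝ) < ⌊Real.exp u⌋₊ := by exact_mod_cast h1
  have h2 : (⌊Real.exp u⌋₊ : ℝ) ≤ Real.exp u := Nat.floor_le (Real.exp_pos u).le
  have h3 := Nat.lt_floor_add_one (Real.exp u)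
  refine ⟨h1, ?_, ?_, h2, h3⟩
  · rw [Real.log_le_iff_le_exp h0]; exact h2
  · have h4 : u < Real.log (⌊Real.exp u⌋₊ + 1) := by
      rw [Real.lt_log_iff_exp_lt (by positivity)]; exact h3
    have h5 : Real.log ((⌊Real.exp u⌋₊ + 1) / ⌊Real.exp u⌋₊) ≤
        (⌊Real.exp u⌋₊ + 1) / ⌊Real.exp u⌋₊ - 1 := Real.log_le_sub_one_of_pos (by positivity)
    rw [Real.log_div (by positivity) (by positivity)] at h5
    have h6 : ((⌊Real.exp u⌋₊ : ℝ) + 1) / ⌊Real.exp u⌋₊ - 1 = 1 / (⌊Real.exp u⌋₊ : ℝ) := by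
      field_simp
      ring
    linarith

lemma exists_eval_sub_eval_log_floor_le (P : Polynomial ℝ) {ε : ℝ} (hε : 0 < ε) :
    ∃ K : ℝ, 0 < K ∧ ∀ u : ℝ, 0 ≤ u →
      |P.eval u - P.eval (Real.log ⌊Real.exp u⌋₊)| ≤ K * (⌊Real.exp u⌋₊ : ℝ) ^ (-1 + ε) := by
  obtain ⟨K, hK, h⟩ := exists_abs_eval_sub_le P hε
  refine ⟨K * 2 ^ ε, by positivity, fun u hu => ?_⟩
  obtain ⟨h1, h2, h3, h4, h5⟩ := floor_exp_bounds hu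
  set n := ⌊Real.exp u⌋₊ with hn
  have h1' : (1:ℝ) ≤ n := by exact_mod_cast h1
  have h0 : (0:ℝ) < n := by linarith
  refine (h _ u (Real.log_natCast_nonneg n) h2).trans ?_
  have e1 : Real.exp (ε * u) ≤ 2 ^ ε * (n:ℝ) ^ ε := by
    rw [← Real.mul_rpow (by norm_num) h0.le, mul_comm ε u, Real.exp_mul]
    exact Real.rpow_le_rpow (Real.exp_pos _).le (by linarith) hε.le
  have e2 : (n:ℝ) ^ (-1 + ε) = (n:ℝ) ^ ε * (1 / n) := by
    rw [add_comm, Real.rpow_add h0, Real.rpow_neg_one, one_div]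
  rw [e2]
  calc _ ≤ K * (2 ^ ε * (n:ℝ) ^ ε) * (1 / n) := by
        apply mul_le_mul (mul_le_mul_of_nonneg_left e1 hK.le) (by linarith) (by linarith)
          (by positivity)
    _ = _ := by ring

lemma epsBound_genTheta (i j : ℕ) : EpsBound (1 / 2) (genTheta i j) := by
  have h : EpsBound (1 / 2 + 0) (fun n : ℕ => (n:ℝ) ^ ((1:ℝ) / 2) * Real.log n ^ (i + j)) :=
    (EpsBound.rpow (1 / 2)).mul (EpsBound.logPow (i + j))
  rw [add_zero] at h
  refine h.of_le fun n hn => ?_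
  have hl := Real.log_natCast_nonneg n
  rw [abs_of_nonneg (a := (n:ℝ) ^ ((1:ℝ) / 2) * _) (by positivity), genTheta, ← Real.sqrt_eq_rpow]
  refine (Finset.abs_sum_le_sum_abs _ _).trans ?_
  trans ∑ m ∈ Finset.Icc 1 (Nat.sqrt n), Real.log n ^ (i + j)
  · refine Finset.sum_le_sum fun m hm => ?_
    obtain ⟨hm1, hm2⟩ := Finset.mem_Icc.1 hm
    have hm0 := Real.log_natCast_nonneg m
    have hmn : Real.log m ≤ Real.log n := Real.log_le_log (by exact_mod_cast hm1)
      (by exact_mod_cast hm2.trans (Nat.sqrt_le_self n))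
    rw [abs_mul, abs_of_nonneg (mul_nonneg (pow_nonneg hm0 _) (pow_nonneg (by linarith) _))]
    have h1 : Real.log m ^ i ≤ Real.log n ^ i := pow_le_pow_left₀ hm0 hmn i
    have h2 : (Real.log n - Real.log m) ^ j ≤ Real.log n ^ j :=
      pow_le_pow_left₀ (by linarith) (by linarith) j
    have h3 := mul_le_mul h1 h2 (pow_nonneg (by linarith) _) (by positivity)
    rw [← pow_add] at h3
    exact (mul_le_of_le_one_right (mul_nonneg (pow_nonneg hm0 _) (pow_nonneg (by linarith) _))
      (abs_saw_le m n)).trans h3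
  · rw [Finset.sum_const, Nat.card_Icc, Nat.add_sub_cancel, nsmul_eq_mul]
    exact mul_le_mul_of_nonneg_right Real.nat_sqrt_le_real_sqrt (by positivity)

lemma epsBound_genSum_sub (i j : ℕ) (P : Polynomial ℝ)
    (hP : EpsBound (-1) (fun n =>
      genSum i j n - (P.eval (Real.log n) - (genTheta i j n + genTheta j i n) / n))) :
    EpsBound (-(1:ℝ)/2) (fun n => genSum i j n - P.eval (Real.log n)) := by
  have h1 := ((epsBound_genTheta i j).add (epsBound_genTheta j i)).mul (EpsBound.rpow (-1))
  rw [show (1:ℝ) / 2 + -1 = -(1:ℝ)/2 by norm_num] at h1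
  refine ((hP.mono (q := -(1:ℝ)/2) (by norm_num)).sub h1).congr fun n hn => ?_
  rw [Real.rpow_neg_one]
  ring

lemma sqrtSmall_of_le {f : ℝ → ℝ} (h : ∀ ε : ℝ, 0 < ε → ε ≤ 1 / 2 → ∃ K : ℝ, 0 < K ∧ ∀ u : ℝ,
    0 ≤ u → |f u| ≤ K * Real.exp ((-(1:ℝ)/2 + ε) * u)) : SqrtSmall f := by
  intro ε hε
  obtain ⟨K, hK, h⟩ := h (min ε (1 / 2)) (by positivity) (min_le_right _ _)
  refine ⟨K, hK, fun u hu => (h u hu).trans (mul_le_mul_of_nonneg_left ?_ hK.le)⟩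
  exact Real.exp_le_exp.2 (mul_le_mul_of_nonneg_right (by linarith [min_le_left ε (1 / 2)]) hu)

lemma exists_abs_logErr_le_floor {A : ℕ → ℝ} {P : Polynomial ℝ}
    (h : EpsBound (-(1:ℝ)/2) (fun n => A n - P.eval (Real.log n))) {ε : ℝ} (hε : 0 < ε) :
    ∃ K : ℝ, 0 < K ∧ ∀ u : ℝ, 0 ≤ u →
      |logErr A P u| ≤ K * (⌊Real.exp u⌋₊ : ℝ) ^ (-(1:ℝ)/2 + ε) := by
  obtain ⟨K, hK, h⟩ := h ε hε
  obtain ⟨K', hK', h'⟩ := exists_eval_sub_eval_log_floor_le P hε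
  refine ⟨K + K', by positivity, fun u hu => ?_⟩
  obtain ⟨h1, h2, h3, h4, h5⟩ := floor_exp_bounds hu
  rw [logErr, if_pos hu]
  have e1 := h _ h1
  have e2 := h' u hu
  set n := ⌊Real.exp u⌋₊ with hn
  have h1' : (1:ℝ) ≤ n := by exact_mod_cast h1
  have e3 : (n:ℝ) ^ (-1 + ε) ≤ (n:ℝ) ^ (-(1:ℝ)/2 + ε) :=
    Real.rpow_le_rpow_of_exponent_le h1' (by linarith)
  calc |A n - P.eval u| = |(A n - P.eval (Real.log n)) - (P.eval u - P.eval (Real.log n))| := by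
        congr 1; ring
    _ ≤ _ := abs_sub _ _
    _ ≤ K * (n:ℝ) ^ (-(1:ℝ)/2 + ε) + K' * (n:ℝ) ^ (-(1:ℝ)/2 + ε) :=
        add_le_add e1 (e2.trans (mul_le_mul_of_nonneg_left e3 hK'.le))
    _ = _ := by ring

lemma sqrtSmall_logErr {A : ℕ → ℝ} {P : Polynomial ℝ}
    (h : EpsBound (-(1:ℝ)/2) (fun n => A n - P.eval (Real.log n))) : SqrtSmall (logErr A P) := by
  refine sqrtSmall_of_le fun ε hε hε1 => ?_
  obtain ⟨K, hK, h⟩ := exists_abs_logErr_le_floor h hε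
  refine ⟨K * (1 / 2) ^ (-(1:ℝ)/2 + ε), by positivity, fun u hu => (h u hu).trans ?_⟩
  obtain ⟨h1, h2, h3, h4, h5⟩ := floor_exp_bounds hu
  set n := ⌊Real.exp u⌋₊ with hn
  have h1' : (1:ℝ) ≤ n := by exact_mod_cast h1
  rw [mul_assoc, mul_comm (-(1:ℝ)/2 + ε) u, Real.exp_mul,
    ← Real.mul_rpow (by norm_num) (Real.exp_pos u).le]
  refine mul_le_mul_of_nonneg_left ?_ hK.le
  exact Real.rpow_le_rpow_of_nonpos (by positivity) (by linarith) (by linarith)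

/-- Integrating over the cells `⌊e^u⌋ = n`. -/
lemma lintegral_le_of_cells {f : ℝ → ℝ} {c w : ℕ → ℝ} {S : ℝ} (hc : ∀ n, 0 ≤ c n)
    (hw : ∀ n, 0 ≤ w n) (hneg : ∀ u < 0, f u ≤ 0)
    (hle : ∀ u, 0 ≤ u → f u ≤ 0 ∨
      (f u ≤ c ⌊Real.exp u⌋₊ ∧ u < Real.log ⌊Real.exp u⌋₊ + w ⌊Real.exp u⌋₊))
    (hS : ∀ X : ℕ, ∑ n ∈ Finset.range X, c n * w n ≤ S) :
    ∫⁻ u, ENNReal.ofReal (f u) ≤ ENNReal.ofReal S := by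
  have hpt : ∀ u, ENNReal.ofReal (f u) ≤ ∑' n : ℕ,
      (Set.Ico (Real.log n) (Real.log n + w n)).indicator (fun _ => ENNReal.ofReal (c n)) u := by
    intro u
    by_cases hu : 0 ≤ u
    · rcases hle u hu with h | ⟨h, h'⟩
      · rw [ENNReal.ofReal_of_nonpos h]; exact zero_le
      · refine le_trans ?_ (ENNReal.le_tsum ⌊Real.exp u⌋₊)
        rw [Set.indicator_of_mem (Set.mem_Ico.2 ⟨(floor_exp_bounds hu).2.1, h'⟩)]
        exact ENNReal.ofReal_le_ofReal h
    · rw [ENNReal.ofReal_of_nonpos (hneg u (not_le.1 hu))]; exact zero_le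
  refine (MeasureTheory.lintegral_mono hpt).trans ?_
  rw [MeasureTheory.lintegral_tsum
    fun n => (measurable_const.indicator measurableSet_Ico).aemeasurable]
  refine ENNReal.tsum_le_of_sum_range_le fun X => ?_
  calc _ = ∑ n ∈ Finset.range X, ENNReal.ofReal (c n * w n) := by
        refine Finset.sum_congr rfl fun n _ => ?_
        rw [MeasureTheory.lintegral_indicator_const measurableSet_Ico, Real.volume_Ico,
          add_sub_cancel_left, ENNReal.ofReal_mul (hc n)]
    _ = ENNReal.ofReal (∑ n ∈ Finset.range X, c n * w n) :=
        (ENNReal.ofReal_sum_of_nonneg fun n _ => mul_nonneg (hc n) (hw n)).symm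
    _ ≤ _ := ENNReal.ofReal_le_ofReal (hS X)

lemma floor_exp_sub_bounds {u δ : ℝ} (hu : 0 ≤ u) (hδ : 0 < δ) (hδ1 : δ ≤ 1)
    (h16 : 16 ≤ δ * (⌊Real.exp u⌋₊ : ℝ)) :
    0 ≤ u - δ ∧ ⌊Real.exp (u - δ)⌋₊ ≤ ⌊Real.exp u⌋₊ ∧
      ⌊Real.exp u⌋₊ ≤ 4 * ⌊Real.exp (u - δ)⌋₊ ∧
      (⌊Real.exp u⌋₊ : ℝ) ≤ ⌊Real.exp (u - δ)⌋₊ + 2 * δ * ⌊Real.exp u⌋₊ := by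
  obtain ⟨h1, h2, h3, h4, h5⟩ := floor_exp_bounds hu
  have hn : (16:ℝ) ≤ ⌊Real.exp u⌋₊ := by nlinarith
  have hu1 : 0 ≤ u - δ := by
    have : (1:ℝ) ≤ u := by
      rw [← Real.exp_le_exp]
      linarith [Real.exp_one_lt_d9]
    linarith
  have h6 := Nat.lt_floor_add_one (Real.exp (u - δ))
  have h7 : Real.exp (u - δ) = Real.exp u * Real.exp (-δ) := by
    rw [← Real.exp_add, sub_eq_add_neg]
  have h8 : 1 - δ ≤ Real.exp (-δ) := by linarith [Real.add_one_le_exp (-δ)]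
  have h9 : (0.36:ℝ) ≤ Real.exp (-δ) := by
    have : Real.exp (-1) ≤ Real.exp (-δ) := Real.exp_le_exp.2 (by linarith)
    linarith [Real.exp_neg_one_gt_d9]
  rw [h7] at h6
  refine ⟨hu1, Nat.floor_mono (Real.exp_le_exp.2 (by linarith)), ?_, ?_⟩
  · rw [h7]
    have : ((⌊Real.exp u⌋₊ : ℕ) : ℝ) ≤ 4 * (⌊Real.exp u * Real.exp (-δ)⌋₊ : ℝ) := by
      nlinarith
    exact_mod_cast this
  · rw [h7]
    nlinarith

lemma rpow_neg_two_le {n : ℕ} {δ ε : ℝ} (hδ : 0 < δ) (hε1 : ε ≤ 1 / 3) (h : 1 ≤ δ * n) :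
    (n:ℝ) ^ (-2 + 2 * ε) ≤ δ ^ (1 - 3 * ε) * (n:ℝ) ^ (-1 - ε) := by
  have hn : (0:ℝ) < n := by
    by_contra hc
    nlinarith
  have h1 : (δ * n) ^ (-(1 - 3 * ε)) ≤ 1 := Real.rpow_le_one_of_one_le_of_nonpos h (by linarith)
  rw [Real.mul_rpow hδ.le hn.le, Real.rpow_neg hδ.le, ← div_eq_inv_mul,
    div_le_one (by positivity)] at h1
  rw [show -2 + 2 * ε = -(1 - 3 * ε) + (-1 - ε) by ring, Real.rpow_add hn]
  exact mul_le_mul_of_nonneg_right h1 (by positivity)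

lemma sq_mul_rpow_le {n : ℕ} {δ ε : ℝ} (hδ : 0 < δ) (hn : 1 ≤ n) (hε : 0 < ε) (hε1 : ε ≤ 1 / 3)
    (h : δ * n ≤ 16) :
    δ ^ 2 * (n:ℝ) ^ (2 * ε) ≤ 256 * (δ ^ (1 - 3 * ε) * (n:ℝ) ^ (-1 - ε)) := by
  have hn : (0:ℝ) < n := by exact_mod_cast hn
  have h1 : (δ * n) ^ (1 + 3 * ε) ≤ 256 :=
    calc _ ≤ (16:ℝ) ^ (1 + 3 * ε) := Real.rpow_le_rpow (by positivity) h (by linarith)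
      _ ≤ (16:ℝ) ^ (2:ℝ) := Real.rpow_le_rpow_of_exponent_le (by norm_num) (by linarith)
      _ = 256 := by norm_num
  rw [Real.mul_rpow hδ.le hn.le] at h1
  have e1 : δ ^ 2 = δ ^ (1 - 3 * ε) * δ ^ (1 + 3 * ε) := by
    rw [← Real.rpow_add hδ, ← Real.rpow_natCast]; congr 1; push_cast; ring
  have e2 : (n:ℝ) ^ (2 * ε) = (n:ℝ) ^ (1 + 3 * ε) * (n:ℝ) ^ (-1 - ε) := by
    rw [← Real.rpow_add hn]; congr 1; ring
  rw [e1, e2]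
  calc _ = (δ ^ (1 + 3 * ε) * (n:ℝ) ^ (1 + 3 * ε)) * (δ ^ (1 - 3 * ε) * (n:ℝ) ^ (-1 - ε)) := by ring
    _ ≤ _ := mul_le_mul_of_nonneg_right h1 (by positivity)

lemma rpow_neg_one_le {n : ℕ} {δ ε : ℝ} (hδ : 0 < δ) (hn : 1 ≤ n) (hε : 0 < ε) (hε1 : ε ≤ 1 / 3)
    (h : δ * n ≤ 16) :
    (n:ℝ) ^ (-1 + 2 * ε) ≤ 16 * (δ ^ (-(3 * ε)) * (n:ℝ) ^ (-1 - ε)) := by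
  have hn : (0:ℝ) < n := by exact_mod_cast hn
  have h1 : (δ * n) ^ (3 * ε) ≤ 16 :=
    calc _ ≤ (16:ℝ) ^ (3 * ε) := Real.rpow_le_rpow (by positivity) h (by linarith)
      _ ≤ (16:ℝ) ^ (1:ℝ) := Real.rpow_le_rpow_of_exponent_le (by norm_num) (by linarith)
      _ = 16 := by norm_num
  rw [Real.mul_rpow hδ.le hn.le] at h1
  rw [show -1 + 2 * ε = (3 * ε) + (-1 - ε) by ring, Real.rpow_add hn, ← mul_assoc,
    Real.rpow_neg hδ.le]
  refine mul_le_mul_of_nonneg_right ?_ (by positivity)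
  rw [← div_eq_mul_inv, le_div_iff₀ (by positivity)]
  linarith

/-- The increments of `A` on short intervals are essentially those of a harmonic sum. -/
def HarmonicIncr (A : ℕ → ℝ) : Prop :=
  ∀ ε : ℝ, 0 < ε → ∃ K : ℝ, 0 < K ∧ ∀ n' n : ℕ, 1 ≤ n → n' ≤ n →
    |A n - A n'| ≤ K * (n:ℝ) ^ ε * (((n:ℝ) - n') / (n' + 1))

lemma harmonicIncr_genSum (i j : ℕ) : HarmonicIncr (genSum i j) := by
  intro ε hε
  obtain ⟨K, hK, h⟩ := exists_dGen_le i j hε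
  refine ⟨K, hK, fun n' n hn hn' => ?_⟩
  have hsub : Finset.Icc 1 n' ⊆ Finset.Icc 1 n := Finset.Icc_subset_Icc_right hn'
  rw [genSum, genSum, ← Finset.sum_sdiff hsub, add_sub_cancel_right,
    abs_of_nonneg (Finset.sum_nonneg fun l _ => div_nonneg (dGen_nonneg _ _ _) (by positivity))]
  trans ∑ l ∈ Finset.Icc 1 n \ Finset.Icc 1 n', K * (n:ℝ) ^ ε / (n' + 1)
  · refine Finset.sum_le_sum fun l hl => ?_
    rw [Finset.mem_sdiff, Finset.mem_Icc, Finset.mem_Icc] at hl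
    have hl1 : 1 ≤ l := hl.1.1
    have hl2 : n' + 1 ≤ l := by omega
    have e1 : (l:ℝ) ^ ε ≤ (n:ℝ) ^ ε :=
      Real.rpow_le_rpow (by positivity) (by exact_mod_cast hl.1.2) hε.le
    exact div_le_div₀ (by positivity) ((h l hl1).trans (mul_le_mul_of_nonneg_left e1 hK.le))
      (by positivity) (by exact_mod_cast hl2)
  · rw [Finset.sum_const, Finset.card_sdiff_of_subset hsub, Nat.card_Icc, Nat.card_Icc,
      Nat.add_sub_cancel, Nat.add_sub_cancel, nsmul_eq_mul, Nat.cast_sub hn']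
    apply le_of_eq
    ring

lemma logErr_sub_le {A : ℕ → ℝ} {P : Polynomial ℝ} {u K ε : ℝ} (hu : 0 ≤ u)
    (h : |P.eval u - P.eval (Real.log ⌊Real.exp u⌋₊)| ≤ K * (⌊Real.exp u⌋₊ : ℝ) ^ (-1 + ε)) :
    |logErr A P u - (A ⌊Real.exp u⌋₊ - P.eval (Real.log ⌊Real.exp u⌋₊))|
      ≤ K * (⌊Real.exp u⌋₊ : ℝ) ^ (-1 + ε) := by
  rw [logErr, if_pos hu, abs_sub_comm]
  refine le_trans (le_of_eq ?_) h
  congr 1; ring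

lemma exists_logErr_sub_sq_le_large {A : ℕ → ℝ} {P : Polynomial ℝ}
    (hF : ShortVar (fun n => A n - P.eval (Real.log n))) {ε : ℝ} (hε : 0 < ε) (hε1 : ε ≤ 1 / 3) :
    ∃ K : ℝ, 0 < K ∧ ∀ δ : ℝ, 0 < δ → δ ≤ 1 → ∃ Ψ : ℕ → ℝ, (∀ n, 0 ≤ Ψ n) ∧
      (∀ X : ℕ, ∑ n ∈ Finset.range X, Ψ n ≤ K * δ ^ (1 - 3 * ε)) ∧
      ∀ u, 0 ≤ u → 16 ≤ δ * (⌊Real.exp u⌋₊ : ℝ) →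
        (logErr A P u - logErr A P (u - δ)) ^ 2
          ≤ Ψ ⌊Real.exp u⌋₊ + Ψ ⌊Real.exp (u - δ)⌋₊ := by
  obtain ⟨K, hK, h⟩ := hF ε hε
  obtain ⟨K1, hK1, h1⟩ := exists_eval_sub_eval_log_floor_le P hε
  obtain ⟨S, hS, hsum⟩ := exists_sum_rpow_le (p := -1 - ε) (by linarith)
  refine ⟨3 * K + 3 * K1 ^ 2 * S, by positivity, fun δ hδ hδ1 => ?_⟩
  obtain ⟨Ψ, hΨ0, hΨ1, hΨ2⟩ := h δ hδ hδ1
  refine ⟨fun n => 3 * Ψ n + 3 * K1 ^ 2 * (δ ^ (1 - 3 * ε) * (n:ℝ) ^ (-1 - ε)), fun n => ?_,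
    fun X => ?_, fun u hu h16 => ?_⟩
  · have := hΨ0 n
    positivity
  · rw [Finset.sum_add_distrib, ← Finset.mul_sum, ← Finset.mul_sum, ← Finset.mul_sum]
    have e1 : δ ^ (1 - ε) ≤ δ ^ (1 - 3 * ε) :=
      Real.rpow_le_rpow_of_exponent_ge hδ hδ1 (by linarith)
    have e2 := (hΨ1 X).trans (mul_le_mul_of_nonneg_left e1 hK.le)
    have e3 : 3 * K1 ^ 2 * (δ ^ (1 - 3 * ε) * ∑ n ∈ Finset.range X, (n:ℝ) ^ (-1 - ε))
        ≤ 3 * K1 ^ 2 * (δ ^ (1 - 3 * ε) * S) :=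
      mul_le_mul_of_nonneg_left (mul_le_mul_of_nonneg_left (hsum X) (by positivity))
        (by positivity)
    linarith
  · obtain ⟨hv, b1, b2, b3⟩ := floor_exp_sub_bounds hu hδ hδ1 h16
    have f1 := logErr_sub_le (A := A) hu (h1 u hu)
    have f2 := logErr_sub_le (A := A) hv (h1 _ hv)
    have f3 := hΨ2 _ _ b1 b2 h16 b3
    set n := ⌊Real.exp u⌋₊
    set n' := ⌊Real.exp (u - δ)⌋₊
    have hn1 : 1 ≤ δ * n := by linarith
    have hn1' : 1 ≤ δ * n' := by
      have : (n:ℝ) ≤ 4 * n' := by exact_mod_cast b2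
      nlinarith
    have key : ∀ m : ℕ, 1 ≤ δ * m → (K1 * (m:ℝ) ^ (-1 + ε)) ^ 2
        ≤ K1 ^ 2 * (δ ^ (1 - 3 * ε) * (m:ℝ) ^ (-1 - ε)) := by
      intro m hm
      have hm0 : (0:ℝ) ≤ m := Nat.cast_nonneg m
      rw [mul_pow, ← Real.rpow_natCast ((m:ℝ) ^ (-1 + ε)) 2, ← Real.rpow_mul hm0,
        show (-1 + ε) * ((2:ℕ):ℝ) = -2 + 2 * ε by push_cast; ring]
      exact mul_le_mul_of_nonneg_left (rpow_neg_two_le hδ hε1 hm) (by positivity)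
    have g1 := (sq_le_sq' (by linarith [(abs_le.1 f1).1]) (abs_le.1 f1).2).trans (key n hn1)
    have g2 := (sq_le_sq' (by linarith [(abs_le.1 f2).1]) (abs_le.1 f2).2).trans (key n' hn1')
    have tri : ∀ x y a b : ℝ, (x - y) ^ 2 ≤ 3 * ((a - b) ^ 2 + (x - a) ^ 2 + (y - b) ^ 2) := by
      intro x y a b
      nlinarith [sq_nonneg ((a - b) - (x - a)), sq_nonneg ((a - b) + (y - b)),
        sq_nonneg ((x - a) + (y - b))]
    have := tri (logErr A P u) (logErr A P (u - δ)) (A n - P.eval (Real.log n))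
      (A n' - P.eval (Real.log n'))
    beta_reduce at f3
    linarith

lemma exists_logErr_sub_sq_le_of_floor_eq (A : ℕ → ℝ) (P : Polynomial ℝ) {ε : ℝ} (hε : 0 < ε)
    (hε1 : ε ≤ 1 / 3) :
    ∃ K : ℝ, 0 < K ∧ ∀ δ : ℝ, 0 < δ → ∀ u, 0 ≤ u → δ * (⌊Real.exp u⌋₊ : ℝ) ≤ 16 →
      ⌊Real.exp (u - δ)⌋₊ = ⌊Real.exp u⌋₊ →
        (logErr A P u - logErr A P (u - δ)) ^ 2
          ≤ K * (δ ^ (1 - 3 * ε) * (⌊Real.exp u⌋₊ : ℝ) ^ (-1 - ε)) := by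
  obtain ⟨K, hK, h⟩ := exists_abs_eval_sub_le P hε
  refine ⟨K ^ 2 * (2 ^ (2 * ε) * 256), by positivity, fun δ hδ u hu h16 heq => ?_⟩
  obtain ⟨h1, h2, h3, h4, h5⟩ := floor_exp_bounds hu
  have hv : 0 ≤ u - δ := by
    rw [← Real.one_le_exp_iff]
    have : ((1:ℕ):ℝ) ≤ Real.exp (u - δ) := by
      rw [← Nat.le_floor_iff (Real.exp_pos _).le, heq]; exact h1
    simpa using this
  have e0 : logErr A P u - logErr A P (u - δ) = -(P.eval u - P.eval (u - δ)) := by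
    rw [logErr, logErr, if_pos hu, if_pos hv, heq]; ring
  have e1 := h (u - δ) u hv (by linarith)
  rw [sub_sub_cancel] at e1
  have e2 := sq_le_sq' (by linarith [(abs_le.1 e1).1]) (abs_le.1 e1).2
  set n := ⌊Real.exp u⌋₊
  have h1' : (1:ℝ) ≤ n := by exact_mod_cast h1
  have e3 : Real.exp (ε * u) ^ 2 ≤ 2 ^ (2 * ε) * (n:ℝ) ^ (2 * ε) := by
    rw [← Real.mul_rpow (by norm_num) (by positivity), ← Real.exp_nat_mul,
      show ((2:ℕ):ℝ) * (ε * u) = u * (2 * ε) by push_cast; ring, Real.exp_mul]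
    exact Real.rpow_le_rpow (Real.exp_pos _).le (by linarith) (by linarith)
  rw [e0, neg_sq]
  calc _ ≤ (K * Real.exp (ε * u) * δ) ^ 2 := e2
    _ = K ^ 2 * δ ^ 2 * Real.exp (ε * u) ^ 2 := by ring
    _ ≤ K ^ 2 * δ ^ 2 * (2 ^ (2 * ε) * (n:ℝ) ^ (2 * ε)) :=
        mul_le_mul_of_nonneg_left e3 (by positivity)
    _ = K ^ 2 * 2 ^ (2 * ε) * (δ ^ 2 * (n:ℝ) ^ (2 * ε)) := by ring
    _ ≤ K ^ 2 * 2 ^ (2 * ε) * (256 * (δ ^ (1 - 3 * ε) * (n:ℝ) ^ (-1 - ε))) :=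
        mul_le_mul_of_nonneg_left (sq_mul_rpow_le hδ h1 hε hε1 h16) (by positivity)
    _ = _ := by ring

lemma exists_abs_logErr_sub_le_small {A : ℕ → ℝ} {P : Polynomial ℝ} (hA : HarmonicIncr A)
    (hs : EpsBound (-(1:ℝ)/2) (fun n => A n - P.eval (Real.log n))) {ε : ℝ} (hε : 0 < ε) :
    ∃ K : ℝ, 0 < K ∧ ∀ δ : ℝ, 0 < δ → δ ≤ 1 → ∀ u, 0 ≤ u → δ * (⌊Real.exp u⌋₊ : ℝ) ≤ 16 →
      |logErr A P u - logErr A P (u - δ)| ≤ K * (⌊Real.exp u⌋₊ : ℝ) ^ (-1 + ε) := by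
  obtain ⟨K1, hK1, h1⟩ := hA ε hε
  obtain ⟨K2, hK2, h2⟩ := exists_abs_eval_sub_le P hε
  obtain ⟨K3, hK3, h3⟩ := exists_abs_logErr_le_floor hs hε
  refine ⟨K1 * 18 * 19 + K2 * 2 ^ ε * 16 + K3 * 2, by positivity, fun δ hδ hδ1 u hu h16 => ?_⟩
  obtain ⟨g1, g2, g3, g4, g5⟩ := floor_exp_bounds hu
  have g0 : (1:ℝ) ≤ ⌊Real.exp u⌋₊ := by exact_mod_cast g1
  by_cases hv : 0 ≤ u - δ
  · have e1 := h2 (u - δ) u hv (by linarith)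
    rw [sub_sub_cancel] at e1
    obtain ⟨k1, k2, k3, k4, k5⟩ := floor_exp_bounds hv
    have hle : ⌊Real.exp (u - δ)⌋₊ ≤ ⌊Real.exp u⌋₊ :=
      Nat.floor_mono (Real.exp_le_exp.2 (by linarith))
    have e2 := h1 _ _ g1 hle
    have e3 : Real.exp u * (1 - δ) ≤ Real.exp (u - δ) := by
      rw [sub_eq_add_neg u, Real.exp_add]
      exact mul_le_mul_of_nonneg_left (by linarith [Real.add_one_le_exp (-δ)]) (Real.exp_pos _).le
    rw [logErr, logErr, if_pos hu, if_pos hv]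
    set n := ⌊Real.exp u⌋₊
    set n' := ⌊Real.exp (u - δ)⌋₊
    have k0 : (1:ℝ) ≤ n' := by exact_mod_cast k1
    have d1 : (n:ℝ) - n' ≤ 18 := by nlinarith
    have e4 : ((n:ℝ) - n') / (n' + 1) ≤ 18 * 19 * (n:ℝ)⁻¹ := by
      rw [← div_eq_mul_inv]
      rw [div_le_div_iff₀ (by positivity) (by positivity)]
      have : ((n:ℝ) - n') * n ≤ 18 * n := mul_le_mul_of_nonneg_right d1 (by positivity)
      nlinarith
    have e5 : Real.exp (ε * u) ≤ 2 ^ ε * (n:ℝ) ^ ε := by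
      rw [← Real.mul_rpow (by norm_num) (by positivity), mul_comm ε u, Real.exp_mul]
      exact Real.rpow_le_rpow (Real.exp_pos _).le (by linarith) hε.le
    have e6 : δ ≤ 16 * (n:ℝ)⁻¹ := by
      rw [← div_eq_mul_inv, le_div_iff₀ (by positivity)]; exact h16
    have e7 : (n:ℝ) ^ (-1 + ε) = (n:ℝ) ^ ε * (n:ℝ)⁻¹ := by
      rw [add_comm, Real.rpow_add (by positivity), Real.rpow_neg_one]
    rw [e7]
    have t1 : |A n - A n'| ≤ K1 * (n:ℝ) ^ ε * (18 * 19 * (n:ℝ)⁻¹) :=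
      e2.trans (mul_le_mul_of_nonneg_left e4 (by positivity))
    have t2 : |P.eval u - P.eval (u - δ)| ≤ K2 * (2 ^ ε * (n:ℝ) ^ ε) * (16 * (n:ℝ)⁻¹) :=
      e1.trans (mul_le_mul (mul_le_mul_of_nonneg_left e5 hK2.le) e6 hδ.le (by positivity))
    have t3 : 0 ≤ K3 * 2 * ((n:ℝ) ^ ε * (n:ℝ)⁻¹) := by positivity
    calc _ = |(A n - A n') - (P.eval u - P.eval (u - δ))| := by congr 1; ring
      _ ≤ _ := abs_sub _ _
      _ ≤ _ := add_le_add t1 t2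
      _ ≤ _ := by linarith
  · rw [show logErr A P (u - δ) = 0 from if_neg hv, sub_zero]
    refine (h3 u hu).trans ?_
    have hn4 : (⌊Real.exp u⌋₊ : ℝ) ≤ 4 := by
      have : Real.exp u ≤ Real.exp 1 := Real.exp_le_exp.2 (by linarith [not_le.1 hv])
      linarith [Real.exp_one_lt_d9]
    set n := ⌊Real.exp u⌋₊
    have e1 : (n:ℝ) ^ (-(1:ℝ)/2 + ε) ≤ 2 * (n:ℝ) ^ (-1 + ε) := by
      rw [show -(1:ℝ)/2 + ε = 1/2 + (-1 + ε) by ring, Real.rpow_add (by positivity)]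
      refine mul_le_mul_of_nonneg_right ?_ (by positivity)
      rw [← Real.sqrt_eq_rpow]
      exact Real.sqrt_le_iff.2 ⟨by norm_num, by linarith⟩
    calc _ ≤ K3 * (2 * (n:ℝ) ^ (-1 + ε)) := mul_le_mul_of_nonneg_left e1 hK3.le
      _ = K3 * 2 * (n:ℝ) ^ (-1 + ε) := by ring
      _ ≤ _ := mul_le_mul_of_nonneg_right (by
          have : 0 < K1 * 18 * 19 + K2 * 2 ^ ε * 16 := by positivity
          linarith) (by positivity)

/-- Pointwise domination of the square of a difference of `logErr`. -/
lemma exists_logErr_sub_sq_mul_exp_le {A : ℕ → ℝ} {P : Polynomial ℝ} (hA : HarmonicIncr A)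
    (hs : EpsBound (-(1:ℝ)/2) (fun n => A n - P.eval (Real.log n)))
    (hF : ShortVar (fun n => A n - P.eval (Real.log n))) {ε : ℝ} (hε : 0 < ε) (hε1 : ε ≤ 1 / 3) :
    ∃ K : ℝ, 0 < K ∧ ∃ C : ℝ, 0 < C ∧ ∀ δ : ℝ, 0 < δ → δ ≤ 1 → ∃ Ψ : ℕ → ℝ, (∀ n, 0 ≤ Ψ n) ∧
      (∀ X : ℕ, ∑ n ∈ Finset.range X, Ψ n ≤ K * δ ^ (1 - 3 * ε)) ∧
      ∀ u, 0 ≤ u →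
        (logErr A P u - logErr A P (u - δ)) ^ 2 * Real.exp u
          ≤ Ψ ⌊Real.exp u⌋₊ * Real.exp u + (if 0 ≤ u - δ then
              Ψ ⌊Real.exp (u - δ)⌋₊ * Real.exp u else 0)
            + if u < Real.log ⌊Real.exp u⌋₊ + δ then
              C * (δ ^ (-(3 * ε)) * (⌊Real.exp u⌋₊ : ℝ) ^ (-1 - ε)) else 0 := by
  obtain ⟨K1, hK1, h1⟩ := exists_logErr_sub_sq_le_large hF hε hε1
  obtain ⟨K2, hK2, h2⟩ := exists_logErr_sub_sq_le_of_floor_eq A P hε hε1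
  obtain ⟨K3, hK3, h3⟩ := exists_abs_logErr_sub_le_small hA hs hε
  obtain ⟨S, hS, hsum⟩ := exists_sum_rpow_le (p := -1 - ε) (by linarith)
  refine ⟨K1 + K2 * S, by positivity, 2 * K3 ^ 2 * 16, by positivity, fun δ hδ hδ1 => ?_⟩
  obtain ⟨Ψ, hΨ0, hΨ1, hΨ2⟩ := h1 δ hδ hδ1
  have hnn : ∀ n : ℕ, 0 ≤ Ψ n + K2 * (δ ^ (1 - 3 * ε) * (n:ℝ) ^ (-1 - ε)) := fun n => by
    have := hΨ0 n
    positivity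
  refine ⟨fun n => Ψ n + K2 * (δ ^ (1 - 3 * ε) * (n:ℝ) ^ (-1 - ε)), hnn, fun X => ?_,
    fun u hu => ?_⟩
  · rw [Finset.sum_add_distrib, ← Finset.mul_sum, ← Finset.mul_sum]
    have e3 : K2 * (δ ^ (1 - 3 * ε) * ∑ n ∈ Finset.range X, (n:ℝ) ^ (-1 - ε))
        ≤ K2 * (δ ^ (1 - 3 * ε) * S) :=
      mul_le_mul_of_nonneg_left (mul_le_mul_of_nonneg_left (hsum X) (by positivity)) hK2.le
    linarith [hΨ1 X]
  · obtain ⟨g1, g2, g3, g4, g5⟩ := floor_exp_bounds hu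
    have g0 : (1:ℝ) ≤ ⌊Real.exp u⌋₊ := by exact_mod_cast g1
    have hE := Real.exp_pos u
    beta_reduce
    set n := ⌊Real.exp u⌋₊ with hn
    have p2 : 0 ≤ (if 0 ≤ u - δ then (Ψ ⌊Real.exp (u - δ)⌋₊ + K2 * (δ ^ (1 - 3 * ε) *
        (⌊Real.exp (u - δ)⌋₊ : ℝ) ^ (-1 - ε))) * Real.exp u else 0) := by
      split_ifs
      · exact mul_nonneg (hnn _) hE.le
      · exact le_rfl
    have p3 : 0 ≤ (if u < Real.log n + δ then
        2 * K3 ^ 2 * 16 * (δ ^ (-(3 * ε)) * (n : ℝ) ^ (-1 - ε)) else 0) := by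
      split_ifs
      · positivity
      · exact le_rfl
    have p1 : 0 ≤ (Ψ n + K2 * (δ ^ (1 - 3 * ε) * (n:ℝ) ^ (-1 - ε))) * Real.exp u :=
      mul_nonneg (hnn _) hE.le
    rcases le_total 16 (δ * n) with h16 | h16
    · have hv := (floor_exp_sub_bounds hu hδ hδ1 h16).1
      rw [if_pos hv] at p2 ⊢
      have := mul_le_mul_of_nonneg_right (hΨ2 u hu h16) hE.le
      have q1 : 0 ≤ K2 * (δ ^ (1 - 3 * ε) * (n:ℝ) ^ (-1 - ε)) * Real.exp u := by positivity
      have q2 : 0 ≤ K2 * (δ ^ (1 - 3 * ε) * (⌊Real.exp (u - δ)⌋₊:ℝ) ^ (-1 - ε)) * Real.exp u := by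
        positivity
      linarith
    · by_cases heq : ⌊Real.exp (u - δ)⌋₊ = n
      · have := mul_le_mul_of_nonneg_right (h2 δ hδ u hu h16 heq) hE.le
        have q1 := mul_nonneg (hΨ0 n) hE.le
        linarith
      · have hlt : ⌊Real.exp (u - δ)⌋₊ < n :=
          lt_of_le_of_ne (Nat.floor_mono (Real.exp_le_exp.2 (by linarith))) heq
        have hlt' : u < Real.log n + δ := by
          rw [Nat.floor_lt (Real.exp_pos _).le, ← Real.lt_log_iff_exp_lt (by linarith)] at hlt
          linarith
        rw [if_pos hlt'] at p3 ⊢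
        have e1 := h3 δ hδ hδ1 u hu h16
        have e2 := sq_le_sq' (by linarith [(abs_le.1 e1).1]) (abs_le.1 e1).2
        have e3 : (K3 * (n:ℝ) ^ (-1 + ε)) ^ 2 * (2 * n)
            = 2 * K3 ^ 2 * (n:ℝ) ^ (-1 + 2 * ε) := by
          have : (n:ℝ) ^ (-1 + 2 * ε) = (n:ℝ) ^ (-1 + ε) * (n:ℝ) ^ (-1 + ε) * n := by
            rw [← Real.rpow_add (by linarith), ← Real.rpow_add_one (by linarith)]
            congr 1; ring
          rw [this]
          ring
        have e4 : (logErr A P u - logErr A P (u - δ)) ^ 2 * Real.exp u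
            ≤ (K3 * (n:ℝ) ^ (-1 + ε)) ^ 2 * (2 * n) :=
          mul_le_mul e2 (by linarith) hE.le (by positivity)
        rw [e3] at e4
        have e5 := mul_le_mul_of_nonneg_left (rpow_neg_one_le hδ g1 hε hε1 h16)
          (show 0 ≤ 2 * K3 ^ 2 by positivity)
        linarith

lemma measurable_comp_floor_exp (Ψ : ℕ → ℝ) (δ : ℝ) :
    Measurable fun u : ℝ => Ψ ⌊Real.exp (u - δ)⌋₊ :=
  (measurable_from_nat (f := Ψ)).comp (Nat.measurable_floor.comp
    (Real.measurable_exp.comp (measurable_id.sub_const δ)))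

lemma meanSqShift_logErr {A : ℕ → ℝ} {P : Polynomial ℝ} (hA : HarmonicIncr A)
    (hs : EpsBound (-(1:ℝ)/2) (fun n => A n - P.eval (Real.log n)))
    (hF : ShortVar (fun n => A n - P.eval (Real.log n))) : MeanSqShift (logErr A P) := by
  intro ε₀ hε₀
  obtain ⟨ε, hε, hε1, hεε⟩ : ∃ ε : ℝ, 0 < ε ∧ ε ≤ 1 / 3 ∧ 3 * ε ≤ ε₀ :=
    ⟨min (ε₀ / 3) (1 / 3), by positivity, min_le_right _ _, by
      linarith [min_le_left (ε₀ / 3) (1 / 3)]⟩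
  obtain ⟨K, hK, C, hC, h⟩ := exists_logErr_sub_sq_mul_exp_le hA hs hF hε hε1
  obtain ⟨S, hS, hsum⟩ := exists_sum_rpow_le (p := -1 - ε) (by linarith)
  refine ⟨2 * K + 3 * (2 * K) + C * S, by positivity, fun δ hδ hδ1 => ?_⟩
  obtain ⟨Ψ, hΨ0, hΨ1, hΨ2⟩ := h δ hδ hδ1
  set f1 : ℝ → ℝ := fun u => if 0 ≤ u then Ψ ⌊Real.exp u⌋₊ * Real.exp u else 0 with hf1
  set f3 : ℝ → ℝ := fun u => if 0 ≤ u then if u < Real.log ⌊Real.exp u⌋₊ + δ then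
      C * (δ ^ (-(3 * ε)) * (⌊Real.exp u⌋₊ : ℝ) ^ (-1 - ε)) else 0 else 0 with hf3
  have m1 : Measurable f1 := by
    refine Measurable.ite measurableSet_Ici ?_ measurable_const
    have := measurable_comp_floor_exp Ψ 0
    simp only [sub_zero] at this
    exact this.mul Real.measurable_exp
  have I1 : ∫⁻ u, ENNReal.ofReal (f1 u) ≤ ENNReal.ofReal (2 * (K * δ ^ (1 - 3 * ε))) := by
    refine lintegral_le_of_cells (c := fun n => Ψ n * (n + 1)) (w := fun n => 1 / (n:ℝ))
      (fun n => mul_nonneg (hΨ0 n) (by positivity)) (fun n => by positivity)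
      (fun u hu => by rw [hf1]; beta_reduce; rw [if_neg (not_le.2 hu)])
      (fun u hu => Or.inr ?_) fun X => ?_
    · obtain ⟨g1, g2, g3, g4, g5⟩ := floor_exp_bounds hu
      refine ⟨?_, g3⟩
      rw [hf1]; beta_reduce; rw [if_pos hu]
      exact mul_le_mul_of_nonneg_left g5.le (hΨ0 _)
    · refine le_trans ?_ (mul_le_mul_of_nonneg_left (hΨ1 X) (by norm_num))
      rw [Finset.mul_sum]
      refine Finset.sum_le_sum fun n _ => ?_
      rcases Nat.eq_zero_or_pos n with rfl | hn
      · have := hΨ0 0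
        simpa using this
      · have hn' : (1:ℝ) ≤ n := by exact_mod_cast hn
        have : ((n:ℝ) + 1) * (1 / n) ≤ 2 := by
          rw [mul_one_div, div_le_iff₀ (by linarith)]; linarith
        have := mul_le_mul_of_nonneg_left this (hΨ0 n)
        linarith
  have I3 : ∫⁻ u, ENNReal.ofReal (f3 u) ≤ ENNReal.ofReal (C * S * δ ^ (1 - 3 * ε)) := by
    refine lintegral_le_of_cells (c := fun n => C * (δ ^ (-(3 * ε)) * (n : ℝ) ^ (-1 - ε)))
      (w := fun _ => δ) (fun n => by positivity) (fun n => hδ.le)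
      (fun u hu => by rw [hf3]; beta_reduce; rw [if_neg (not_le.2 hu)])
      (fun u hu => ?_) fun X => ?_
    · rw [hf3]; beta_reduce; rw [if_pos hu]
      by_cases hc : u < Real.log ⌊Real.exp u⌋₊ + δ
      · right; rw [if_pos hc]; exact ⟨le_rfl, hc⟩
      · left; rw [if_neg hc]
    · have e : δ ^ (1 - 3 * ε) = δ ^ (-(3 * ε)) * δ := by
        rw [← Real.rpow_add_one hδ.ne']; congr 1; ring
      rw [e, ← Finset.sum_mul, ← Finset.mul_sum, ← Finset.mul_sum]
      calc _ ≤ C * (δ ^ (-(3 * ε)) * S) * δ := mul_le_mul_of_nonneg_right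
            (mul_le_mul_of_nonneg_left (mul_le_mul_of_nonneg_left (hsum X) (by positivity)) hC.le)
            hδ.le
        _ = _ := by ring
  have I2 : ∫⁻ u, ENNReal.ofReal (3 * f1 (u - δ))
      ≤ ENNReal.ofReal (3 * (2 * (K * δ ^ (1 - 3 * ε)))) := by
    rw [MeasureTheory.lintegral_sub_right_eq_self (fun u => ENNReal.ofReal (3 * f1 u)) δ]
    simp only [ENNReal.ofReal_mul (show (0:ℝ) ≤ 3 by norm_num)]
    rw [MeasureTheory.lintegral_const_mul _ m1.ennreal_ofReal]
    exact mul_le_mul_right I1 _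
  have m2 : Measurable fun u => ENNReal.ofReal (3 * f1 (u - δ)) :=
    ((m1.comp (measurable_id.sub_const δ)).const_mul 3).ennreal_ofReal
  have hpt : ∀ u, ENNReal.ofReal ((logErr A P u - logErr A P (u - δ)) ^ 2 * Real.exp u)
      ≤ ENNReal.ofReal (f1 u) + (ENNReal.ofReal (3 * f1 (u - δ)) + ENNReal.ofReal (f3 u)) := by
    intro u
    refine (ENNReal.ofReal_le_ofReal ?_).trans (ENNReal.ofReal_add_le.trans
      (add_le_add le_rfl ENNReal.ofReal_add_le) :
        ENNReal.ofReal (f1 u + (3 * f1 (u - δ) + f3 u)) ≤ _)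
    by_cases hu : 0 ≤ u
    · refine (hΨ2 u hu).trans ?_
      rw [hf1, hf3]
      beta_reduce
      rw [if_pos hu, if_pos hu, add_assoc]
      refine add_le_add le_rfl (add_le_add ?_ le_rfl)
      split_ifs with hv
      · have e : Real.exp u ≤ 3 * Real.exp (u - δ) := by
          have e1 : Real.exp u = Real.exp δ * Real.exp (u - δ) := by
            rw [← Real.exp_add]; congr 1; ring
          have e2 : Real.exp δ ≤ 3 := by
            have : Real.exp δ ≤ Real.exp 1 := Real.exp_le_exp.2 hδ1
            linarith [Real.exp_one_lt_d9]
          rw [e1]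
          exact mul_le_mul_of_nonneg_right e2 (Real.exp_pos _).le
        have := mul_le_mul_of_nonneg_left e (hΨ0 ⌊Real.exp (u - δ)⌋₊)
        linarith
      · simp
    · have hu' : ¬ 0 ≤ u - δ := fun h => hu (by linarith)
      rw [hf1, hf3]
      beta_reduce
      rw [if_neg hu, if_neg hu, if_neg hu', logErr, logErr, if_neg hu, if_neg hu']
      simp
  have e1 : δ ^ (1 - 3 * ε) ≤ δ ^ (1 - ε₀) :=
    Real.rpow_le_rpow_of_exponent_ge hδ hδ1 (by linarith)
  calc _ ≤ _ := MeasureTheory.lintegral_mono hpt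
    _ = _ := by
      rw [MeasureTheory.lintegral_add_left m1.ennreal_ofReal, MeasureTheory.lintegral_add_left m2]
    _ ≤ ENNReal.ofReal (2 * (K * δ ^ (1 - 3 * ε))) +
        (ENNReal.ofReal (3 * (2 * (K * δ ^ (1 - 3 * ε)))) +
          ENNReal.ofReal (C * S * δ ^ (1 - 3 * ε))) := add_le_add I1 (add_le_add I2 I3)
    _ = ENNReal.ofReal ((2 * K + 3 * (2 * K) + C * S) * δ ^ (1 - 3 * ε)) := by
        rw [← ENNReal.ofReal_add (by positivity) (by positivity),
          ← ENNReal.ofReal_add (by positivity) (by positivity)]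
        congr 1; ring
    _ ≤ _ := ENNReal.ofReal_le_ofReal (mul_le_mul_of_nonneg_left e1 (by positivity))

/-- Measurable functions supported on `[0, ∞)` and bounded on bounded sets. -/
structure Causal (f : ℝ → ℝ) : Prop where
  measurable : Measurable f
  eq_zero : ∀ u, u < 0 → f u = 0
  bounded : ∀ M : ℝ, ∃ C : ℝ, 0 ≤ C ∧ ∀ u, u ≤ M → |f u| ≤ C

/-- Convolution on the line. -/
noncomputable def conv (f g : ℝ → ℝ) (L : ℝ) : ℝ := ∫ s, f (L - s) * g s

namespace Causal

variable {f g k : ℝ → ℝ}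

lemma add (hf : Causal f) (hg : Causal g) : Causal (fun u => f u + g u) where
  measurable := hf.measurable.add hg.measurable
  eq_zero u hu := by rw [hf.eq_zero u hu, hg.eq_zero u hu, add_zero]
  bounded M := by
    obtain ⟨C, hC, h⟩ := hf.bounded M
    obtain ⟨C', hC', h'⟩ := hg.bounded M
    exact ⟨C + C', add_nonneg hC hC', fun u hu =>
      (abs_add_le _ _).trans (add_le_add (h u hu) (h' u hu))⟩

lemma sub (hf : Causal f) (hg : Causal g) : Causal (fun u => f u - g u) where
  measurable := hf.measurable.sub hg.measurable
  eq_zero u hu := by rw [hf.eq_zero u hu, hg.eq_zero u hu, sub_zero]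
  bounded M := by
    obtain ⟨C, hC, h⟩ := hf.bounded M
    obtain ⟨C', hC', h'⟩ := hg.bounded M
    exact ⟨C + C', add_nonneg hC hC', fun u hu =>
      (abs_sub _ _).trans (add_le_add (h u hu) (h' u hu))⟩

lemma shift (hf : Causal f) {h : ℝ} (hh : 0 ≤ h) : Causal (fun u => f (u - h)) where
  measurable := hf.measurable.comp (measurable_id.sub_const h)
  eq_zero u hu := hf.eq_zero _ (by linarith)
  bounded M := by
    obtain ⟨C, hC, h'⟩ := hf.bounded M
    exact ⟨C, hC, fun u hu => h' _ (by linarith)⟩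

lemma integrable_conv (hf : Causal f) (hg : Causal g) (L : ℝ) :
    MeasureTheory.Integrable (fun s => f (L - s) * g s) := by
  obtain ⟨C, hC, h⟩ := hf.bounded L
  obtain ⟨C', hC', h'⟩ := hg.bounded L
  have hm : Measurable (fun s => f (L - s) * g s) :=
    (hf.measurable.comp (measurable_id.const_sub L)).mul hg.measurable
  have hon : MeasureTheory.IntegrableOn (fun s => f (L - s) * g s) (Set.Icc 0 L) := by
    refine MeasureTheory.Measure.integrableOn_of_bounded (M := C * C')
      isCompact_Icc.measure_lt_top.ne hm.aestronglyMeasurable ?_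
    refine (MeasureTheory.ae_restrict_iff' measurableSet_Icc).2 (Filter.Eventually.of_forall ?_)
    intro s hs
    rw [norm_mul]
    exact mul_le_mul (h _ (by linarith [hs.1])) (h' _ hs.2) (norm_nonneg _) hC
  refine hon.integrable_of_forall_notMem_eq_zero fun s hs => ?_
  rw [Set.mem_Icc, not_and_or, not_le, not_le] at hs
  rcases hs with hs | hs
  · rw [hg.eq_zero s hs, mul_zero]
  · rw [hf.eq_zero _ (by linarith), zero_mul]

lemma conv_eq_intervalIntegral (hf : Causal f) (hg : Causal g) {L : ℝ} (hL : 0 ≤ L) :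
    conv f g L = ∫ s in (0:ℝ)..L, f (L - s) * g s := by
  rw [conv, intervalIntegral.integral_of_le hL, ← MeasureTheory.integral_Icc_eq_integral_Ioc,
    MeasureTheory.setIntegral_eq_integral_of_forall_compl_eq_zero]
  intro s hs
  rw [Set.mem_Icc, not_and_or, not_le, not_le] at hs
  rcases hs with hs | hs
  · rw [hg.eq_zero s hs, mul_zero]
  · rw [hf.eq_zero _ (by linarith), zero_mul]

lemma conv_add_left (hf : Causal f) (hg : Causal g) (hk : Causal k) (L : ℝ) :
    conv (fun u => f u + g u) k L = conv f k L + conv g k L := by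
  rw [conv, conv, conv, ← MeasureTheory.integral_add (hf.integrable_conv hk L)
    (hg.integrable_conv hk L)]
  exact MeasureTheory.integral_congr_ae (Filter.Eventually.of_forall fun s => by
    simp only []; ring)

lemma conv_sub_left (hf : Causal f) (hg : Causal g) (hk : Causal k) (L : ℝ) :
    conv (fun u => f u - g u) k L = conv f k L - conv g k L := by
  rw [conv, conv, conv, ← MeasureTheory.integral_sub (hf.integrable_conv hk L)
    (hg.integrable_conv hk L)]
  exact MeasureTheory.integral_congr_ae (Filter.Eventually.of_forall fun s => by
    simp only []; ring)

end Causal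

lemma conv_comm (f g : ℝ → ℝ) (L : ℝ) : conv f g L = conv g f L := by
  rw [conv, conv, ← MeasureTheory.integral_sub_left_eq_self _ MeasureTheory.volume L]
  exact MeasureTheory.integral_congr_ae (Filter.Eventually.of_forall fun s => by
    simp only [sub_sub_cancel]; ring)

lemma conv_shift_left (f g : ℝ → ℝ) (h L : ℝ) : conv (fun u => f (u - h)) g L = conv f g (L - h) := by
  rw [conv, conv]
  exact MeasureTheory.integral_congr_ae (Filter.Eventually.of_forall fun s => by
    simp only []; rw [sub_right_comm])

lemma conv_shift_right (f g : ℝ → ℝ) (h L : ℝ) :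
    conv f (fun u => g (u - h)) L = conv f g (L - h) := by
  rw [conv_comm, conv_shift_left, conv_comm]

namespace Causal

variable {f g k : ℝ → ℝ}

lemma conv_add_right (hf : Causal f) (hg : Causal g) (hk : Causal k) (L : ℝ) :
    conv f (fun u => g u + k u) L = conv f g L + conv f k L := by
  rw [conv_comm, conv_add_left hg hk hf, conv_comm g, conv_comm k]

lemma conv_sub_right (hf : Causal f) (hg : Causal g) (hk : Causal k) (L : ℝ) :
    conv f (fun u => g u - k u) L = conv f g L - conv f k L := by
  rw [conv_comm, conv_sub_left hg hk hf, conv_comm g, conv_comm k]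

/-- Second differences of a convolution are convolutions of first differences. -/
lemma conv_second_difference (hf : Causal f) (hg : Causal g) {h : ℝ} (hh : 0 ≤ h) (L : ℝ) :
    conv (fun u => f u - f (u - h)) (fun u => g u - g (u - h)) (L + 2 * h)
      = conv f g (L + 2 * h) - 2 * conv f g (L + h) + conv f g L := by
  rw [conv_sub_left hf (hf.shift hh) (hg.sub (hg.shift hh)), conv_sub_right hf hg (hg.shift hh),
    conv_sub_right (hf.shift hh) hg (hg.shift hh), conv_shift_right, conv_shift_left,
    conv_shift_right, conv_shift_left, show L + 2 * h - h = L + h by ring,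
    show L + h - h = L by ring]
  ring

end Causal

/-- A polynomial truncated to the positive half line. -/
noncomputable def polyPos (P : Polynomial ℝ) (u : ℝ) : ℝ := if 0 ≤ u then P.eval u else 0

/-- The summatory step function in the variable `u = log x`. -/
noncomputable def stepFn (A : ℕ → ℝ) (u : ℝ) : ℝ := if 0 ≤ u then A ⌊Real.exp u⌋₊ else 0

lemma causal_polyPos (P : Polynomial ℝ) : Causal (polyPos P) where
  measurable := Measurable.ite measurableSet_Ici P.continuous.measurable measurable_const
  eq_zero u hu := if_neg (not_le.2 hu)
  bounded M := by
    obtain ⟨K, hK, h⟩ := exists_abs_eval_le_exp P one_pos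
    refine ⟨K * Real.exp M, by positivity, fun u hu => ?_⟩
    rw [polyPos]
    split_ifs with h0
    · refine (h u h0).trans (mul_le_mul_of_nonneg_left (Real.exp_le_exp.2 (by linarith)) hK.le)
    · rw [abs_zero]; positivity

lemma causal_stepFn (A : ℕ → ℝ) : Causal (stepFn A) where
  measurable := by
    refine Measurable.ite measurableSet_Ici ?_ measurable_const
    have := measurable_comp_floor_exp A 0
    simpa only [sub_zero] using this
  eq_zero u hu := if_neg (not_le.2 hu)
  bounded M := by
    refine ⟨∑ n ∈ Finset.range (⌊Real.exp M⌋₊ + 1), |A n|,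
      Finset.sum_nonneg fun _ _ => abs_nonneg _, fun u hu => ?_⟩
    rw [stepFn]
    split_ifs with h0
    · refine Finset.single_le_sum (f := fun n => |A n|) (fun _ _ => abs_nonneg _)
        (Finset.mem_range.2 (Nat.lt_succ_of_le (Nat.floor_mono (Real.exp_le_exp.2 hu))))
    · rw [abs_zero]; exact Finset.sum_nonneg fun _ _ => abs_nonneg _

lemma logErr_eq (A : ℕ → ℝ) (P : Polynomial ℝ) :
    logErr A P = fun u => stepFn A u - polyPos P u := by
  funext u
  rw [logErr, stepFn, polyPos]
  split_ifs <;> simp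

lemma causal_logErr (A : ℕ → ℝ) (P : Polynomial ℝ) : Causal (logErr A P) := by
  rw [logErr_eq]
  exact (causal_stepFn A).sub (causal_polyPos P)

lemma conv_stepFn (A B : ℕ → ℝ) (P Q : Polynomial ℝ) (L : ℝ) :
    conv (stepFn A) (stepFn B) L = conv (polyPos P) (polyPos Q) L
      + conv (logErr A P) (polyPos Q) L + conv (logErr B Q) (polyPos P) L
      + conv (logErr A P) (logErr B Q) L := by
  have hA : stepFn A = fun u => polyPos P u + logErr A P u := by
    rw [logErr_eq]; funext u; ring
  have hB : stepFn B = fun u => polyPos Q u + logErr B Q u := by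
    rw [logErr_eq]; funext u; ring
  have c1 := causal_polyPos P
  have c2 := causal_polyPos Q
  have c3 := causal_logErr A P
  have c4 := causal_logErr B Q
  rw [hA, hB, c1.conv_add_left c3 (c2.add c4), c1.conv_add_right c2 c4, c3.conv_add_right c2 c4,
    conv_comm (polyPos P) (logErr B Q)]
  ring

lemma integral_sub_pow_mul_pow (p q : ℕ) (L : ℝ) :
    ∫ s in (0:ℝ)..L, (L - s) ^ p * s ^ q
      = (p.factorial : ℝ) * q.factorial / (p + q + 1).factorial * L ^ (p + q + 1) := by
  induction p generalizing q with
  | zero =>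
    simp only [pow_zero, one_mul, integral_pow, zero_add, Nat.factorial_succ, Nat.factorial_zero]
    have : (q.factorial : ℝ) ≠ 0 := by exact_mod_cast q.factorial_ne_zero
    push_cast
    field_simp
    simp
  | succ p ih =>
    have hu : ∀ x ∈ Set.uIcc 0 L, HasDerivAt (fun s : ℝ => (L - s) ^ (p + 1))
        (-((p + 1 : ℕ) * (L - x) ^ p)) x := fun x _ =>
      (((hasDerivAt_id x).const_sub L).fun_pow (p + 1)).congr_deriv (by simp)
    have hv : ∀ x ∈ Set.uIcc 0 L, HasDerivAt (fun s : ℝ => s ^ (q + 1) / ((q + 1 : ℕ) : ℝ))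
        (x ^ q) x := fun x _ =>
      ((hasDerivAt_pow (q + 1) x).div_const _).congr_deriv (by
        rw [Nat.add_sub_cancel]; field_simp)
    have := intervalIntegral.integral_mul_deriv_eq_deriv_mul hu hv
      (Continuous.intervalIntegrable (by fun_prop) _ _)
      (Continuous.intervalIntegrable (by fun_prop) _ _)
    rw [this]
    have e : ∀ x : ℝ, -((p + 1 : ℕ) * (L - x) ^ p) * (x ^ (q + 1) / ((q + 1 : ℕ) : ℝ))
        = -(((p + 1 : ℕ) : ℝ) / ((q + 1 : ℕ) : ℝ)) * ((L - x) ^ p * x ^ (q + 1)) := fun x => by ring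
    simp only [e]
    rw [intervalIntegral.integral_const_mul, ih (q + 1)]
    rw [show p + (q + 1) + 1 = p + 1 + q + 1 by ring, Nat.factorial_succ q, Nat.factorial_succ p]
    have : ((q + 1 : ℕ) : ℝ) ≠ 0 := by positivity
    simp
    field_simp

/-- `P` has degree at most `D` and `c` is its coefficient there. -/
def LeadAt (P : Polynomial ℝ) (D : ℕ) (c : ℝ) : Prop := P.natDegree ≤ D ∧ P.coeff D = c

lemma LeadAt.add {P Q : Polynomial ℝ} {D : ℕ} {c d : ℝ} (hP : LeadAt P D c) (hQ : LeadAt Q D d) :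
    LeadAt (P + Q) D (c + d) :=
  ⟨Polynomial.natDegree_add_le_of_degree_le hP.1 hQ.1, by
    rw [Polynomial.coeff_add, hP.2, hQ.2]⟩

lemma LeadAt.of_natDegree_lt {P : Polynomial ℝ} {D : ℕ} (h : P.natDegree < D) : LeadAt P D 0 :=
  ⟨h.le, Polynomial.coeff_eq_zero_of_natDegree_lt h⟩

lemma LeadAt.derivative {P : Polynomial ℝ} {D : ℕ} {c : ℝ} (h : LeadAt P (D + 1) c) :
    LeadAt P.derivative D (c * (D + 1)) :=
  ⟨(Polynomial.natDegree_derivative_le P).trans (by have := h.1; omega), by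
    rw [Polynomial.coeff_derivative, h.2]⟩

lemma exists_conv_polyPos {P Q : Polynomial ℝ} {p q : ℕ} {c d : ℝ} (hP : LeadAt P p c)
    (hQ : LeadAt Q q d) : ∃ R : Polynomial ℝ,
      LeadAt R (p + q + 1) (c * d * ((p.factorial : ℝ) * q.factorial / (p + q + 1).factorial)) ∧
      ∀ L, 0 ≤ L → conv (polyPos P) (polyPos Q) L = R.eval L := by
  refine ⟨∑ i ∈ Finset.range (p + 1), ∑ j ∈ Finset.range (q + 1), Polynomial.monomial (i + j + 1)
    (P.coeff i * Q.coeff j * ((i.factorial : ℝ) * j.factorial / (i + j + 1).factorial)),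
    ⟨?_, ?_⟩, fun L hL => ?_⟩
  · refine Polynomial.natDegree_sum_le_of_forall_le _ _ fun i hi =>
      Polynomial.natDegree_sum_le_of_forall_le _ _ fun j hj =>
        (Polynomial.natDegree_monomial_le _).trans ?_
    rw [Finset.mem_range] at hi hj
    omega
  · simp only [Polynomial.finsetSum_coeff, Polynomial.coeff_monomial]
    rw [Finset.sum_eq_single p, Finset.sum_eq_single q]
    · rw [if_pos rfl, hP.2, hQ.2]
    · intro j hj hjq
      rw [if_neg (by omega)]
    · intro h; simp at h
    · intro i hi hip
      refine Finset.sum_eq_zero fun j hj => ?_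
      rw [Finset.mem_range] at hi hj
      rw [if_neg (by omega)]
    · intro h; simp at h
  · rw [(causal_polyPos P).conv_eq_intervalIntegral (causal_polyPos Q) hL]
    have e : ∫ s in (0:ℝ)..L, polyPos P (L - s) * polyPos Q s
        = ∫ s in (0:ℝ)..L, ∑ i ∈ Finset.range (p + 1), ∑ j ∈ Finset.range (q + 1),
          P.coeff i * Q.coeff j * ((L - s) ^ i * s ^ j) := by
      refine intervalIntegral.integral_congr fun s hs => ?_
      rw [Set.uIcc_of_le hL] at hs
      rw [polyPos, polyPos, if_pos (by linarith [hs.2]), if_pos hs.1,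
        Polynomial.eval_eq_sum_range' (Nat.lt_succ_of_le hP.1),
        Polynomial.eval_eq_sum_range' (Nat.lt_succ_of_le hQ.1), Finset.sum_mul_sum]
      exact Finset.sum_congr rfl fun i _ => Finset.sum_congr rfl fun j _ => by ring
    rw [e, intervalIntegral.integral_finsetSum fun i _ =>
      Continuous.intervalIntegrable (by fun_prop) _ _, Polynomial.eval_finsetSum]
    refine Finset.sum_congr rfl fun i _ => ?_
    rw [intervalIntegral.integral_finsetSum fun i _ =>
      Continuous.intervalIntegrable (by fun_prop) _ _, Polynomial.eval_finsetSum]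
    refine Finset.sum_congr rfl fun j _ => ?_
    rw [intervalIntegral.integral_const_mul, integral_sub_pow_mul_pow, Polynomial.eval_monomial]
    ring

lemma integrable_mul_eval {a : ℝ → ℝ} (ha : Causal a) (hs : SqrtSmall a) (P : Polynomial ℝ) :
    MeasureTheory.Integrable (fun s => a s * P.eval s) := by
  obtain ⟨K, hK, h⟩ := hs (1 / 8) (by norm_num)
  obtain ⟨K', hK', h'⟩ := exists_abs_eval_le_exp P (ε := 1 / 8) (by norm_num)
  have hm : Measurable (fun s => a s * P.eval s) := ha.measurable.mul P.continuous.measurable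
  have hon : MeasureTheory.IntegrableOn (fun s => a s * P.eval s) (Set.Ioi (-1)) := by
    refine ((integrableOn_exp_mul_Ioi (a := -(1/4)) (by norm_num) (-1)).const_mul
      (K * K')).mono' hm.aestronglyMeasurable ?_
    refine Filter.Eventually.of_forall fun s => ?_
    by_cases h0 : 0 ≤ s
    · rw [norm_mul, Real.norm_eq_abs, Real.norm_eq_abs]
      calc _ ≤ (K * Real.exp ((-(1:ℝ)/2 + 1 / 8) * s)) * (K' * Real.exp (1 / 8 * s)) :=
            mul_le_mul (h s h0) (h' s h0) (abs_nonneg _) (by positivity)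
        _ = K * K' * (Real.exp ((-(1:ℝ)/2 + 1 / 8) * s) * Real.exp (1 / 8 * s)) := by ring
        _ = _ := by rw [← Real.exp_add]; congr 2; ring
    · rw [ha.eq_zero s (not_le.1 h0), zero_mul, norm_zero]; positivity
  refine hon.integrable_of_forall_notMem_eq_zero fun s hs => ?_
  rw [Set.mem_Ioi, not_lt] at hs
  rw [ha.eq_zero s (by linarith), zero_mul]

lemma exists_integral_mul_eval_sub {a : ℝ → ℝ} (ha : Causal a) (hs : SqrtSmall a)
    (Q : Polynomial ℝ) {q : ℕ} (hq : Q.natDegree ≤ q) : ∃ R : Polynomial ℝ, R.natDegree ≤ q ∧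
      ∀ L, ∫ s, a s * Q.eval (L - s) = R.eval L := by
  refine ⟨∑ i ∈ Finset.range (q + 1), Polynomial.monomial i
    (∫ s, a s * ((Polynomial.hasseDeriv i Q).comp (-Polynomial.X)).eval s), ?_, fun L => ?_⟩
  · refine Polynomial.natDegree_sum_le_of_forall_le _ _ fun i hi =>
      (Polynomial.natDegree_monomial_le _).trans ?_
    rw [Finset.mem_range] at hi
    omega
  · have e : ∀ s, a s * Q.eval (L - s) = ∑ i ∈ Finset.range (q + 1),
        a s * ((Polynomial.hasseDeriv i Q).comp (-Polynomial.X)).eval s * L ^ i := by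
      intro s
      rw [sub_eq_add_neg, ← Polynomial.taylor_eval, Polynomial.eval_eq_sum_range'
        (n := q + 1) (by rw [Polynomial.natDegree_taylor]; omega), Finset.mul_sum]
      refine Finset.sum_congr rfl fun i _ => ?_
      rw [Polynomial.taylor_coeff, Polynomial.eval_comp, Polynomial.eval_neg, Polynomial.eval_X]
      ring
    simp only [e]
    rw [MeasureTheory.integral_finsetSum _ fun i _ => (integrable_mul_eval ha hs _).mul_const _,
      Polynomial.eval_finsetSum]
    refine Finset.sum_congr rfl fun i _ => ?_
    rw [MeasureTheory.integral_mul_const, Polynomial.eval_monomial]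

lemma exists_abs_polyPos_sub_diff_le (Q : Polynomial ℝ) {ε : ℝ} (hε : 0 < ε) :
    ∃ K : ℝ, 0 < K ∧ ∀ η x : ℝ, 0 < η → η ≤ 1 →
      |(polyPos Q (x + η) - Q.eval (x + η)) - (polyPos Q x - Q.eval x)|
        ≤ if 0 ≤ x then 0 else K * Real.exp (ε * -x) * ((if -η ≤ x then 1 else 0) + η) := by
  obtain ⟨K, hK, h⟩ := exists_abs_eval_le_exp (Q.comp (-Polynomial.X)) hε
  obtain ⟨K', hK', h'⟩ := exists_abs_eval_sub_le (Q.comp (-Polynomial.X)) hε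
  refine ⟨K + K', by positivity, fun η x hη hη1 => ?_⟩
  have hq : ∀ y, Q.eval y = (Q.comp (-Polynomial.X)).eval (-y) := fun y => by
    rw [Polynomial.eval_comp, Polynomial.eval_neg, Polynomial.eval_X, neg_neg]
  split_ifs with hx hx'
  · rw [polyPos, polyPos, if_pos hx, if_pos (by linarith)]; simp
  · rw [polyPos, polyPos, if_neg hx, if_pos (by linarith)]
    have h1 := h (-x) (by linarith)
    rw [← hq] at h1
    have : Q.eval (x + η) - Q.eval (x + η) - (0 - Q.eval x) = Q.eval x := by ring
    rw [this]
    refine h1.trans ?_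
    rw [mul_assoc]
    have : 0 < Real.exp (ε * -x) := Real.exp_pos _
    nlinarith [mul_pos hK this, mul_pos hK' this, mul_pos (mul_pos hK this) hη,
      mul_pos (mul_pos hK' this) hη]
  · rw [polyPos, polyPos, if_neg hx, if_neg (by linarith)]
    have h1 := h' (-(x + η)) (-x) (by linarith) (by linarith)
    rw [← hq, ← hq] at h1
    have : 0 - Q.eval (x + η) - (0 - Q.eval x) = Q.eval x - Q.eval (x + η) := by ring
    rw [this]
    refine h1.trans ?_
    have : 0 < Real.exp (ε * -x) := Real.exp_pos _
    nlinarith [mul_pos (mul_pos hK this) hη]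

lemma integral_indicator_exp (L : ℝ) :
    MeasureTheory.Integrable ((Set.Ioi L).indicator fun s => Real.exp (-(1 / 4) * (s - L))) ∧
    ∫ s, (Set.Ioi L).indicator (fun s => Real.exp (-(1 / 4) * (s - L))) s = 4 := by
  have e : (fun s => Real.exp (-(1 / 4) * (s - L)))
      = fun s => Real.exp (L / 4) * Real.exp (-(1 / 4) * s) := by
    funext s; rw [← Real.exp_add]; congr 1; ring
  rw [e]
  constructor
  · have : MeasureTheory.IntegrableOn
        (fun s => Real.exp (L / 4) * Real.exp (-(1 / 4) * s)) (Set.Ioi L) :=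
      (integrableOn_exp_mul_Ioi (by norm_num) L).const_mul _
    exact this.integrable_indicator measurableSet_Ioi
  · rw [MeasureTheory.integral_indicator measurableSet_Ioi, MeasureTheory.integral_const_mul,
      integral_exp_mul_Ioi (by norm_num), mul_div_assoc', mul_neg, ← Real.exp_add]
    have : L / 4 + -(1 / 4) * L = 0 := by ring
    rw [this, Real.exp_zero]; norm_num

set_option maxHeartbeats 1000000 in
/-- Convolving an exponentially small function with a truncated polynomial gives a polynomial up
to an error with small Lipschitz constant. -/
lemma exists_conv_polyPos_diff {a : ℝ → ℝ} (ha : Causal a) (hs : SqrtSmall a)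
    (Q : Polynomial ℝ) {q : ℕ} (hq : Q.natDegree ≤ q) :
    ∃ R : Polynomial ℝ, R.natDegree ≤ q ∧ ∀ ε : ℝ, 0 < ε → ∃ K : ℝ, 0 < K ∧
      ∀ L η : ℝ, 0 ≤ L → 0 < η → η ≤ 1 →
        |(conv a (polyPos Q) (L + η) - conv a (polyPos Q) L) - (R.eval (L + η) - R.eval L)|
          ≤ η * (K * Real.exp ((-(1:ℝ)/2 + ε) * L)) := by
  obtain ⟨R, hR, hRe⟩ := exists_integral_mul_eval_sub ha hs Q hq
  refine ⟨R, hR, fun ε₀ hε₀ => ?_⟩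
  obtain ⟨ε, hε, hε8, hεε⟩ : ∃ ε : ℝ, 0 < ε ∧ ε ≤ 1 / 8 ∧ ε ≤ ε₀ :=
    ⟨min ε₀ (1 / 8), by positivity, min_le_right _ _, min_le_left _ _⟩
  obtain ⟨K, hK, h⟩ := hs ε hε
  obtain ⟨K', hK', h'⟩ := exists_abs_polyPos_sub_diff_le Q hε
  have hi1 : ∀ L, MeasureTheory.Integrable (fun s => a s * Q.eval (L - s)) := fun L => by
    have := integrable_mul_eval ha hs (Q.comp (Polynomial.C L - Polynomial.X))
    simpa using this
  have hi2 : ∀ L, MeasureTheory.Integrable (fun s => a s * polyPos Q (L - s)) := fun L => by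
    have := (causal_polyPos Q).integrable_conv ha L
    refine this.congr (Filter.Eventually.of_forall fun s => mul_comm _ _)
  have hW : ∀ L, conv a (polyPos Q) L - R.eval L
      = ∫ s, a s * (polyPos Q (L - s) - Q.eval (L - s)) := fun L => by
    rw [conv_comm, conv, ← hRe]
    have : ∫ s, polyPos Q (L - s) * a s = ∫ s, a s * polyPos Q (L - s) :=
      MeasureTheory.integral_congr_ae (Filter.Eventually.of_forall fun s => mul_comm _ _)
    rw [this, ← MeasureTheory.integral_sub (hi2 L) (hi1 L)]
    exact MeasureTheory.integral_congr_ae (Filter.Eventually.of_forall fun s => by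
      beta_reduce; ring)
  have hi3 : ∀ L, MeasureTheory.Integrable
      (fun s => a s * (polyPos Q (L - s) - Q.eval (L - s))) := fun L =>
    ((hi2 L).sub (hi1 L)).congr (Filter.Eventually.of_forall fun s => by
      simp only [Pi.sub_apply]; ring)
  refine ⟨K * K' * 5, by positivity, fun L η hL hη hη1 => ?_⟩
  have e1 : (conv a (polyPos Q) (L + η) - conv a (polyPos Q) L) - (R.eval (L + η) - R.eval L)
      = ∫ s, a s * ((polyPos Q (L - s + η) - Q.eval (L - s + η))
        - (polyPos Q (L - s) - Q.eval (L - s))) := by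
    have : (conv a (polyPos Q) (L + η) - conv a (polyPos Q) L) - (R.eval (L + η) - R.eval L)
      = (conv a (polyPos Q) (L + η) - R.eval (L + η)) - (conv a (polyPos Q) L - R.eval L) := by
      ring
    rw [this, hW, hW, ← MeasureTheory.integral_sub (hi3 _) (hi3 _)]
    refine MeasureTheory.integral_congr_ae (Filter.Eventually.of_forall fun s => ?_)
    beta_reduce
    rw [sub_add_eq_add_sub]; ring
  rw [e1, ← Real.norm_eq_abs]
  set c : ℝ := K * K' * Real.exp ((-(1:ℝ)/2 + ε) * L) with hc
  have hc0 : 0 < c := by positivity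
  obtain ⟨he1, he2⟩ := integral_indicator_exp L
  have hg1 : MeasureTheory.Integrable ((Set.Ioc L (L + η)).indicator fun _ => (1:ℝ)) :=
    (MeasureTheory.integrableOn_const (by simp)).integrable_indicator measurableSet_Ioc
  have hg2 : ∫ s, (Set.Ioc L (L + η)).indicator (fun _ => (1:ℝ)) s = η := by
    rw [MeasureTheory.integral_indicator measurableSet_Ioc]; simp [hη.le]
  have hint_eq : MeasureTheory.Integrable (fun s => c * ((Set.Ioc L (L + η)).indicator (fun _ => (1:ℝ)) s
      + η * (Set.Ioi L).indicator (fun s => Real.exp (-(1 / 4) * (s - L))) s)) :=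
    (hg1.add (he1.const_mul η)).const_mul c
  refine (MeasureTheory.norm_integral_le_of_norm_le hint_eq (Filter.Eventually.of_forall ?_)).trans ?_
  · intro s
    have hb := h' η (L - s) hη hη1
    rw [norm_mul, Real.norm_eq_abs, Real.norm_eq_abs]
    by_cases hsL : s ≤ L
    · rw [if_pos (by linarith)] at hb
      have : |a s| * _ ≤ |a s| * 0 := mul_le_mul_of_nonneg_left hb (abs_nonneg _)
      refine this.trans ?_
      rw [mul_zero]
      refine mul_nonneg hc0.le (add_nonneg (Set.indicator_nonneg (fun _ _ => zero_le_one) _)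
        (mul_nonneg hη.le (Set.indicator_nonneg (fun _ _ => (Real.exp_pos _).le) _)))
    · rw [if_neg (by linarith)] at hb
      have hE : Real.exp ((-(1:ℝ)/2 + ε) * s) * Real.exp (ε * -(L - s))
          ≤ Real.exp ((-(1:ℝ)/2 + ε) * L) * Real.exp (-(1 / 4) * (s - L)) := by
        rw [← Real.exp_add, ← Real.exp_add, Real.exp_le_exp]
        nlinarith
      have hE1 : Real.exp (-(1 / 4) * (s - L)) ≤ 1 := Real.exp_le_one_iff.2 (by linarith)
      rw [Set.indicator_apply, Set.indicator_apply, if_pos (Set.mem_Ioi.2 (not_le.1 hsL))]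
      refine (mul_le_mul (h s (by linarith)) hb (abs_nonneg _) (by positivity)).trans ?_
      set E1 := Real.exp (-(1 / 4) * (s - L))
      have e2 : ∀ z : ℝ, 0 ≤ z → K * Real.exp ((-(1:ℝ)/2 + ε) * s) *
          (K' * Real.exp (ε * -(L - s)) * z) ≤ c * (E1 * z) := fun z hz => by
        calc _ = K * K' * z * (Real.exp ((-(1:ℝ)/2 + ε) * s) * Real.exp (ε * -(L - s))) := by ring
          _ ≤ K * K' * z * (Real.exp ((-(1:ℝ)/2 + ε) * L) * E1) :=
            mul_le_mul_of_nonneg_left hE (by positivity)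
          _ = _ := by rw [hc]; ring
      have hi : (if -η ≤ L - s then (1:ℝ) else 0) = if s ∈ Set.Ioc L (L + η) then 1 else 0 := by
        refine if_congr ?_ rfl rfl
        rw [Set.mem_Ioc]
        exact ⟨fun h => ⟨not_le.1 hsL, by linarith⟩, fun h => by linarith [h.2]⟩
      rw [hi]
      have hz : (0:ℝ) ≤ if s ∈ Set.Ioc L (L + η) then 1 else 0 := by split_ifs <;> norm_num
      refine (e2 _ (by linarith)).trans (mul_le_mul_of_nonneg_left ?_ hc0.le)
      nlinarith
  · rw [MeasureTheory.integral_const_mul, MeasureTheory.integral_add hg1 (he1.const_mul η), hg2,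
      MeasureTheory.integral_const_mul, he2]
    have : Real.exp ((-(1:ℝ)/2 + ε) * L) ≤ Real.exp ((-(1:ℝ)/2 + ε₀) * L) :=
      Real.exp_le_exp.2 (mul_le_mul_of_nonneg_right (by linarith) hL)
    calc c * (η + η * 4) = η * (K * K' * 5 * Real.exp ((-(1:ℝ)/2 + ε) * L)) := by rw [hc]; ring
      _ ≤ _ := by gcongr

/-- Summatory function of a sequence. -/
noncomputable def psum (α : ℕ → ℝ) (n : ℕ) : ℝ := ∑ l ∈ Finset.Icc 1 n, α l

/-- Summatory function of a Dirichlet convolution. -/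
noncomputable def hypSum (α β : ℕ → ℝ) (N : ℕ) : ℝ :=
  ∑ n ∈ Finset.Icc 1 N, β n * psum α (N / n)

lemma psum_zero (α : ℕ → ℝ) : psum α 0 = 0 := by simp [psum]

lemma psum_mono {α : ℕ → ℝ} (hα : ∀ n, 0 ≤ α n) : Monotone (psum α) := fun _ _ h =>
  Finset.sum_le_sum_of_subset_of_nonneg (Finset.Icc_subset_Icc_right h) fun i _ _ => hα i

lemma psum_nonneg {α : ℕ → ℝ} (hα : ∀ n, 0 ≤ α n) (n : ℕ) : 0 ≤ psum α n :=
  Finset.sum_nonneg fun i _ => hα i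

lemma hypSum_eq_of_le (α β : ℕ → ℝ) {N M : ℕ} (h : N ≤ M) :
    hypSum α β N = ∑ n ∈ Finset.Icc 1 M, β n * psum α (N / n) := by
  refine Finset.sum_subset (Finset.Icc_subset_Icc_right h) fun n hn hn' => ?_
  rw [Finset.mem_Icc] at hn hn'
  rw [Nat.div_eq_of_lt (by omega), psum_zero, mul_zero]

lemma hypSum_nonneg {α β : ℕ → ℝ} (hα : ∀ n, 0 ≤ α n) (hβ : ∀ n, 0 ≤ β n) (N : ℕ) :
    0 ≤ hypSum α β N :=
  Finset.sum_nonneg fun n _ => mul_nonneg (hβ n) (psum_nonneg hα _)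

lemma stepFn_mono {A : ℕ → ℝ} (hA : Monotone A) (hA0 : ∀ n, 0 ≤ A n) : Monotone (stepFn A) := by
  intro u v h
  rw [stepFn, stepFn]
  split_ifs with h1 h2
  · exact hA (Nat.floor_mono (Real.exp_le_exp.2 h))
  · linarith
  · exact hA0 _
  · exact le_rfl

lemma floor_exp_sub_log (L : ℝ) {n : ℕ} (hn : 1 ≤ n) :
    ⌊Real.exp (L - Real.log n)⌋₊ = ⌊Real.exp L⌋₊ / n := by
  have : (0:ℝ) < n := by exact_mod_cast hn
  rw [Real.exp_sub, Real.exp_log this, Nat.floor_div_natCast]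

lemma stepFn_psum_sub_log (α : ℕ → ℝ) (L : ℝ) {n : ℕ} (hn : 1 ≤ n) :
    stepFn (psum α) (L - Real.log n) = psum α (⌊Real.exp L⌋₊ / n) := by
  rw [stepFn, floor_exp_sub_log L hn]
  split_ifs with h
  · rfl
  · rw [← floor_exp_sub_log L hn, Nat.floor_eq_zero.2 (Real.exp_lt_one_iff.2 (not_le.1 h)), psum_zero]

lemma polyPos_one (u : ℝ) : polyPos 1 u = if 0 ≤ u then 1 else 0 := by
  rw [polyPos, Polynomial.eval_one]

lemma stepFn_psum_eq_sum (β : ℕ → ℝ) {s : ℝ} {M : ℕ} (h : ⌊Real.exp s⌋₊ ≤ M) :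
    stepFn (psum β) s = ∑ n ∈ Finset.Icc 1 M, β n * polyPos 1 (s - Real.log n) := by
  have hle : ∀ n ∈ Finset.Icc 1 M, (0 ≤ s - Real.log n ↔ n ≤ ⌊Real.exp s⌋₊) := fun n hn => by
    have : (0:ℝ) < n := by exact_mod_cast (Finset.mem_Icc.1 hn).1
    rw [Nat.le_floor_iff (Real.exp_pos _).le, sub_nonneg, Real.log_le_iff_le_exp this]
  have e : ∑ n ∈ Finset.Icc 1 M, β n * polyPos 1 (s - Real.log n) = psum β ⌊Real.exp s⌋₊ := by
    rw [psum, ← Finset.sum_subset (Finset.Icc_subset_Icc_right h)]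
    · refine Finset.sum_congr rfl fun n hn => ?_
      rw [polyPos_one, if_pos, mul_one]
      rw [Finset.mem_Icc] at hn
      exact (hle n (Finset.mem_Icc.2 ⟨hn.1, hn.2.trans h⟩)).2 hn.2
    · intro n hn hn'
      rw [polyPos_one, if_neg, mul_zero]
      rw [hle n hn]
      rw [Finset.mem_Icc] at hn hn'
      omega
  rw [e, stepFn]
  split_ifs with hs
  · rfl
  · rw [Nat.floor_eq_zero.2 (Real.exp_lt_one_iff.2 (not_le.1 hs)), psum_zero]

lemma conv_stepFn_psum (A : ℕ → ℝ) (β : ℕ → ℝ) {L : ℝ} {M : ℕ} (h : ⌊Real.exp L⌋₊ ≤ M) :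
    conv (stepFn A) (stepFn (psum β)) L
      = ∑ n ∈ Finset.Icc 1 M, β n * conv (stepFn A) (polyPos 1) (L - Real.log n) := by
  have hA := causal_stepFn A
  have e : ∀ s, stepFn A (L - s) * stepFn (psum β) s
      = ∑ n ∈ Finset.Icc 1 M, β n * (stepFn A (L - s) * polyPos 1 (s - Real.log n)) := fun s => by
    by_cases hs : s ≤ L
    · rw [stepFn_psum_eq_sum β ((Nat.floor_mono (Real.exp_le_exp.2 hs)).trans h), Finset.mul_sum]
      exact Finset.sum_congr rfl fun n _ => by ring
    · rw [hA.eq_zero _ (by linarith)]; simp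
  have hlog : ∀ n : ℕ, 0 ≤ Real.log n := fun n => Real.log_natCast_nonneg n
  rw [conv]
  simp only [e]
  rw [MeasureTheory.integral_finsetSum _ fun n _ =>
    (hA.integrable_conv ((causal_polyPos 1).shift (hlog n)) L).const_mul _]
  refine Finset.sum_congr rfl fun n _ => ?_
  rw [MeasureTheory.integral_const_mul, ← conv_shift_right]
  rfl

lemma conv_stepFn_one_diff {A : ℕ → ℝ} (hA : Monotone A) (hA0 : ∀ n, 0 ≤ A n) (x : ℝ) {η : ℝ}
    (hη : 0 < η) :
    η * stepFn A x ≤ conv (stepFn A) (polyPos 1) (x + η) - conv (stepFn A) (polyPos 1) x ∧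
    conv (stepFn A) (polyPos 1) (x + η) - conv (stepFn A) (polyPos 1) x
      ≤ η * stepFn A (x + η) := by
  have hc := causal_stepFn A
  have hp := causal_polyPos 1
  have hI : ∀ c : ℝ, MeasureTheory.Integrable ((Set.Ioc x (x + η)).indicator fun _ => c) ∧
      ∫ s, (Set.Ioc x (x + η)).indicator (fun _ => c) s = η * c := fun c => by
    constructor
    · exact (MeasureTheory.integrableOn_const (by simp)).integrable_indicator measurableSet_Ioc
    · rw [MeasureTheory.integral_indicator measurableSet_Ioc]; simp [hη.le]
  have hi : MeasureTheory.Integrable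
      (fun s => polyPos 1 (x + η - s) * stepFn A s - polyPos 1 (x - s) * stepFn A s) :=
    (hp.integrable_conv hc (x + η)).sub (hp.integrable_conv hc x)
  have e : ∀ s, polyPos 1 (x + η - s) * stepFn A s - polyPos 1 (x - s) * stepFn A s
      = (Set.Ioc x (x + η)).indicator (fun s => stepFn A s) s := fun s => by
    rw [polyPos_one, polyPos_one, Set.indicator_apply]
    by_cases h1 : s ≤ x
    · rw [if_pos (by linarith), if_pos (by linarith), if_neg fun h => by linarith [h.1], sub_self]
    · by_cases h2 : s ≤ x + η
      · rw [if_pos (by linarith), if_neg (by linarith), if_pos ⟨not_le.1 h1, h2⟩]; ring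
      · rw [if_neg (by linarith), if_neg (by linarith), if_neg fun h => h2 h.2]; ring
  have hm := stepFn_mono hA hA0
  rw [conv_comm, conv_comm _ _ x, conv, conv,
    ← MeasureTheory.integral_sub (hp.integrable_conv hc (x + η)) (hp.integrable_conv hc x),
    ← (hI (stepFn A x)).2, ← (hI (stepFn A (x + η))).2]
  constructor
  · refine MeasureTheory.integral_mono (hI _).1 hi fun s => ?_
    beta_reduce
    rw [e]
    exact Set.indicator_le_indicator' fun hs => hm hs.1.le
  · refine MeasureTheory.integral_mono hi (hI _).1 fun s => ?_
    beta_reduce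
    rw [e]
    exact Set.indicator_le_indicator' fun hs => hm hs.2

/-- The difference quotients of the convolution of step functions enclose the summatory function
of the Dirichlet convolution. -/
lemma hypSum_sandwich {α β : ℕ → ℝ} (hα : ∀ n, 0 ≤ α n) (hβ : ∀ n, 0 ≤ β n) (L : ℝ) {η : ℝ}
    (hη : 0 < η) :
    η * hypSum α β ⌊Real.exp L⌋₊ ≤ conv (stepFn (psum α)) (stepFn (psum β)) (L + η)
        - conv (stepFn (psum α)) (stepFn (psum β)) L ∧
    conv (stepFn (psum α)) (stepFn (psum β)) (L + η)
        - conv (stepFn (psum α)) (stepFn (psum β)) L ≤ η * hypSum α β ⌊Real.exp (L + η)⌋₊ := by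
  have hle : ⌊Real.exp L⌋₊ ≤ ⌊Real.exp (L + η)⌋₊ :=
    Nat.floor_mono (Real.exp_le_exp.2 (by linarith))
  rw [conv_stepFn_psum _ _ hle, conv_stepFn_psum _ _ le_rfl, hypSum_eq_of_le α β hle, hypSum,
    ← Finset.sum_sub_distrib, Finset.mul_sum, Finset.mul_sum]
  constructor
  · refine Finset.sum_le_sum fun n hn => ?_
    have := (conv_stepFn_one_diff (psum_mono hα) (psum_nonneg hα) (L - Real.log n) hη).1
    rw [stepFn_psum_sub_log α L (Finset.mem_Icc.1 hn).1, ← sub_add_eq_add_sub] at *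
    have := mul_le_mul_of_nonneg_left this (hβ n)
    linarith
  · refine Finset.sum_le_sum fun n hn => ?_
    have := (conv_stepFn_one_diff (psum_mono hα) (psum_nonneg hα) (L - Real.log n) hη).2
    rw [sub_add_eq_add_sub, stepFn_psum_sub_log α (L + η) (Finset.mem_Icc.1 hn).1] at this
    have := mul_le_mul_of_nonneg_left this (hβ n)
    linarith

lemma exists_conv_stepFn_diff {A B : ℕ → ℝ} {P Q : Polynomial ℝ} {p q : ℕ} {c d : ℝ}
    (ha : SqrtSmall (logErr A P)) (hb : SqrtSmall (logErr B Q))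
    (hP : LeadAt P p c) (hQ : LeadAt Q q d) :
    ∃ R : Polynomial ℝ,
      LeadAt R (p + q + 1) (c * d * ((p.factorial : ℝ) * q.factorial / (p + q + 1).factorial)) ∧
      ∀ ε : ℝ, 0 < ε → ∃ K : ℝ, 0 < K ∧ ∀ L η : ℝ, 0 ≤ L → 0 < η → η ≤ 1 →
        |(conv (stepFn A) (stepFn B) (L + η) - conv (stepFn A) (stepFn B) L)
          - (R.eval (L + η) - R.eval L)
          - (conv (logErr A P) (logErr B Q) (L + η) - conv (logErr A P) (logErr B Q) L)|
          ≤ η * (K * Real.exp ((-(1:ℝ)/2 + ε) * L)) := by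
  obtain ⟨R0, hR0, h0⟩ := exists_conv_polyPos hP hQ
  obtain ⟨R1, hR1, h1⟩ := exists_conv_polyPos_diff (causal_logErr A P) ha Q hQ.1
  obtain ⟨R2, hR2, h2⟩ := exists_conv_polyPos_diff (causal_logErr B Q) hb P hP.1
  refine ⟨R0 + R1 + R2, ?_, fun ε hε => ?_⟩
  · have := (hR0.add (LeadAt.of_natDegree_lt (P := R1) (by omega))).add
      (LeadAt.of_natDegree_lt (P := R2) (by omega))
    simpa using this
  · obtain ⟨K1, hK1, h1⟩ := h1 ε hε
    obtain ⟨K2, hK2, h2⟩ := h2 ε hε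
    refine ⟨K1 + K2, by positivity, fun L η hL hη hη1 => ?_⟩
    have h1 := h1 L η hL hη hη1
    have h2 := h2 L η hL hη hη1
    rw [conv_stepFn A B P Q, conv_stepFn A B P Q, h0 _ hL, h0 _ (by linarith)]
    simp only [Polynomial.eval_add]
    rw [abs_le] at h1 h2 ⊢
    constructor <;> linarith [h1.1, h1.2, h2.1, h2.2]

lemma exists_abs_eval_sub_derivative_le (P : Polynomial ℝ) {ε : ℝ} (hε : 0 < ε) :
    ∃ K : ℝ, 0 < K ∧ ∀ u w v : ℝ, 0 ≤ u → u < v → u ≤ w → w ≤ v →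
      |P.eval v - P.eval u - (v - u) * P.derivative.eval w| ≤ (v - u) * (K * Real.exp (ε * v) *
        (v - u)) := by
  obtain ⟨K, hK, h⟩ := exists_abs_eval_sub_le P.derivative hε
  refine ⟨K, hK, fun u w v hu huv hw hwv => ?_⟩
  obtain ⟨ξ, hξ, e⟩ := exists_hasDerivAt_eq_slope (fun x => P.eval x) (fun x => P.derivative.eval x)
    huv P.continuous.continuousOn fun x _ => P.hasDerivAt x
  have hvu : 0 < v - u := by linarith
  rw [eq_div_iff hvu.ne'] at e
  rw [← e]
  have e2 : P.derivative.eval ξ * (v - u) - (v - u) * P.derivative.eval w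
      = (v - u) * (P.derivative.eval ξ - P.derivative.eval w) := by ring
  rw [e2, abs_mul, abs_of_pos hvu]
  refine mul_le_mul_of_nonneg_left ?_ hvu.le
  have hexp : ∀ x y : ℝ, 0 ≤ x → x ≤ y → y ≤ v → u ≤ x →
      |P.derivative.eval y - P.derivative.eval x| ≤ K * Real.exp (ε * v) * (v - u) := by
    intro x y hx hxy hy hux
    refine (h x y hx hxy).trans ?_
    have : Real.exp (ε * y) ≤ Real.exp (ε * v) :=
      Real.exp_le_exp.2 (mul_le_mul_of_nonneg_left hy hε.le)
    have h1 : y - x ≤ v - u := by linarith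
    have h2 : 0 ≤ y - x := by linarith
    gcongr
  rcases le_total ξ w with h1 | h1
  · rw [abs_sub_comm]
    exact hexp _ _ (by linarith [hξ.1]) h1 hwv hξ.1.le
  · exact hexp _ _ (by linarith) h1 hξ.2.le hw

/-- A bound on the increments of the convolution of the two error terms, on scales at least
`exp (-κ L)`, gives an asymptotic formula for the summatory function of the Dirichlet convolution,
with a saving of `exp (-κ L)`. -/
lemma exists_hypSum_asymptotic {α β : ℕ → ℝ} (hα : ∀ n, 0 ≤ α n) (hβ : ∀ n, 0 ≤ β n)
    {R : Polynomial ℝ} {H : ℝ → ℝ} {κ : ℝ} (hκ0 : 0 < κ) (hκ : κ ≤ 1 / 2)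
    (hR : ∀ ε : ℝ, 0 < ε → ∃ K : ℝ, 0 < K ∧ ∀ L η : ℝ, 0 ≤ L → 0 < η → η ≤ 1 →
      |(conv (stepFn (psum α)) (stepFn (psum β)) (L + η)
          - conv (stepFn (psum α)) (stepFn (psum β)) L)
          - (R.eval (L + η) - R.eval L) - (H (L + η) - H L)|
          ≤ η * (K * Real.exp ((-(1:ℝ)/2 + ε) * L)))
    (hH : ∀ ε : ℝ, 0 < ε → ∃ K : ℝ, 0 < K ∧ ∀ L η : ℝ, 0 ≤ L → Real.exp (-κ * L) ≤ η → η ≤ 1 →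
      |H (L + η) - H L| ≤ η * (K * Real.exp ((-κ + ε) * L))) :
    ∀ ε : ℝ, 0 < ε → ∃ K : ℝ, 0 < K ∧ ∀ L : ℝ, 0 ≤ L →
      |hypSum α β ⌊Real.exp L⌋₊ - R.derivative.eval L| ≤ K * Real.exp ((-κ + ε) * L) := by
  intro ε hε
  obtain ⟨K1, hK1, h1⟩ := hR ε hε
  obtain ⟨K2, hK2, h2⟩ := hH ε hε
  obtain ⟨K3, hK3, h3⟩ := exists_abs_eval_sub_derivative_le R hε
  obtain ⟨K4, hK4, h4⟩ := exists_abs_eval_le_exp R.derivative hε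
  set T := conv (stepFn (psum α)) (stepFn (psum β)) with hT
  set S := hypSum α β with hS
  have key : ∀ L w η : ℝ, 0 ≤ L → Real.exp (-κ * L) ≤ η → η ≤ 1 → η ≤ 3 * Real.exp (-κ * L) →
      L ≤ w → w ≤ L + η → |T (L + η) - T L - η * R.derivative.eval w|
        ≤ η * ((K1 + K2 + 3 * K3 * Real.exp ε) * Real.exp ((-κ + ε) * L)) := by
    intro L w η hL hη hη1 hη3 hw hw'
    have hη0 : 0 < η := (Real.exp_pos _).trans_le hη
    have b1 := h1 L η hL hη0 hη1
    have b2 := h2 L η hL hη hη1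
    have b3 := h3 L w (L + η) hL (by linarith) hw hw'
    rw [add_sub_cancel_left] at b3
    have c1 : Real.exp ((-(1:ℝ)/2 + ε) * L) ≤ Real.exp ((-κ + ε) * L) :=
      Real.exp_le_exp.2 (mul_le_mul_of_nonneg_right (by linarith) hL)
    have c3 : Real.exp (ε * (L + η)) * η ≤ 3 * Real.exp ε * Real.exp ((-κ + ε) * L) := by
      have : Real.exp (ε * (L + η)) ≤ Real.exp (ε * L) * Real.exp ε := by
        rw [← Real.exp_add, Real.exp_le_exp]; nlinarith
      calc _ ≤ Real.exp (ε * L) * Real.exp ε * (3 * Real.exp (-κ * L)) :=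
            mul_le_mul this hη3 hη0.le (by positivity)
        _ = 3 * Real.exp ε * (Real.exp (-κ * L) * Real.exp (ε * L)) := by ring
        _ = _ := by rw [← Real.exp_add, add_mul]
    have d1 : η * (K1 * Real.exp ((-(1:ℝ)/2 + ε) * L)) ≤ η * (K1 * Real.exp ((-κ + ε) * L)) := by
      gcongr
    have d3 : η * (K3 * Real.exp (ε * (L + η)) * η)
        ≤ η * (K3 * (3 * Real.exp ε * Real.exp ((-κ + ε) * L))) := by
      rw [mul_assoc K3]; gcongr
    rw [abs_le] at b1 b2 b3 ⊢
    constructor <;> linarith [b1.1, b1.2, b2.1, b2.2, b3.1, b3.2]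
  set K := K1 + K2 + 3 * K3 * Real.exp ε with hK
  have hK0 : 0 < K := by positivity
  have hS2 : 0 ≤ S ⌊Real.exp 1⌋₊ := hypSum_nonneg hα hβ _
  refine ⟨3 * K + (S ⌊Real.exp 1⌋₊ + K4 * Real.exp ε) * Real.exp κ, by positivity,
    fun L hL => ?_⟩
  rw [abs_sub_le_iff]
  have hexp : 0 < Real.exp ((-κ + ε) * L) := Real.exp_pos _
  have hC : 0 ≤ (S ⌊Real.exp 1⌋₊ + K4 * Real.exp ε) * Real.exp κ := by positivity
  constructor
  · have hη1 : Real.exp (-κ * L) ≤ 1 := Real.exp_le_one_iff.2 (by nlinarith)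
    have hη0 := Real.exp_pos (-κ * L)
    have k := key L L (Real.exp (-κ * L)) hL le_rfl hη1 (by linarith) le_rfl (by linarith)
    have s := (hypSum_sandwich hα hβ L hη0).1
    rw [← hT, ← hS] at s
    have := (abs_le.1 k).2
    have : Real.exp (-κ * L) * (S ⌊Real.exp L⌋₊ - R.derivative.eval L)
        ≤ Real.exp (-κ * L) * (K * Real.exp ((-κ + ε) * L)) := by linarith
    have := le_of_mul_le_mul_left this hη0
    nlinarith [mul_nonneg hC hexp.le, mul_pos hK0 hexp]
  · by_cases hL1 : L ≤ 1
    · have b4 := (abs_le.1 (h4 L hL)).2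
      have s0 : 0 ≤ S ⌊Real.exp L⌋₊ := hypSum_nonneg hα hβ _
      have e1 : Real.exp (ε * L) = Real.exp (κ * L) * Real.exp ((-κ + ε) * L) := by
        rw [← Real.exp_add]; congr 1; ring
      have e2 : Real.exp (κ * L) ≤ Real.exp κ := Real.exp_le_exp.2 (by nlinarith)
      have e3 : 1 ≤ Real.exp ε := Real.one_le_exp hε.le
      have : K4 * Real.exp (ε * L) ≤ K4 * Real.exp ε * Real.exp κ * Real.exp ((-κ + ε) * L) := by
        rw [e1]
        calc _ ≤ K4 * (Real.exp κ * Real.exp ((-κ + ε) * L)) := by gcongr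
          _ = K4 * 1 * Real.exp κ * Real.exp ((-κ + ε) * L) := by ring
          _ ≤ _ := by gcongr
      have : 0 ≤ (3 * K + S ⌊Real.exp 1⌋₊ * Real.exp κ) * Real.exp ((-κ + ε) * L) := by positivity
      nlinarith
    · rw [not_le] at hL1
      set η := Real.exp (-κ * (L - 1)) with hη
      have hη0 : 0 < η := Real.exp_pos _
      have hη1 : η ≤ 1 := Real.exp_le_one_iff.2 (by nlinarith)
      have hκ3 : Real.exp κ ≤ 3 := (Real.exp_le_exp.2 (by linarith)).trans
        Real.exp_one_lt_three.le
      have hη3 : η ≤ 3 * Real.exp (-κ * (L - η)) := by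
        have : η = Real.exp κ * Real.exp (-κ * L) := by rw [hη, ← Real.exp_add]; congr 1; ring
        rw [this]
        refine mul_le_mul hκ3 (Real.exp_le_exp.2 ?_) (Real.exp_pos _).le (by norm_num)
        nlinarith
      have hηl : Real.exp (-κ * (L - η)) ≤ η := Real.exp_le_exp.2 (by nlinarith)
      have k := key (L - η) L η (by linarith) hηl hη1 hη3 (by linarith) (by linarith)
      have s := (hypSum_sandwich hα hβ (L - η) hη0).2
      rw [← hT, ← hS] at s
      rw [sub_add_cancel] at s k
      have := (abs_le.1 k).1
      have h5 : Real.exp ((-κ + ε) * (L - η)) ≤ 3 * Real.exp ((-κ + ε) * L) := by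
        refine le_trans ?_ (mul_le_mul_of_nonneg_right hκ3 (Real.exp_pos _).le)
        rw [← Real.exp_add, Real.exp_le_exp]
        nlinarith
      have : η * (R.derivative.eval L - S ⌊Real.exp L⌋₊)
          ≤ η * (K * Real.exp ((-κ + ε) * (L - η))) := by linarith
      have := le_of_mul_le_mul_left this hη0
      nlinarith [mul_nonneg hC hexp.le, mul_pos hK0 hexp, mul_le_mul_of_nonneg_left h5 hK0.le]

lemma sqrtSmall_conv {a b : ℝ → ℝ} (ha : Causal a) (hb : Causal b) (hsa : SqrtSmall a)
    (hsb : SqrtSmall b) : SqrtSmall (conv a b) := by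
  intro ε₀ hε₀
  obtain ⟨ε, hε, rfl⟩ : ∃ ε, 0 < ε ∧ ε₀ = 2 * ε := ⟨ε₀ / 2, by linarith, by ring⟩
  obtain ⟨K, hK, h⟩ := hsa ε hε
  obtain ⟨K', hK', h'⟩ := hsb ε hε
  refine ⟨K * K' / ε, by positivity, fun L hL => ?_⟩
  rw [ha.conv_eq_intervalIntegral hb hL]
  have := intervalIntegral.norm_integral_le_of_norm_le_const (a := 0) (b := L)
    (f := fun s => a (L - s) * b s) (C := K * K' * Real.exp ((-(1:ℝ)/2 + ε) * L)) fun s hs => by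
      rw [Set.uIoc_of_le hL] at hs
      rw [norm_mul, Real.norm_eq_abs, Real.norm_eq_abs]
      calc _ ≤ (K * Real.exp ((-(1:ℝ)/2 + ε) * (L - s))) * (K' * Real.exp ((-(1:ℝ)/2 + ε) * s)) :=
            mul_le_mul (h _ (by linarith [hs.2])) (h' _ hs.1.le) (abs_nonneg _) (by positivity)
        _ = K * K' * (Real.exp ((-(1:ℝ)/2 + ε) * (L - s)) * Real.exp ((-(1:ℝ)/2 + ε) * s)) := by
            ring
        _ = _ := by rw [← Real.exp_add]; congr 2; ring
  rw [sub_zero, abs_of_nonneg hL, Real.norm_eq_abs] at this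
  refine this.trans ?_
  have h1 : L ≤ Real.exp (ε * L) / ε := by
    rw [le_div_iff₀ hε]
    linarith [Real.add_one_le_exp (ε * L)]
  calc _ ≤ K * K' * Real.exp ((-(1:ℝ)/2 + ε) * L) * (Real.exp (ε * L) / ε) := by gcongr
    _ = K * K' / ε * (Real.exp ((-(1:ℝ)/2 + ε) * L) * Real.exp (ε * L)) := by ring
    _ = _ := by rw [← Real.exp_add]; congr 2; ring

lemma SqrtSmall.exists_abs_diff_le {H : ℝ → ℝ} (hH : SqrtSmall H) {ε : ℝ} (hε : 0 < ε) :
    ∃ K : ℝ, 0 < K ∧ ∀ L η : ℝ, 0 ≤ L → 0 ≤ η → η ≤ 1 →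
      |H (L + η) - H L| ≤ K * Real.exp ((-(1:ℝ)/2 + ε) * L) := by
  obtain ⟨K, hK, h⟩ := hH ε hε
  refine ⟨K * (Real.exp ε + 1), by positivity, fun L η hL hη hη1 => ?_⟩
  have h1 : Real.exp ((-(1:ℝ)/2 + ε) * (L + η)) ≤ Real.exp ε * Real.exp ((-(1:ℝ)/2 + ε) * L) := by
    rw [← Real.exp_add, Real.exp_le_exp]; nlinarith
  have h2 := mul_le_mul_of_nonneg_left h1 hK.le
  refine (abs_sub _ _).trans ?_
  linarith [h _ hL, h (L + η) (by linarith)]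

lemma exists_abs_diff_le_of_sqrtSmall {H : ℝ → ℝ} (hH : SqrtSmall H) :
    ∀ ε : ℝ, 0 < ε → ∃ K : ℝ, 0 < K ∧ ∀ L η : ℝ, 0 ≤ L → Real.exp (-(1 / 4) * L) ≤ η → η ≤ 1 →
      |H (L + η) - H L| ≤ η * (K * Real.exp ((-(1 / 4) + ε) * L)) := by
  intro ε hε
  obtain ⟨K, hK, h⟩ := hH.exists_abs_diff_le hε
  refine ⟨K, hK, fun L η hL hη hη1 => (h L η hL ((Real.exp_pos _).le.trans hη) hη1).trans ?_⟩
  have : Real.exp ((-(1:ℝ)/2 + ε) * L)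
      = Real.exp (-(1 / 4) * L) * Real.exp ((-(1 / 4) + ε) * L) := by
    rw [← Real.exp_add]; congr 1; ring
  rw [this]
  have := mul_le_mul_of_nonneg_right hη (by positivity : 0 ≤ K * Real.exp ((-(1 / 4) + ε) * L))
  linarith

lemma exists_abs_conv_second_difference_le {a b : ℝ → ℝ} (ha : Causal a) (hb : Causal b)
    (hma : MeanSqShift a) (hmb : MeanSqShift b) {ε : ℝ} (hε : 0 < ε) :
    ∃ K : ℝ, 0 < K ∧ ∀ L h : ℝ, 0 < h → h ≤ 1 →
      |conv a b (L + 2 * h) - 2 * conv a b (L + h) + conv a b L|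
        ≤ K * h ^ (1 - ε) * Real.exp (-(1 / 2) * L) := by
  obtain ⟨K, hK, h1⟩ := hma ε hε
  obtain ⟨K', hK', h2⟩ := hmb ε hε
  refine ⟨K + K', by positivity, fun L h hh hh1 => ?_⟩
  rw [← ha.conv_second_difference hb hh.le]
  set M := L + 2 * h with hM
  have h1 := h1 h hh hh1
  have h2 := h2 h hh hh1
  have hmeas : ∀ {f : ℝ → ℝ}, Causal f →
      Measurable fun u => ENNReal.ofReal ((f u - f (u - h)) ^ 2 * Real.exp u) := fun hf =>
    (((hf.measurable.sub (hf.shift hh.le).measurable).pow_const 2).mul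
      Real.measurable_exp).ennreal_ofReal
  have hle : ENNReal.ofReal |conv (fun u => a u - a (u - h)) (fun u => b u - b (u - h)) M|
      ≤ ENNReal.ofReal (Real.exp (-(1 / 2) * M)) *
        (ENNReal.ofReal (K * h ^ (1 - ε)) + ENNReal.ofReal (K' * h ^ (1 - ε))) := by
    rw [conv, ← Real.norm_eq_abs, ofReal_norm]
    refine (MeasureTheory.enorm_integral_le_lintegral_enorm _).trans ?_
    refine le_trans ?_ (mul_le_mul_right (add_le_add h1 h2) _)
    rw [← MeasureTheory.lintegral_sub_left_eq_self
        (fun u => ENNReal.ofReal ((a u - a (u - h)) ^ 2 * Real.exp u)) M,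
      ← MeasureTheory.lintegral_add_right _ (hmeas hb),
      ← MeasureTheory.lintegral_const_mul' _ _ ENNReal.ofReal_ne_top]
    refine MeasureTheory.lintegral_mono fun s => ?_
    beta_reduce
    rw [← ENNReal.ofReal_add (by positivity) (by positivity),
      ← ENNReal.ofReal_mul (Real.exp_pos _).le, ← ofReal_norm]
    refine ENNReal.ofReal_le_ofReal ?_
    rw [Real.norm_eq_abs]
    generalize a (M - s) - a (M - s - h) = x
    generalize b s - b (s - h) = y
    have e1 : Real.exp (M - s) = Real.exp ((M - s) / 2) ^ 2 := by
      rw [sq, ← Real.exp_add]; congr 1; ring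
    have e2 : Real.exp s = Real.exp (s / 2) ^ 2 := by rw [sq, ← Real.exp_add]; congr 1; ring
    have e3 : Real.exp (-(1 / 2) * M) * (Real.exp ((M - s) / 2) * Real.exp (s / 2)) = 1 := by
      rw [← Real.exp_add, ← Real.exp_add, Real.exp_eq_one_iff]; ring
    rw [e1, e2]
    have p0 := Real.exp_pos (-(1 / 2) * M)
    generalize Real.exp (-(1 / 2) * M) = w at *
    generalize Real.exp ((M - s) / 2) = r at *
    generalize Real.exp (s / 2) = t at *
    have : x * y = w * ((x * r) * (y * t)) := by
      calc x * y = (x * y) * (w * (r * t)) := by rw [e3, mul_one]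
        _ = _ := by ring
    rw [this, abs_mul, abs_of_pos p0]
    refine mul_le_mul_of_nonneg_left ?_ p0.le
    rw [abs_le]
    constructor <;> nlinarith [sq_nonneg (x * r - y * t), sq_nonneg (x * r + y * t),
      sq_nonneg (x * r), sq_nonneg (y * t)]
  rw [← ENNReal.ofReal_add (by positivity) (by positivity),
    ← ENNReal.ofReal_mul (Real.exp_pos _).le, ENNReal.ofReal_le_ofReal_iff (by positivity)] at hle
  refine hle.trans ?_
  have : Real.exp (-(1 / 2) * M) ≤ Real.exp (-(1 / 2) * L) := Real.exp_le_exp.2 (by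
    rw [hM]; linarith)
  calc Real.exp (-(1 / 2) * M) * (K * h ^ (1 - ε) + K' * h ^ (1 - ε))
      ≤ Real.exp (-(1 / 2) * L) * (K * h ^ (1 - ε) + K' * h ^ (1 - ε)) := by gcongr
    _ = _ := by ring

lemma exists_abs_conv_diff_le {a b : ℝ → ℝ} (ha : Causal a) (hb : Causal b)
    (hsa : SqrtSmall a) (hsb : SqrtSmall b) (hma : MeanSqShift a) (hmb : MeanSqShift b) :
    ∀ ε : ℝ, 0 < ε → ∃ K : ℝ, 0 < K ∧ ∀ L η : ℝ, 0 ≤ L → Real.exp (-(1 / 2) * L) ≤ η → η ≤ 1 →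
      |conv a b (L + η) - conv a b L| ≤ η * (K * Real.exp ((-(1 / 2) + ε) * L)) := by
  intro ε₀ hε₀
  obtain ⟨ε, hε, rfl⟩ : ∃ ε, 0 < ε ∧ ε₀ = 2 * ε := ⟨ε₀ / 2, by linarith, by ring⟩
  obtain ⟨K, hK, h1⟩ := (sqrtSmall_conv ha hb hsa hsb).exists_abs_diff_le hε
  obtain ⟨K', hK', h2⟩ := exists_abs_conv_second_difference_le ha hb hma hmb hε
  set H := conv a b with hH
  have key : ∀ L : ℝ, 0 ≤ L → ∀ J : ℕ, ∀ η : ℝ, Real.exp (-(1 / 2) * L) ≤ η → η ≤ 1 →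
      (1 / 2 : ℝ) ^ (J + 1) ≤ η → |H (L + η) - H L|
        ≤ η * ((2 * K + J * K') * Real.exp ((-(1 / 2) + ε) * L)) := by
    intro L hL J
    have hE := Real.exp_pos ((-(1 / 2) + ε) * L)
    have base : ∀ η : ℝ, 1 / 2 ≤ η → η ≤ 1 → ∀ J : ℕ, |H (L + η) - H L|
        ≤ η * ((2 * K + J * K') * Real.exp ((-(1 / 2) + ε) * L)) := by
      intro η hη hη1 J
      have := h1 L η hL (by linarith) hη1
      rw [neg_div] at this
      refine this.trans ?_
      have : 0 ≤ η * (J * K') * Real.exp ((-(1 / 2) + ε) * L) := by positivity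
      nlinarith [mul_pos hK hE]
    induction J with
    | zero =>
      intro η _ hη1 hη
      exact base η (by simpa using hη) hη1 0
    | succ J ih =>
      intro η hη hη1 hJ
      by_cases hη2 : 1 / 2 ≤ η
      · exact base η hη2 hη1 _
      · rw [not_le] at hη2
        have hη0 : 0 < η := (Real.exp_pos _).trans_le hη
        have b1 := ih (2 * η) (by linarith) (by linarith) (by rw [pow_succ] at hJ; linarith)
        have b2 := h2 L η hη0 hη1
        have hpow : η ^ (1 - ε) * Real.exp (-(1 / 2) * L)
            ≤ η * Real.exp ((-(1 / 2) + ε) * L) := by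
          rw [sub_eq_add_neg, Real.rpow_add hη0, Real.rpow_one, mul_assoc]
          refine mul_le_mul_of_nonneg_left ?_ hη0.le
          have : η ^ (-ε) ≤ Real.exp (ε * L) := by
            calc η ^ (-ε) ≤ Real.exp (-(1 / 2) * L) ^ (-ε) :=
                  Real.rpow_le_rpow_of_nonpos (Real.exp_pos _) hη (by linarith)
              _ ≤ _ := by
                  rw [← Real.exp_mul, Real.exp_le_exp]; nlinarith
          calc _ ≤ Real.exp (ε * L) * Real.exp (-(1 / 2) * L) := by gcongr
            _ = _ := by rw [← Real.exp_add]; congr 1; ring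
        have b3 : |H (L + 2 * η) - 2 * H (L + η) + H L|
            ≤ η * (K' * Real.exp ((-(1 / 2) + ε) * L)) := by
          refine b2.trans ?_
          have := mul_le_mul_of_nonneg_left hpow hK'.le
          linarith
        push_cast
        have : 0 ≤ η * (K' * Real.exp ((-(1 / 2) + ε) * L)) := by positivity
        rw [abs_le] at b1 b3 ⊢
        constructor <;> linarith [b1.1, b1.2, b3.1, b3.2]
  refine ⟨2 * K + (1 + 1 / ε) * K', by positivity, fun L η hL hη hη1 => ?_⟩
  have hη0 : 0 < η := (Real.exp_pos _).trans_le hη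
  have hJ : (1 / 2 : ℝ) ^ (⌈L⌉₊ + 1) ≤ η := by
    refine le_trans ?_ hη
    have e : Real.exp (-(1 / 2) * L) = (Real.exp (1 / 2) ^ L)⁻¹ := by
      rw [← Real.exp_mul, ← Real.exp_neg]; congr 1; ring
    rw [e, show (1 / 2 : ℝ) ^ (⌈L⌉₊ + 1) = (2 ^ (⌈L⌉₊ + 1))⁻¹ by rw [one_div, inv_pow]]
    refine inv_anti₀ (by positivity) ?_
    have h2 : Real.exp (1 / 2) ≤ 2 := by
      have h3 := Real.exp_one_lt_three
      have : Real.exp 1 = Real.exp (1 / 2) * Real.exp (1 / 2) := by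
        rw [← Real.exp_add]; norm_num
      by_contra h; rw [not_le] at h; nlinarith
    calc Real.exp (1 / 2) ^ L ≤ (2:ℝ) ^ L := Real.rpow_le_rpow (Real.exp_pos _).le h2 hL
      _ ≤ (2:ℝ) ^ ((⌈L⌉₊ + 1 : ℕ) : ℝ) := Real.rpow_le_rpow_of_exponent_le (by norm_num) (by
          push_cast; linarith [Nat.le_ceil L])
      _ = _ := Real.rpow_natCast _ _
  refine (key L hL ⌈L⌉₊ η hη hη1 hJ).trans (mul_le_mul_of_nonneg_left ?_ hη0.le)
  have e : Real.exp ((-(1 / 2) + 2 * ε) * L)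
      = Real.exp ((-(1 / 2) + ε) * L) * Real.exp (ε * L) := by
    rw [← Real.exp_add]; congr 1; ring
  have h3 : (⌈L⌉₊ : ℝ) ≤ (1 + 1 / ε) * Real.exp (ε * L) := by
    have c1 := (Nat.ceil_lt_add_one hL).le
    have c2 : L ≤ Real.exp (ε * L) / ε := by
      rw [le_div_iff₀ hε]
      linarith [Real.add_one_le_exp (ε * L)]
    have c3 : 1 ≤ Real.exp (ε * L) := Real.one_le_exp (by positivity)
    calc _ ≤ L + 1 := c1
      _ ≤ Real.exp (ε * L) / ε + Real.exp (ε * L) := by linarith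
      _ = _ := by ring
  have c3 : 1 ≤ Real.exp (ε * L) := Real.one_le_exp (by positivity)
  rw [e]
  calc (2 * K + ⌈L⌉₊ * K') * Real.exp ((-(1 / 2) + ε) * L)
      ≤ (2 * K * Real.exp (ε * L) + (1 + 1 / ε) * Real.exp (ε * L) * K')
        * Real.exp ((-(1 / 2) + ε) * L) := by
        refine mul_le_mul_of_nonneg_right (add_le_add ?_ ?_) (Real.exp_pos _).le
        · exact le_mul_of_one_le_right (by positivity) c3
        · exact mul_le_mul_of_nonneg_right h3 hK'.le
    _ = _ := by ring

lemma leadAt_logSumMain (j : ℕ) (γ : ℝ) :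
    LeadAt (logSumMain j γ) (j + 1) (1 / ((j : ℝ) + 1)) := by
  constructor
  · refine Polynomial.natDegree_add_le_of_degree_le (Polynomial.natDegree_C_mul_X_pow_le _ _) ?_
    rw [Polynomial.natDegree_C]; omega
  · rw [logSumMain, Polynomial.coeff_add, Polynomial.coeff_C_mul_X_pow, Polynomial.coeff_C,
      if_pos rfl, if_neg (by omega), add_zero]

lemma exists_sqrtSmall_psum_log (j : ℕ) : ∃ P : Polynomial ℝ,
    LeadAt P (j + 1) (1 / ((j : ℝ) + 1)) ∧
    SqrtSmall (logErr (psum fun l => Real.log l ^ j / l) P) := by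
  obtain ⟨γ, h⟩ := exists_logSum_asymptotic j
  refine ⟨logSumMain j γ, leadAt_logSumMain j γ, sqrtSmall_logErr ?_⟩
  have h1 : EpsBound (-2) (fun n => psum (fun l => Real.log l ^ j / l) n
      - ((logSumMain j γ).eval (Real.log n) + 1 / 2 * (Real.log n ^ j * (n : ℝ) ^ (-1 : ℝ)))) := by
    intro ε hε
    obtain ⟨K, hK, h⟩ := h ε hε
    refine ⟨K, hK, fun n hn => ?_⟩
    have := h n (by exact_mod_cast hn)
    rw [logSum, Nat.floor_natCast] at this
    refine le_of_eq_of_le ?_ this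
    beta_reduce
    rw [logSumMain_eval, psum, Real.rpow_neg_one]
    congr 1
    ring
  have h2 := ((EpsBound.logPow j).mul (EpsBound.rpow (-1))).const_mul (1 / 2)
  refine ((h1.mono (q := -(1:ℝ)/2) (by norm_num)).add
    (h2.mono (q := -(1:ℝ)/2) (by norm_num))).congr fun n hn => by ring

lemma genSum_eq_hypSum (i j n : ℕ) : genSum i j n
    = hypSum (fun l => Real.log l ^ j / l) (fun l => Real.log l ^ i / l) n := by
  simp only [genSum, dGen_div]
  rw [sum_Icc_sum_divisorsAntidiagonal'
    (fun a b => Real.log a ^ i / a * (Real.log b ^ j / b))]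
  simp only [hypSum, psum, Finset.mul_sum]

lemma eq_of_abs_eval_sub_le {P Q : Polynomial ℝ} {K c : ℝ} (hc : c < 0)
    (h : ∀ L : ℝ, 0 ≤ L → |P.eval L - Q.eval L| ≤ K * Real.exp (c * L)) : P = Q := by
  have ht : Filter.Tendsto (fun L => (P - Q).eval L) Filter.atTop (nhds 0) := by
    refine squeeze_zero_norm' (a := fun L => K * Real.exp (c * L)) ?_ ?_
    · filter_upwards [Filter.eventually_ge_atTop 0] with L hL
      rw [Polynomial.eval_sub, Real.norm_eq_abs]
      exact h L hL
    · rw [← mul_zero K]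
      refine Filter.Tendsto.const_mul _ (Real.tendsto_exp_atBot.comp ?_)
      exact Filter.tendsto_id.const_mul_atTop_of_neg hc
  have := (Polynomial.tendsto_nhds_iff (P - Q)).1 ht
  exact sub_eq_zero.1 (Polynomial.leadingCoeff_eq_zero.1 this.1)

lemma log_pow_div_nonneg (j l : ℕ) : 0 ≤ Real.log l ^ j / l :=
  div_nonneg (pow_nonneg (Real.log_natCast_nonneg l) _) (Nat.cast_nonneg l)

lemma exists_genSum_polynomial (i j : ℕ) : ∃ P : Polynomial ℝ,
    LeadAt P (i + j + 2) ((i.factorial : ℝ) * j.factorial / (i + j + 2).factorial) ∧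
    SqrtSmall (logErr (genSum i j) P) ∧ MeanSqShift (logErr (genSum i j) P) := by
  obtain ⟨P, hP⟩ := exists_genSum_asymptotic i j
  have hs := epsBound_genSum_sub i j P hP
  have hss := sqrtSmall_logErr hs
  refine ⟨P, ?_, hss, meanSqShift_logErr (harmonicIncr_genSum i j) hs
    (shortVar_genSum_sub i j P hP)⟩
  obtain ⟨P1, hP1, h1⟩ := exists_sqrtSmall_psum_log j
  obtain ⟨P2, hP2, h2⟩ := exists_sqrtSmall_psum_log i
  obtain ⟨R, hR, h3⟩ := exists_conv_stepFn_diff h1 h2 hP1 hP2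
  obtain ⟨K, hK, h4⟩ := exists_hypSum_asymptotic (log_pow_div_nonneg j) (log_pow_div_nonneg i)
    (κ := 1 / 4) (by norm_num) (by norm_num) h3
    (exists_abs_diff_le_of_sqrtSmall (sqrtSmall_conv (causal_logErr _ _) (causal_logErr _ _) h1 h2))
    (1 / 8) (by norm_num)
  obtain ⟨K', hK', h5⟩ := hss (1 / 8) (by norm_num)
  have hPR : P = R.derivative := by
    refine eq_of_abs_eval_sub_le (K := K + K') (c := -(1 / 8)) (by norm_num) fun L hL => ?_
    have h4 := h4 L hL
    have h5 := h5 L hL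
    rw [← genSum_eq_hypSum] at h4
    rw [logErr, if_pos hL] at h5
    have e1 : Real.exp ((-(1 / 4) + 1 / 8) * L) = Real.exp (-(1 / 8) * L) := by
      congr 1; ring
    have e2 : Real.exp ((-(1:ℝ) / 2 + 1 / 8) * L) ≤ Real.exp (-(1 / 8) * L) :=
      Real.exp_le_exp.2 (by linarith)
    have e3 := mul_le_mul_of_nonneg_left e2 hK'.le
    rw [e1] at h4
    rw [abs_le] at h4 h5 ⊢
    constructor <;> linarith [h4.1, h4.2, h5.1, h5.2]
  have hlead := LeadAt.derivative hR
  rw [← hPR] at hlead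
  rw [show i + j + 2 = j + 1 + (i + 1) by ring]
  refine ⟨hlead.1, hlead.2.trans ?_⟩
  rw [Nat.factorial_succ (j + 1 + (i + 1)), Nat.factorial_succ j, Nat.factorial_succ i]
  have : ((j + 1 + (i + 1)).factorial : ℝ) ≠ 0 := by positivity
  push_cast
  field_simp

/-- The asymptotic formula for the four-dimensional divisor sums. -/
lemma exists_hypSum_dGen_asymptotic (i₁ j₁ i₂ j₂ : ℕ) : ∃ P : Polynomial ℝ,
    LeadAt P (i₁ + j₁ + i₂ + j₂ + 4) ((i₁.factorial : ℝ) * j₁.factorial * i₂.factorial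
      * j₂.factorial / (i₁ + j₁ + i₂ + j₂ + 4).factorial) ∧
    ∀ ε : ℝ, 0 < ε → ∃ K : ℝ, 0 < K ∧ ∀ y : ℝ, 1 ≤ y →
      |hypSum (fun l => dGen i₁ j₁ l / l) (fun l => dGen i₂ j₂ l / l) ⌊y⌋₊ - P.eval (Real.log y)|
        ≤ K * y ^ (-(1:ℝ)/2 + ε) := by
  obtain ⟨P1, hP1, h1, m1⟩ := exists_genSum_polynomial i₁ j₁
  obtain ⟨P2, hP2, h2, m2⟩ := exists_genSum_polynomial i₂ j₂
  obtain ⟨R, hR, h3⟩ := exists_conv_stepFn_diff h1 h2 hP1 hP2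
  have h4 := exists_hypSum_asymptotic (α := fun l => dGen i₁ j₁ l / l)
    (β := fun l => dGen i₂ j₂ l / l)
    (fun n => div_nonneg (dGen_nonneg _ _ _) (Nat.cast_nonneg n))
    (fun n => div_nonneg (dGen_nonneg _ _ _) (Nat.cast_nonneg n))
    (κ := 1 / 2) (by norm_num) le_rfl h3
    (exists_abs_conv_diff_le (causal_logErr _ _) (causal_logErr _ _) h1 h2 m1 m2)
  refine ⟨R.derivative, ?_, fun ε hε => ?_⟩
  · have := LeadAt.derivative hR
    rw [show i₁ + j₁ + i₂ + j₂ + 4 = i₁ + j₁ + 2 + (i₂ + j₂ + 2) by ring]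
    refine ⟨this.1, this.2.trans ?_⟩
    rw [Nat.factorial_succ (i₁ + j₁ + 2 + (i₂ + j₂ + 2))]
    have h1 : ((i₁ + j₁ + 2).factorial : ℝ) ≠ 0 := by positivity
    have h2 : ((i₂ + j₂ + 2).factorial : ℝ) ≠ 0 := by positivity
    have h3 : ((i₁ + j₁ + 2 + (i₂ + j₂ + 2)).factorial : ℝ) ≠ 0 := by positivity
    push_cast
    field_simp
  · obtain ⟨K, hK, h4⟩ := h4 ε hε
    refine ⟨K, hK, fun y hy => ?_⟩
    have hy0 : 0 < y := by linarith
    have := h4 (Real.log y) (Real.log_nonneg hy)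
    rw [Real.exp_log hy0, mul_comm _ (Real.log y), Real.exp_mul, Real.exp_log hy0] at this
    rw [neg_div]
    exact this

lemma sum_divisors_mul (F : ℕ → ℝ) {a v : ℕ} (ha : a ≠ 0) (hv : v ≠ 0) :
    ∑ c ∈ (a * v).divisors, F c = ∑ x ∈ a.divisorsAntidiagonal, ∑ y ∈ v.divisorsAntidiagonal,
      if Nat.Coprime x.2 y.1 then F (x.1 * y.1) else 0 := by
  rw [← Finset.sum_product', ← Finset.sum_filter]
  symm
  refine Finset.sum_bij' (fun z _ => z.1.1 * z.2.1)
    (fun c _ => ((Nat.gcd a c, a / Nat.gcd a c), (c / Nat.gcd a c, v / (c / Nat.gcd a c))))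
    ?_ ?_ ?_ ?_ ?_
  · rintro ⟨⟨g, h⟩, ⟨k, l⟩⟩ hz
    simp only [Finset.mem_filter, Finset.mem_product, Nat.mem_divisorsAntidiagonal] at hz
    obtain ⟨⟨⟨rfl, _⟩, ⟨rfl, _⟩⟩, _⟩ := hz
    exact Nat.mem_divisors.2 ⟨⟨h * l, by ring⟩, by positivity⟩
  · intro c hc
    obtain ⟨hc, _⟩ := Nat.mem_divisors.1 hc
    have hg : 0 < Nat.gcd a c := Nat.gcd_pos_of_pos_left _ (Nat.pos_of_ne_zero ha)
    have hcop : Nat.Coprime (a / Nat.gcd a c) (c / Nat.gcd a c) := Nat.coprime_div_gcd_div_gcd hg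
    have hdv : c / Nat.gcd a c ∣ v := by
      refine hcop.symm.dvd_of_dvd_mul_left ?_
      refine Nat.dvd_of_mul_dvd_mul_left hg ?_
      rw [Nat.mul_div_cancel' (Nat.gcd_dvd_right a c), ← mul_assoc,
        Nat.mul_div_cancel' (Nat.gcd_dvd_left a c)]
      exact hc
    simp only [Finset.mem_filter, Finset.mem_product, Nat.mem_divisorsAntidiagonal]
    exact ⟨⟨⟨Nat.mul_div_cancel' (Nat.gcd_dvd_left a c), ha⟩, ⟨Nat.mul_div_cancel' hdv, hv⟩⟩, hcop⟩
  · rintro ⟨⟨g, h⟩, ⟨k, l⟩⟩ hz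
    simp only [Finset.mem_filter, Finset.mem_product, Nat.mem_divisorsAntidiagonal] at hz
    obtain ⟨⟨⟨rfl, h0⟩, ⟨rfl, h1⟩⟩, hcop⟩ := hz
    have hg : 0 < g := Nat.pos_of_ne_zero fun h => h0 (by rw [h, zero_mul])
    have hk : 0 < k := Nat.pos_of_ne_zero fun h => h1 (by rw [h, zero_mul])
    have e : Nat.gcd (g * h) (g * k) = g := by
      rw [Nat.gcd_mul_left, Nat.Coprime.gcd_eq_one hcop, mul_one]
    simp only [e, Nat.mul_div_cancel_left _ hg, Nat.mul_div_cancel_left _ hk]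
  · intro c hc
    exact Nat.mul_div_cancel' (Nat.gcd_dvd_right a c)
  · intros; rfl

/-- Sum of `G` over the quadruples of positive integers with product at most `M`. -/
noncomputable def quadSum (M : ℕ) (G : ℕ → ℕ → ℕ → ℕ → ℝ) : ℝ :=
  ∑ g ∈ Finset.Icc 1 M, ∑ h ∈ Finset.Icc 1 (M / g), ∑ k ∈ Finset.Icc 1 (M / (g * h)),
    ∑ l ∈ Finset.Icc 1 (M / (g * h) / k), G g h k l

lemma sum_sum_antidiagonal_eq_quadSum (M : ℕ) (G : ℕ → ℕ → ℕ → ℕ → ℝ) :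
    ∑ n ∈ Finset.Icc 1 M, ∑ x ∈ n.divisorsAntidiagonal, ∑ m ∈ Finset.Icc 1 (M / n),
      ∑ y ∈ m.divisorsAntidiagonal, G x.1 x.2 y.1 y.2 = quadSum M G := by
  have e : ∀ n, ∑ x ∈ n.divisorsAntidiagonal, ∑ m ∈ Finset.Icc 1 (M / n),
      ∑ y ∈ m.divisorsAntidiagonal, G x.1 x.2 y.1 y.2
      = ∑ x ∈ n.divisorsAntidiagonal, (fun g h => ∑ k ∈ Finset.Icc 1 (M / (g * h)),
        ∑ l ∈ Finset.Icc 1 (M / (g * h) / k), G g h k l) x.1 x.2 := fun n => by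
    refine Finset.sum_congr rfl fun x hx => ?_
    beta_reduce
    rw [(Nat.mem_divisorsAntidiagonal.1 hx).1, ← sum_Icc_sum_divisorsAntidiagonal'
      (fun k l => G x.1 x.2 k l)]
  simp only [e]
  rw [sum_Icc_sum_divisorsAntidiagonal' fun g h => ∑ k ∈ Finset.Icc 1 (M / (g * h)),
        ∑ l ∈ Finset.Icc 1 (M / (g * h) / k), G g h k l]
  rfl

lemma quadSum_congr {M : ℕ} {G G' : ℕ → ℕ → ℕ → ℕ → ℝ}
    (h : ∀ g h k l, 1 ≤ g → 1 ≤ h → 1 ≤ k → 1 ≤ l → g * h * k * l ≤ M → G g h k l = G' g h k l) :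
    quadSum M G = quadSum M G' := by
  refine Finset.sum_congr rfl fun a ha => Finset.sum_congr rfl fun b hb =>
    Finset.sum_congr rfl fun c hc => Finset.sum_congr rfl fun d hd => ?_
  rw [Finset.mem_Icc] at ha hb hc hd
  refine h a b c d ha.1 hb.1 hc.1 hd.1 ?_
  have := hd.2
  rwa [Nat.div_div_eq_div_mul, Nat.le_div_iff_mul_le
    (Nat.mul_pos (Nat.mul_pos ha.1 hb.1) hc.1), mul_comm] at this

lemma quadSum_sum {ι : Type*} (s : Finset ι) (M : ℕ) (G : ι → ℕ → ℕ → ℕ → ℕ → ℝ) :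
    quadSum M (fun g h k l => ∑ e ∈ s, G e g h k l) = ∑ e ∈ s, quadSum M (G e) := by
  simp only [quadSum]
  rw [Finset.sum_comm]
  refine Finset.sum_congr rfl fun g _ => ?_
  rw [Finset.sum_comm]
  refine Finset.sum_congr rfl fun h _ => ?_
  rw [Finset.sum_comm]
  refine Finset.sum_congr rfl fun k _ => ?_
  rw [Finset.sum_comm]

lemma quadSum_const_mul (c : ℝ) (M : ℕ) (G : ℕ → ℕ → ℕ → ℕ → ℝ) :
    quadSum M (fun g h k l => c * G g h k l) = c * quadSum M G := by
  simp only [quadSum, Finset.mul_sum]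

lemma sum_Icc_ite_dvd (e M : ℕ) (he : 1 ≤ e) (F : ℕ → ℝ) :
    (∑ h ∈ Finset.Icc 1 M, if e ∣ h then F h else 0) = ∑ h ∈ Finset.Icc 1 (M / e), F (e * h) := by
  rw [← Finset.sum_filter]
  symm
  refine Finset.sum_bij' (fun h _ => e * h) (fun h _ => h / e) ?_ ?_ ?_ ?_ ?_
  · intro h hh
    rw [Finset.mem_Icc, Nat.le_div_iff_mul_le (by omega)] at hh
    rw [Finset.mem_filter, Finset.mem_Icc]
    exact ⟨⟨Nat.mul_pos he hh.1, by rw [mul_comm]; exact hh.2⟩, dvd_mul_right _ _⟩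
  · intro h hh
    rw [Finset.mem_filter, Finset.mem_Icc] at hh
    rw [Finset.mem_Icc]
    exact ⟨Nat.div_pos (Nat.le_of_dvd hh.1.1 hh.2) he, Nat.div_le_div_right hh.1.2⟩
  · intro h _
    exact Nat.mul_div_cancel_left _ he
  · intro h hh
    exact Nat.mul_div_cancel' (Finset.mem_filter.1 hh).2
  · intros; rfl

lemma quadSum_ite_dvd (e M : ℕ) (he : 1 ≤ e) (G : ℕ → ℕ → ℕ → ℕ → ℝ) :
    quadSum M (fun g h k l => if e ∣ h ∧ e ∣ k then G g h k l else 0)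
      = quadSum (M / e ^ 2) (fun g h k l => G g (e * h) (e * k) l) := by
  have e1 : quadSum M (fun g h k l => if e ∣ h ∧ e ∣ k then G g h k l else 0)
      = ∑ g ∈ Finset.Icc 1 M, ∑ h ∈ Finset.Icc 1 (M / g / e),
        ∑ k ∈ Finset.Icc 1 (M / e ^ 2 / (g * h)), ∑ l ∈ Finset.Icc 1 (M / e ^ 2 / (g * h) / k),
          G g (e * h) (e * k) l := by
    refine Finset.sum_congr rfl fun g _ => ?_
    have e2 : ∀ h, (∑ k ∈ Finset.Icc 1 (M / (g * h)), ∑ l ∈ Finset.Icc 1 (M / (g * h) / k),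
        if e ∣ h ∧ e ∣ k then G g h k l else 0) = if e ∣ h then
          (∑ k ∈ Finset.Icc 1 (M / (g * h)), if e ∣ k then
            ∑ l ∈ Finset.Icc 1 (M / (g * h) / k), G g h k l else 0) else 0 := by
      intro h
      by_cases h1 : e ∣ h
      · simp only [h1, true_and, if_true]
        refine Finset.sum_congr rfl fun k _ => ?_
        by_cases h2 : e ∣ k <;> simp [h2]
      · simp [h1]
    beta_reduce
    simp only [e2]
    rw [sum_Icc_ite_dvd e _ he (fun h => ∑ k ∈ Finset.Icc 1 (M / (g * h)), if e ∣ k then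
            ∑ l ∈ Finset.Icc 1 (M / (g * h) / k), G g h k l else 0)]
    refine Finset.sum_congr rfl fun h _ => ?_
    rw [sum_Icc_ite_dvd e _ he (fun k => ∑ l ∈ Finset.Icc 1 (M / (g * (e * h)) / k),
      G g (e * h) k l)]
    have e3 : M / (g * (e * h)) / e = M / e ^ 2 / (g * h) := by
      rw [Nat.div_div_eq_div_mul, Nat.div_div_eq_div_mul]
      congr 1; ring
    rw [e3]
    refine Finset.sum_congr rfl fun k _ => ?_
    rw [← Nat.div_div_eq_div_mul, e3]
  rw [e1]
  have sub : ∀ {a b : ℕ}, a ≤ b → Finset.Icc 1 a ⊆ Finset.Icc 1 b := fun h =>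
    Finset.Icc_subset_Icc le_rfl h
  have z : ∀ g h, M / e ^ 2 < g * h → M / e ^ 2 / (g * h) = 0 := fun g h hh =>
    Nat.div_eq_of_lt hh
  symm
  have e4 : ∀ g ∈ Finset.Icc 1 M, ∑ h ∈ Finset.Icc 1 (M / e ^ 2 / g),
        ∑ k ∈ Finset.Icc 1 (M / e ^ 2 / (g * h)), ∑ l ∈ Finset.Icc 1 (M / e ^ 2 / (g * h) / k),
          G g (e * h) (e * k) l = ∑ h ∈ Finset.Icc 1 (M / g / e),
        ∑ k ∈ Finset.Icc 1 (M / e ^ 2 / (g * h)), ∑ l ∈ Finset.Icc 1 (M / e ^ 2 / (g * h) / k),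
          G g (e * h) (e * k) l := by
    intro g hg
    rw [Finset.mem_Icc] at hg
    refine Finset.sum_subset (sub ?_) ?_
    · rw [Nat.div_div_eq_div_mul, Nat.div_div_eq_div_mul]
      refine Nat.div_le_div_left ?_ (Nat.mul_pos hg.1 he)
      nlinarith [Nat.mul_le_mul_left (e * g) he]
    · intro h h1 h2
      rw [Finset.mem_Icc] at h1 h2
      have : M / e ^ 2 < g * h := by
        by_contra h3
        exact h2 ⟨h1.1, (Nat.le_div_iff_mul_le hg.1).2 (by rw [mul_comm]; omega)⟩
      rw [z g h this]; simp
  rw [← Finset.sum_congr rfl e4]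
  refine Finset.sum_subset (sub (Nat.div_le_self _ _)) ?_
  intro g h1 h2
  rw [Finset.mem_Icc] at h1 h2
  have : M / e ^ 2 / g = 0 := Nat.div_eq_of_lt (by omega)
  rw [this]; simp

lemma quadSum_log_pow_div (a b c d M : ℕ) :
    quadSum M (fun g h k l => Real.log g ^ a / g * (Real.log h ^ b / h) *
      (Real.log k ^ c / k * (Real.log l ^ d / l)))
      = hypSum (fun l => dGen c d l / l) (fun n => dGen a b n / n) M := by
  rw [← sum_sum_antidiagonal_eq_quadSum]
  refine Finset.sum_congr rfl fun n _ => ?_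
  beta_reduce
  rw [dGen_div, Finset.sum_mul]
  refine Finset.sum_congr rfl fun x _ => ?_
  rw [psum, Finset.mul_sum]
  refine Finset.sum_congr rfl fun m _ => ?_
  rw [dGen_div, Finset.mul_sum]

lemma dLog_eq_sum_divisors (ν n : ℕ) : dLog ν n = ∑ c ∈ n.divisors, Real.log c ^ ν := by
  simp only [dLog, dGen, pow_zero, mul_one]
  exact Nat.sum_divisorsAntidiagonal (fun c _ => Real.log c ^ ν)

lemma sum_dLog_mul_dLog_eq_quadSum (μ ν N : ℕ) :
    ∑ n ∈ Finset.Icc 1 N, dLog μ n * dLog ν n / n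
      = quadSum N (fun g h k l => if Nat.Coprime h k then
          Real.log (g * h : ℕ) ^ μ * Real.log (g * k : ℕ) ^ ν / ((g * h) * (k * l)) else 0) := by
  have e1 : ∀ n, dLog μ n * dLog ν n / n = ∑ x ∈ n.divisorsAntidiagonal,
      (fun a v : ℕ => Real.log a ^ μ * dLog ν (a * v) / (a * v)) x.1 x.2 := by
    intro n
    conv_lhs => rw [dLog, dGen]
    rw [Finset.sum_mul, Finset.sum_div]
    refine Finset.sum_congr rfl fun x hx => ?_
    have := (Nat.mem_divisorsAntidiagonal.1 hx).1
    beta_reduce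
    rw [← Nat.cast_mul, this, pow_zero, mul_one]
  rw [Finset.sum_congr rfl fun n _ => e1 n, sum_Icc_sum_divisorsAntidiagonal'
    (fun a v : ℕ => Real.log a ^ μ * dLog ν (a * v) / (a * v)),
    ← sum_sum_antidiagonal_eq_quadSum]
  refine Finset.sum_congr rfl fun a ha => ?_
  rw [Finset.mem_Icc] at ha
  rw [Finset.sum_comm]
  refine Finset.sum_congr rfl fun v hv => ?_
  rw [Finset.mem_Icc] at hv
  rw [dLog_eq_sum_divisors, sum_divisors_mul (fun c => Real.log c ^ ν) (by omega) (by omega),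
    Finset.mul_sum, Finset.sum_div]
  refine Finset.sum_congr rfl fun x hx => ?_
  rw [Finset.mul_sum, Finset.sum_div]
  refine Finset.sum_congr rfl fun y hy => ?_
  split_ifs
  · have h1 := (Nat.mem_divisorsAntidiagonal.1 hx).1
    have h2 := (Nat.mem_divisorsAntidiagonal.1 hy).1
    rw [h1, ← Nat.cast_mul x.1, h1, ← Nat.cast_mul y.1, h2]
  · simp

lemma ite_coprime_eq_sum_moebius {h k N : ℕ} (hh : 1 ≤ h) (hN : h ≤ N) :
    (if Nat.Coprime h k then (1:ℝ) else 0) = ∑ e ∈ Finset.Icc 1 N,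
      if e ∣ h ∧ e ∣ k then (ArithmeticFunction.moebius e : ℝ) else 0 := by
  rw [← Finset.sum_filter]
  have e1 : Finset.filter (fun e => e ∣ h ∧ e ∣ k) (Finset.Icc 1 N) = (Nat.gcd h k).divisors := by
    ext e
    rw [Finset.mem_filter, Finset.mem_Icc, Nat.mem_divisors, Nat.dvd_gcd_iff]
    refine ⟨fun h1 => ⟨h1.2, Nat.gcd_ne_zero_left (by omega)⟩, fun h1 => ⟨⟨?_, ?_⟩, h1.1⟩⟩
    · exact Nat.pos_of_dvd_of_pos h1.1.1 hh
    · exact (Nat.le_of_dvd hh h1.1.1).trans hN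
  rw [e1]
  have := congrArg (fun f => ((f (Nat.gcd h k) : ℤ) : ℝ)) ArithmeticFunction.moebius_mul_coe_zeta
  simp only [ArithmeticFunction.coe_mul_zeta_apply, ArithmeticFunction.one_apply] at this
  push_cast at this
  rw [this]

lemma sum_dLog_mul_dLog_eq_sum_quadSum (μ ν N : ℕ) :
    ∑ n ∈ Finset.Icc 1 N, dLog μ n * dLog ν n / n
      = ∑ e ∈ Finset.Icc 1 N, (ArithmeticFunction.moebius e : ℝ) / (e:ℝ) ^ 2 *
        quadSum (N / e ^ 2) (fun g h k l =>
          (Real.log e + Real.log g + Real.log h) ^ μ * (Real.log e + Real.log g + Real.log k) ^ ν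
            / ((g * h) * (k * l))) := by
  rw [sum_dLog_mul_dLog_eq_quadSum]
  set H : ℕ → ℕ → ℕ → ℕ → ℝ := fun g h k l =>
    Real.log (g * h : ℕ) ^ μ * Real.log (g * k : ℕ) ^ ν / ((g * h) * (k * l)) with hH
  have e1 : quadSum N (fun g h k l => if Nat.Coprime h k then H g h k l else 0)
      = quadSum N (fun g h k l => ∑ e ∈ Finset.Icc 1 N, (ArithmeticFunction.moebius e : ℝ) *
        if e ∣ h ∧ e ∣ k then H g h k l else 0) := by
    refine quadSum_congr fun g h k l hg hh hk hl hM => ?_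
    have hN : h ≤ N := by
      refine le_trans ?_ hM
      calc h = 1 * h * 1 * 1 := by ring
        _ ≤ _ := by gcongr
    have := congrArg (fun z => z * H g h k l) (ite_coprime_eq_sum_moebius (k := k) hh hN)
    simp only [ite_mul, one_mul, zero_mul, Finset.sum_mul] at this
    rw [this]
    refine Finset.sum_congr rfl fun e _ => ?_
    split_ifs <;> simp
  rw [e1, quadSum_sum]
  refine Finset.sum_congr rfl fun e he => ?_
  have he1 := (Finset.mem_Icc.1 he).1
  rw [quadSum_const_mul, quadSum_ite_dvd e N he1, div_eq_mul_inv, mul_assoc, ← quadSum_const_mul ((e:ℝ) ^ 2)⁻¹]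
  congr 1
  refine quadSum_congr fun g h k l hg hh hk hl _ => ?_
  have e0 : (e:ℝ) ≠ 0 := by positivity
  have g0 : (g:ℝ) ≠ 0 := by positivity
  have h0 : (h:ℝ) ≠ 0 := by positivity
  have k0 : (k:ℝ) ≠ 0 := by positivity
  simp only [hH]
  push_cast
  rw [Real.log_mul g0 (by positivity), Real.log_mul g0 (by positivity), Real.log_mul e0 h0,
    Real.log_mul e0 k0]
  have l0 : (l:ℝ) ≠ 0 := by positivity
  rw [show Real.log g + (Real.log e + Real.log h) = Real.log e + Real.log g + Real.log h by ring,
    show Real.log g + (Real.log e + Real.log k) = Real.log e + Real.log g + Real.log k by ring]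
  field_simp

lemma log_pow_mul_log_pow_expand (x g h k : ℝ) (μ ν : ℕ) :
    (x + g + h) ^ μ * (x + g + k) ^ ν
      = ∑ i ∈ Finset.range (μ + 1), ∑ j ∈ Finset.range (ν + 1), ∑ s ∈ Finset.range (i + j + 1),
        ((Nat.choose μ i * Nat.choose ν j * Nat.choose (i + j) s : ℕ) : ℝ) * x ^ s *
          (g ^ (i + j - s) * h ^ (μ - i) * k ^ (ν - j)) := by
  rw [add_pow, add_pow, Finset.sum_mul_sum]
  refine Finset.sum_congr rfl fun i _ => Finset.sum_congr rfl fun j _ => ?_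
  have e : (x + g) ^ i * h ^ (μ - i) * (Nat.choose μ i : ℝ) *
      ((x + g) ^ j * k ^ (ν - j) * (Nat.choose ν j : ℝ))
      = (x + g) ^ (i + j) * (h ^ (μ - i) * k ^ (ν - j) * Nat.choose μ i * Nat.choose ν j) := by
    ring
  rw [e, add_pow, Finset.sum_mul]
  refine Finset.sum_congr rfl fun s _ => ?_
  push_cast
  ring

lemma sum_dLog_mul_dLog_eq_sum_hypSum (μ ν N : ℕ) :
    ∑ n ∈ Finset.Icc 1 N, dLog μ n * dLog ν n / n
      = ∑ i ∈ Finset.range (μ + 1), ∑ j ∈ Finset.range (ν + 1), ∑ s ∈ Finset.range (i + j + 1),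
        ((Nat.choose μ i * Nat.choose ν j * Nat.choose (i + j) s : ℕ) : ℝ) *
        ∑ e ∈ Finset.Icc 1 N, (ArithmeticFunction.moebius e : ℝ) / (e:ℝ) ^ 2 * Real.log e ^ s *
          hypSum (fun l => dGen (ν - j) 0 l / l) (fun n => dGen (i + j - s) (μ - i) n / n)
            (N / e ^ 2) := by
  rw [sum_dLog_mul_dLog_eq_sum_quadSum]
  have e1 : ∀ e M : ℕ, quadSum M (fun g h k l =>
          (Real.log e + Real.log g + Real.log h) ^ μ * (Real.log e + Real.log g + Real.log k) ^ ν
            / ((g * h) * (k * l)))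
      = ∑ i ∈ Finset.range (μ + 1), ∑ j ∈ Finset.range (ν + 1), ∑ s ∈ Finset.range (i + j + 1),
        ((Nat.choose μ i * Nat.choose ν j * Nat.choose (i + j) s : ℕ) : ℝ) * Real.log e ^ s *
        hypSum (fun l => dGen (ν - j) 0 l / l) (fun n => dGen (i + j - s) (μ - i) n / n) M := by
    intro e M
    simp only [← quadSum_log_pow_div, ← quadSum_const_mul, ← quadSum_sum]
    refine quadSum_congr fun g h k l _ _ _ _ _ => ?_
    rw [log_pow_mul_log_pow_expand]
    simp only [Finset.sum_div]
    refine Finset.sum_congr rfl fun i _ => Finset.sum_congr rfl fun j _ =>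
      Finset.sum_congr rfl fun s _ => ?_
    rw [mul_div_assoc]
    congr 1
    rw [pow_zero, div_mul_div_comm, div_mul_div_comm, div_mul_div_comm, mul_one]
  simp only [e1, Finset.mul_sum]
  rw [Finset.sum_comm]
  refine Finset.sum_congr rfl fun i _ => ?_
  rw [Finset.sum_comm]
  refine Finset.sum_congr rfl fun j _ => ?_
  rw [Finset.sum_comm]
  refine Finset.sum_congr rfl fun s _ => Finset.sum_congr rfl fun e _ => ?_
  ring

lemma EpsBound.summable {p : ℝ} {F : ℕ → ℝ} (h : EpsBound p F) (hp : p < -1) : Summable F := by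
  obtain ⟨K, hK, hF⟩ := h ((-1 - p) / 2) (by linarith)
  have hs : Summable fun n : ℕ => K * (n : ℝ) ^ (p + (-1 - p) / 2) :=
    (Real.summable_nat_rpow.2 (by linarith)).mul_left K
  rw [← summable_nat_add_iff 1] at hs ⊢
  refine Summable.of_norm_bounded hs fun n => ?_
  rw [Real.norm_eq_abs]
  exact hF (n + 1) (by omega)

lemma exists_abs_floor_sub_le {H : ℕ → ℝ} (H0 : H 0 = 0) {P : Polynomial ℝ}
    (hH : ∀ ε : ℝ, 0 < ε → ∃ K : ℝ, 0 < K ∧ ∀ y : ℝ, 1 ≤ y →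
      |H ⌊y⌋₊ - P.eval (Real.log y)| ≤ K * y ^ (-(1:ℝ)/2 + ε)) {δ : ℝ} (hδ : 0 < δ)
    (hδ' : δ < 1 / 2) :
    ∃ K : ℝ, 0 < K ∧ ∀ y : ℝ, 0 < y →
      |H ⌊y⌋₊ - P.eval (Real.log y)| ≤ K * y ^ (-(1:ℝ)/2 + δ) := by
  obtain ⟨K, hK, h⟩ := hH δ hδ
  obtain ⟨K', hK', h'⟩ := exists_abs_eval_le_exp (P.comp (-Polynomial.X))
    (ε := 1 / 2 - δ) (by linarith)
  refine ⟨K + K', by positivity, fun y hy => ?_⟩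
  have hp : 0 < y ^ (-(1:ℝ)/2 + δ) := Real.rpow_pos_of_pos hy _
  rcases le_or_gt 1 y with h1 | h1
  · refine (h y h1).trans ?_
    gcongr
    linarith
  · rw [Nat.floor_eq_zero.2 h1, H0, zero_sub, abs_neg]
    have := h' (-Real.log y) (by linarith [Real.log_nonpos hy.le h1.le])
    rw [Polynomial.eval_comp, Polynomial.eval_neg, Polynomial.eval_X, neg_neg] at this
    refine this.trans ?_
    rw [Real.rpow_def_of_pos hy, show (1 / 2 - δ) * -Real.log y = Real.log y * (-1 / 2 + δ) by ring]
    gcongr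
    linarith

/-- The polynomial in `L` with values `∑ w e * P (L - 2 log e)`. -/
noncomputable def weightedShift (w : ℕ → ℝ) (P : Polynomial ℝ) (D : ℕ) : Polynomial ℝ :=
  ∑ i ∈ Finset.range (D + 1), Polynomial.monomial i
    (∑' e : ℕ, w e * (Polynomial.hasseDeriv i P).eval (-2 * Real.log e))

lemma leadAt_weightedShift (w : ℕ → ℝ) {P : Polynomial ℝ} {D : ℕ} {c : ℝ} (hP : LeadAt P D c) :
    LeadAt (weightedShift w P D) D (c * ∑' e, w e) := by
  refine ⟨?_, ?_⟩
  · refine Polynomial.natDegree_sum_le_of_forall_le _ _ fun i hi => ?_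
    exact (Polynomial.natDegree_monomial_le _).trans (by rw [Finset.mem_range] at hi; omega)
  · rw [weightedShift, Polynomial.finsetSum_coeff]
    simp only [Polynomial.coeff_monomial]
    rw [Finset.sum_ite_eq' (Finset.range (D + 1)) D]
    simp only [Finset.mem_range, Nat.lt_succ_self, if_true]
    have e : Polynomial.hasseDeriv D P = Polynomial.C c := by
      rw [Polynomial.eq_C_of_natDegree_le_zero (p := Polynomial.hasseDeriv D P)]
      · rw [Polynomial.hasseDeriv_coeff, zero_add, Nat.choose_self, hP.2]
        simp
      · exact (Polynomial.natDegree_hasseDeriv_le P D).trans (by have := hP.1; omega)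
    simp only [e, Polynomial.eval_C]
    rw [tsum_mul_right, mul_comm]

lemma EpsBound.summable_mul_eval_log {w : ℕ → ℝ} (hw : EpsBound (-2) w) (R : Polynomial ℝ) :
    Summable fun e : ℕ => w e * R.eval (-2 * Real.log e) := by
  refine ((hw.polyLog_mul (R.comp (-2 * Polynomial.X))).congr fun n _ => ?_).summable (by norm_num)
  simp [mul_comm]

lemma eval_weightedShift {w : ℕ → ℝ} (hw : EpsBound (-2) w) {P : Polynomial ℝ} {D : ℕ}
    (hP : P.natDegree ≤ D) (L : ℝ) :
    (weightedShift w P D).eval L = ∑' e : ℕ, w e * P.eval (L - 2 * Real.log e) := by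
  have e1 : ∀ e : ℕ, w e * P.eval (L - 2 * Real.log e) = ∑ i ∈ Finset.range (D + 1),
      w e * (Polynomial.hasseDeriv i P).eval (-2 * Real.log e) * L ^ i := by
    intro e
    rw [show L - 2 * Real.log e = L + -2 * Real.log e by ring, ← Polynomial.taylor_eval,
      Polynomial.eval_eq_sum_range' (n := D + 1) (by rw [Polynomial.natDegree_taylor]; omega),
      Finset.mul_sum]
    simp only [Polynomial.taylor_coeff, mul_assoc]
  simp only [e1]
  rw [Summable.tsum_finsetSum fun i _ => (hw.summable_mul_eval_log _).mul_right _, weightedShift,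
    Polynomial.eval_finsetSum]
  refine Finset.sum_congr rfl fun i _ => ?_
  rw [Polynomial.eval_monomial, tsum_mul_right]

lemma exists_sum_weight_asymptotic {w : ℕ → ℝ} (hw : EpsBound (-2) w) (hw0 : w 0 = 0)
    {H : ℕ → ℝ} (H0 : H 0 = 0) {P : Polynomial ℝ} {D : ℕ} {c : ℝ} (hP : LeadAt P D c)
    (hH : ∀ ε : ℝ, 0 < ε → ∃ K : ℝ, 0 < K ∧ ∀ y : ℝ, 1 ≤ y →
      |H ⌊y⌋₊ - P.eval (Real.log y)| ≤ K * y ^ (-(1:ℝ)/2 + ε)) :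
    ∃ Q : Polynomial ℝ, LeadAt Q D (c * ∑' e, w e) ∧ ∀ ε : ℝ, 0 < ε → ∃ K : ℝ, 0 < K ∧
      ∀ t : ℝ, 1 ≤ t → |(∑ e ∈ Finset.Icc 1 ⌊t⌋₊, w e * H (⌊t⌋₊ / e ^ 2)) - Q.eval (Real.log t)|
        ≤ K * t ^ (-(1:ℝ)/2 + ε) := by
  refine ⟨weightedShift w P D, leadAt_weightedShift w hP, fun ε hε => ?_⟩
  set δ := min ε (1 / 4) with hδdef
  have hδ : 0 < δ := lt_min hε (by norm_num)
  have hδ4 : δ ≤ 1 / 4 := min_le_right _ _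
  have hδε : δ ≤ ε := min_le_left _ _
  obtain ⟨K₁, hK₁, h₁⟩ := hw δ hδ
  obtain ⟨K₂, hK₂, h₂⟩ := exists_abs_floor_sub_le H0 hH hδ (by linarith)
  have hs : Summable fun e : ℕ => (e : ℝ) ^ (-1 - δ) := Real.summable_nat_rpow.2 (by linarith)
  have hS : 0 ≤ ∑' e : ℕ, (e : ℝ) ^ (-1 - δ) := tsum_nonneg fun e => by positivity
  refine ⟨K₁ * K₂ * (∑' e : ℕ, (e : ℝ) ^ (-1 - δ)) + 1, by positivity, fun t ht => ?_⟩
  have ht0 : 0 < t := by linarith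
  have z : ∀ e ∉ Finset.Icc 1 ⌊t⌋₊, w e * H (⌊t⌋₊ / e ^ 2) = 0 := fun e he => by
    rw [Finset.mem_Icc] at he
    rcases Nat.eq_zero_or_pos e with h0 | h0
    · rw [h0, hw0, zero_mul]
    · have : ⌊t⌋₊ < e := by omega
      rw [Nat.div_eq_of_lt (by nlinarith), H0, mul_zero]
  have s1 : Summable fun e => w e * H (⌊t⌋₊ / e ^ 2) := summable_of_ne_finset_zero z
  have s2 : Summable fun e : ℕ => w e * P.eval (Real.log t - 2 * Real.log e) := by
    refine (hw.summable_mul_eval_log (Polynomial.taylor (Real.log t) P)).congr fun e => ?_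
    rw [Polynomial.taylor_eval]
    congr 2; ring
  have e1 : ∑' e, w e * H (⌊t⌋₊ / e ^ 2) = ∑ e ∈ Finset.Icc 1 ⌊t⌋₊, w e * H (⌊t⌋₊ / e ^ 2) :=
    tsum_eq_sum z
  rw [← e1, eval_weightedShift hw hP.1, ← s1.tsum_sub s2, ← Real.norm_eq_abs]
  have b : ∀ e : ℕ, ‖w e * H (⌊t⌋₊ / e ^ 2) - w e * P.eval (Real.log t - 2 * Real.log e)‖
      ≤ K₁ * K₂ * t ^ (-(1:ℝ)/2 + δ) * (e : ℝ) ^ (-1 - δ) := by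
    intro e
    rcases Nat.eq_zero_or_pos e with h0 | h0
    · rw [h0, hw0, zero_mul, zero_mul, sub_zero, norm_zero]
      positivity
    · have he : (0:ℝ) < e := by exact_mod_cast h0
      have hfl : ⌊t⌋₊ / e ^ 2 = ⌊t / (e:ℝ) ^ 2⌋₊ := by
        rw [← Nat.floor_div_natCast]; push_cast; rfl
      have hlog : Real.log t - 2 * Real.log e = Real.log (t / (e:ℝ) ^ 2) := by
        rw [Real.log_div ht0.ne' (by positivity), Real.log_pow]; push_cast; rfl
      rw [← mul_sub, norm_mul, Real.norm_eq_abs, Real.norm_eq_abs, hfl, hlog]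
      refine (mul_le_mul (h₁ e h0) (h₂ _ (by positivity)) (abs_nonneg _) (by positivity)).trans ?_
      rw [Real.div_rpow ht0.le (by positivity), ← Real.rpow_natCast (e:ℝ) 2, ← Real.rpow_mul he.le,
        div_eq_mul_inv, ← Real.rpow_neg he.le]
      have : (e:ℝ) ^ (-1 - δ) = (e:ℝ) ^ (-2 + δ) * (e:ℝ) ^ (-(((2:ℕ):ℝ) * (-(1:ℝ)/2 + δ))) := by
        rw [← Real.rpow_add he]
        congr 1; push_cast; ring
      rw [this]
      apply le_of_eq; ring
  refine (tsum_of_norm_bounded (hs.mul_left _).hasSum b).trans ?_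
  rw [tsum_mul_left]
  have : t ^ (-(1:ℝ)/2 + δ) ≤ t ^ (-(1:ℝ)/2 + ε) := Real.rpow_le_rpow_of_exponent_le ht (by linarith)
  have hp : 0 < t ^ (-(1:ℝ)/2 + ε) := Real.rpow_pos_of_pos ht0 _
  calc _ = K₁ * K₂ * (∑' e : ℕ, (e : ℝ) ^ (-1 - δ)) * t ^ (-(1:ℝ)/2 + δ) := by ring
    _ ≤ K₁ * K₂ * (∑' e : ℕ, (e : ℝ) ^ (-1 - δ)) * t ^ (-(1:ℝ)/2 + ε) := by gcongr
    _ ≤ _ := by linarith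

/-- `S t` equals a polynomial in `log t` with coefficient `c` in degree `D`, up to an error
`O(t ^ (-1/2 + ε))`. -/
def HasLogAsymptotic (S : ℝ → ℝ) (D : ℕ) (c : ℝ) : Prop :=
  ∃ Q : Polynomial ℝ, LeadAt Q D c ∧ ∀ ε : ℝ, 0 < ε → ∃ K : ℝ, 0 < K ∧
    ∀ t : ℝ, 1 ≤ t → |S t - Q.eval (Real.log t)| ≤ K * t ^ (-(1:ℝ)/2 + ε)

lemma HasLogAsymptotic.const_mul {S : ℝ → ℝ} {D : ℕ} {c : ℝ} (a : ℝ) (h : HasLogAsymptotic S D c) :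
    HasLogAsymptotic (fun t => a * S t) D (a * c) := by
  obtain ⟨Q, hQ, h⟩ := h
  refine ⟨Polynomial.C a * Q, ⟨(Polynomial.natDegree_C_mul_le a Q).trans hQ.1, ?_⟩, fun ε hε => ?_⟩
  · rw [Polynomial.coeff_C_mul, hQ.2]
  · obtain ⟨K, hK, h⟩ := h ε hε
    refine ⟨(|a| + 1) * K, by positivity, fun t ht => ?_⟩
    rw [Polynomial.eval_mul, Polynomial.eval_C, ← mul_sub, abs_mul, mul_assoc]
    exact mul_le_mul (by linarith) (h t ht) (abs_nonneg _) (by positivity)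

lemma HasLogAsymptotic.sum {ι : Type*} (s : Finset ι) {S : ι → ℝ → ℝ} {D : ℕ} {c : ι → ℝ}
    (h : ∀ i ∈ s, HasLogAsymptotic (S i) D (c i)) :
    HasLogAsymptotic (fun t => ∑ i ∈ s, S i t) D (∑ i ∈ s, c i) := by
  classical
  induction s using Finset.induction_on with
  | empty =>
    refine ⟨0, ⟨by simp, by simp⟩, fun ε _ => ⟨1, one_pos, fun t ht => ?_⟩⟩
    have : 0 ≤ t := by linarith
    simp only [Finset.sum_empty, Polynomial.eval_zero, sub_zero, abs_zero]
    positivity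
  | insert a s ha ih =>
    obtain ⟨Q, hQ, h1⟩ := ih fun i hi => h i (Finset.mem_insert_of_mem hi)
    obtain ⟨R, hR, h2⟩ := h a (Finset.mem_insert_self a s)
    simp only [Finset.sum_insert ha]
    refine ⟨R + Q, hR.add hQ, fun ε hε => ?_⟩
    obtain ⟨K, hK, h1⟩ := h1 ε hε
    obtain ⟨K', hK', h2⟩ := h2 ε hε
    refine ⟨K' + K, by positivity, fun t ht => ?_⟩
    rw [Polynomial.eval_add, add_sub_add_comm, add_mul]
    exact (abs_add_le _ _).trans (add_le_add (h2 t ht) (h1 t ht))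

lemma HasLogAsymptotic.of_lt {S : ℝ → ℝ} {D D' : ℕ} {c : ℝ} (h : HasLogAsymptotic S D c)
    (hD : D < D') : HasLogAsymptotic S D' 0 := by
  obtain ⟨Q, hQ, h⟩ := h
  exact ⟨Q, LeadAt.of_natDegree_lt (hQ.1.trans_lt hD), h⟩

lemma epsBound_moebius_div_sq (s : ℕ) : EpsBound (-2)
    (fun e => (ArithmeticFunction.moebius e : ℝ) / (e:ℝ) ^ 2 * Real.log e ^ s) := by
  have h1 : EpsBound 0 (fun e => (ArithmeticFunction.moebius e : ℝ)) :=
    EpsBound.of_bounded 1 fun n _ => by exact_mod_cast ArithmeticFunction.abs_moebius_le_one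
  have h := (h1.mul (EpsBound.rpow (-2))).mul (EpsBound.logPow s)
  rw [zero_add, add_zero] at h
  refine h.congr fun n hn => ?_
  rw [Real.rpow_neg (by positivity), div_eq_mul_inv]
  norm_cast

lemma tsum_moebius_div_sq :
    ∑' e : ℕ, (ArithmeticFunction.moebius e : ℝ) / (e:ℝ) ^ 2 = 6 / Real.pi ^ 2 := by
  have h := LSeries_one_mul_Lseries_moebius (s := 2) (by norm_num)
  rw [LSeries_one_eq_riemannZeta (by norm_num), riemannZeta_two] at h
  have e1 : LSeries (fun n => ((ArithmeticFunction.moebius n : ℤ) : ℂ)) 2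
      = ((∑' e : ℕ, (ArithmeticFunction.moebius e : ℝ) / (e:ℝ) ^ 2 : ℝ) : ℂ) := by
    rw [LSeries, Complex.ofReal_tsum]
    refine tsum_congr fun n => ?_
    rcases Nat.eq_zero_or_pos n with rfl | hn
    · simp
    · rw [LSeries.term_of_ne_zero (by omega)]
      push_cast
      norm_cast
  rw [e1] at h
  have h' : Real.pi ^ 2 / 6 * (∑' e : ℕ, (ArithmeticFunction.moebius e : ℝ) / (e:ℝ) ^ 2) = 1 := by
    exact_mod_cast h
  have hpi := Real.pi_pos
  field_simp
  field_simp at h'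
  linarith

lemma sum_sum_choose (μ ν : ℕ) :
    (∑ i ∈ Finset.range (μ + 1), ∑ j ∈ Finset.range (ν + 1), ((Nat.choose (i + j) i : ℕ) : ℝ))
      = (Nat.choose (μ + ν + 2) (μ + 1) : ℝ) - 1 := by
  have h1 : ∀ i, ∑ j ∈ Finset.range (ν + 1), Nat.choose (i + j) i = Nat.choose (i + 1 + ν) ν := by
    intro i
    have := Nat.sum_range_add_choose ν i
    simp only [add_comm _ i] at this
    rw [this, show i + ν + 1 = (i + 1) + ν by ring, Nat.choose_symm_add]
  have h2 := Nat.sum_range_add_choose (μ + 1) ν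
  rw [Finset.sum_range_succ', show μ + 1 + ν + 1 = (μ + 1) + (ν + 1) by ring] at h2
  simp only [zero_add, Nat.choose_self] at h2
  rw [show μ + ν + 2 = (μ + 1) + (ν + 1) by ring, Nat.choose_symm_add, ← h2]
  push_cast
  rw [add_sub_cancel_right]
  refine Finset.sum_congr rfl fun i _ => ?_
  rw [← h1]
  push_cast
  rfl

lemma choose_mul_factorials {μ ν i j : ℕ} (hi : i ≤ μ) (hj : j ≤ ν) :
    Nat.choose μ i * Nat.choose ν j *
      (Nat.factorial (ν - j) * Nat.factorial (i + j) * Nat.factorial (μ - i))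
      = Nat.factorial μ * Nat.factorial ν * Nat.choose (i + j) i := by
  rw [← Nat.choose_mul_factorial_mul_factorial hi, ← Nat.choose_mul_factorial_mul_factorial hj,
    ← Nat.add_choose_mul_factorial_mul_factorial i j, Nat.choose_symm_add]
  ring

lemma hasLogAsymptotic_moebius_hypSum {μ ν i j s : ℕ} (hi : i ≤ μ) (hj : j ≤ ν) (hs : s ≤ i + j) :
    HasLogAsymptotic (fun t => ∑ e ∈ Finset.Icc 1 ⌊t⌋₊,
        (ArithmeticFunction.moebius e : ℝ) / (e:ℝ) ^ 2 * Real.log e ^ s *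
          hypSum (fun l => dGen (ν - j) 0 l / l) (fun n => dGen (i + j - s) (μ - i) n / n)
            (⌊t⌋₊ / e ^ 2)) (μ + ν + 4)
      (if s = 0 then 6 / Real.pi ^ 2 * ((Nat.factorial (ν - j) * Nat.factorial (i + j) *
        Nat.factorial (μ - i) : ℕ) : ℝ) / (Nat.factorial (μ + ν + 4) : ℝ) else 0) := by
  obtain ⟨P, hP, hH⟩ := exists_hypSum_dGen_asymptotic (ν - j) 0 (i + j - s) (μ - i)
  have hD : ν - j + 0 + (i + j - s) + (μ - i) + 4 = μ + ν + 4 - s := by omega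
  rw [hD] at hP
  have main := exists_sum_weight_asymptotic (epsBound_moebius_div_sq s) (by simp)
    (by simp [hypSum]) hP hH
  split_ifs with h0
  · subst h0
    have e1 : ∑' e : ℕ, (ArithmeticFunction.moebius e : ℝ) / (e:ℝ) ^ 2 * Real.log e ^ 0
        = 6 / Real.pi ^ 2 := by
      simp only [pow_zero, mul_one]; exact tsum_moebius_div_sq
    rw [e1] at main
    have e2 : 6 / Real.pi ^ 2 * ((Nat.factorial (ν - j) * Nat.factorial (i + j) *
        Nat.factorial (μ - i) : ℕ) : ℝ) / (Nat.factorial (μ + ν + 4) : ℝ)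
        = (Nat.factorial (ν - j) : ℝ) * Nat.factorial 0 * Nat.factorial (i + j - 0) *
          Nat.factorial (μ - i) / Nat.factorial (μ + ν + 4 - 0) * (6 / Real.pi ^ 2) := by
      simp only [Nat.sub_zero, Nat.factorial_zero]
      push_cast
      ring
    rw [e2]
    exact main
  · exact HasLogAsymptotic.of_lt main (by omega)

theorem divisor_log_correlation_polynomial_special (μ ν : ℕ) :
    ∃ Q : Polynomial ℝ,
      Q.natDegree = μ + ν + 4 ∧
      Q.leadingCoeff =
        6 / Real.pi ^ 2 *
          ((Nat.factorial μ : ℝ) * (Nat.factorial ν : ℝ) / (Nat.factorial (μ + ν + 4) : ℝ) *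
            ((Nat.choose (μ + ν + 2) (μ + 1) : ℝ) - 1)) ∧
      ∀ ε : ℝ, 0 < ε → ∃ K : ℝ, 0 < K ∧ ∀ t : ℝ, 2 ≤ t →
        |(∑ n ∈ Finset.Icc 1 ⌊t⌋₊, dLog μ n * dLog ν n / n) -
            Q.eval (Real.log t)| ≤ K * t ^ (-(1:ℝ)/2 + ε) := by
  have main : HasLogAsymptotic (fun t => ∑ n ∈ Finset.Icc 1 ⌊t⌋₊, dLog μ n * dLog ν n / n)
      (μ + ν + 4) (6 / Real.pi ^ 2 *
          ((Nat.factorial μ : ℝ) * (Nat.factorial ν : ℝ) / (Nat.factorial (μ + ν + 4) : ℝ) *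
            ((Nat.choose (μ + ν + 2) (μ + 1) : ℝ) - 1))) := by
    simp only [sum_dLog_mul_dLog_eq_sum_hypSum]
    rw [← sum_sum_choose, Finset.mul_sum, Finset.mul_sum]
    refine HasLogAsymptotic.sum _ fun i hi => ?_
    rw [Finset.mul_sum, Finset.mul_sum]
    refine HasLogAsymptotic.sum _ fun j hj => ?_
    rw [Finset.mem_range] at hi hj
    have h := HasLogAsymptotic.sum (Finset.range (i + j + 1)) fun s hs =>
      (hasLogAsymptotic_moebius_hypSum (μ := μ) (ν := ν) (i := i) (j := j) (s := s) (by omega)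
        (by omega) (by rw [Finset.mem_range] at hs; omega)).const_mul
          ((Nat.choose μ i * Nat.choose ν j * Nat.choose (i + j) s : ℕ) : ℝ)
    simp only [mul_ite, mul_zero] at h
    rw [Finset.sum_ite_eq' (Finset.range (i + j + 1)) 0, if_pos (by simp)] at h
    convert h using 1
    rw [Nat.choose_zero_right, mul_one]
    have := congrArg (fun n : ℕ => (n : ℝ)) (choose_mul_factorials (μ := μ) (ν := ν) (i := i)
      (j := j) (by omega) (by omega))
    push_cast at this ⊢
    linear_combination -(6 / Real.pi ^ 2 / (Nat.factorial (μ + ν + 4) : ℝ)) * this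
  obtain ⟨Q, hQ, h⟩ := main
  have hc : (1:ℝ) < Nat.choose (μ + ν + 2) (μ + 1) := by
    have := Nat.choose_le_choose (μ + 1) (show μ + 2 ≤ μ + ν + 2 by omega)
    rw [show μ + 2 = (μ + 1) + 1 by ring, Nat.choose_succ_self_right] at this
    exact_mod_cast (by omega : 1 < Nat.choose (μ + ν + 2) (μ + 1))
  have hne : Q.coeff (μ + ν + 4) ≠ 0 := by
    rw [hQ.2]
    have := Real.pi_pos
    have := sub_pos.2 hc
    positivity
  have hdeg : Q.natDegree = μ + ν + 4 := le_antisymm hQ.1 (Polynomial.le_natDegree_of_ne_zero hne)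
  refine ⟨Q, hdeg, by rw [Polynomial.leadingCoeff, hdeg, hQ.2], fun ε hε => ?_⟩
  obtain ⟨K, hK, h⟩ := h ε hε
  exact ⟨K, hK, fun t ht => h t (by linarith)⟩
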